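/- Let d ≥ 2 and let Γ ≤ SL_d(ℤ) be a countably infinite subgroup that is Zariski dense in SL_d(ℝ). Then there exists a free p.m.p. action β of Γ on an atomless standard probability space such that multiplication by the weak equivalence class of β is discontinuous; sequentially: there exist free p.m.p. actions α_i (i ∈ ℕ) and α of Γ on atomless standard probability spaces such that dist_H(C(α_i,S,k), C(α,S,k)) → 0 as i → ∞ for every finite S ⊆ Γ and every k ∈ ℕ⁺, while for some finite S ⊆ Γ and some k ∈ ℕ⁺ the sequence dist_H(C(α_i×β,S,k), C(α×β,S,k)) does not converge to 0. -/

import Mathlib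

open MeasureTheory Filter Topology

/-- A probability-measure-preserving (p.m.p.) action of a group `Γ`,
bundled together with the probability space it acts on. -/
structure PMP (Γ : Type) [Group Γ] where
  /-- the underlying space -/
  X : Type
  /-- the σ-algebra -/
  [mX : MeasurableSpace X]
  /-- the measure -/
  μ : @Measure X mX
  /-- the measure is a probability measure -/
  [prob : IsProbabilityMeasure μ]
  /-- the action map -/
  act : Γ → X → X
  one_act : ∀ x, act 1 x = x
  mul_act : ∀ γ δ x, act (γ * δ) x = act γ (act δ x)
  /-- each group element acts by a measure-preserving (in particular measurable) map -/
  preserves : ∀ γ, MeasurePreserving (act γ) μ μ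

attribute [instance] PMP.mX PMP.prob

variable {Γ : Type} [Group Γ]

/-- A p.m.p. action is free if almost every point has trivial stabilizer. -/
def PMP.Free (a : PMP Γ) : Prop :=
  a.μ {x | ∀ γ : Γ, γ ≠ 1 → a.act γ x ≠ x} = 1

/-- The vector `M^α_{S,k}[f] ∈ [0,1]^{S×k×k}`, defined by
`M^α_{S,k}[f](γ,i,j) = μ {x | f x = i ∧ f (γ • x) = j}`. -/
noncomputable def PMP.M (a : PMP Γ) (S : Finset Γ) (k : ℕ) (f : a.X → Fin k) :
    ↥S × Fin k × Fin k → ℝ :=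
  fun q => (a.μ {x | f x = q.2.1 ∧ f (a.act (q.1 : Γ) x) = q.2.2}).toReal

/-- `C(α,S,k)`: the closure of the set of vectors `M^α_{S,k}[f]`, where `f` ranges over
measurable maps `X → k`, taken in `[0,1]^{S×k×k}`.  (The space `↥S × Fin k × Fin k → ℝ`
carries the sup metric `dist_∞`, since the product distance on a finite product of copies
of `ℝ` is the max of the coordinate distances.) -/
noncomputable def PMP.C (a : PMP Γ) (S : Finset Γ) (k : ℕ) :
    Set (↥S × Fin k × Fin k → ℝ) :=
  closure {v | ∃ f : a.X → Fin k, Measurable f ∧ a.M S k f = v}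

/-- The product of two p.m.p. actions:  `γ • (x, y) = (γ • x, γ • y)` on `(X × Y, μ × ν)`. -/
noncomputable def PMP.prod (a b : PMP Γ) : PMP Γ where
  X := a.X × b.X
  μ := a.μ.prod b.μ
  act γ p := (a.act γ p.1, b.act γ p.2)
  one_act := by intro p; simp [a.one_act, b.one_act]
  mul_act := by intro γ δ p; simp [a.mul_act, b.mul_act]
  preserves γ := (a.preserves γ).prod (b.preserves γ)

/-- A subgroup `Γ ≤ SL_d(ℤ)` is Zariski dense in `SL_d(ℝ)` if every polynomial with real
coefficients in the `d²` matrix entries that vanishes on `Γ` vanishes on all of `SL_d(ℝ)`. -/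
def ZariskiDense (d : ℕ) (Γ : Subgroup (Matrix.SpecialLinearGroup (Fin d) ℤ)) : Prop :=
  ∀ P : MvPolynomial (Fin d × Fin d) ℝ,
    (∀ γ ∈ Γ, MvPolynomial.eval
        (fun ij => ((γ : Matrix (Fin d) (Fin d) ℤ) ij.1 ij.2 : ℝ)) P = 0) →
    ∀ A : Matrix.SpecialLinearGroup (Fin d) ℝ,
      MvPolynomial.eval (fun ij => (A : Matrix (Fin d) (Fin d) ℝ) ij.1 ij.2) P = 0

namespace FreeGroup

/-- The inverse letter. -/
def bar {ι : Type*} (a : ι × Bool) : ι × Bool := (a.1, !a.2)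

theorem bar_bar {ι : Type*} (a : ι × Bool) : bar (bar a) = a := by simp [bar]

theorem bar_ne {ι : Type*} (a : ι × Bool) : bar a ≠ a := by
  intro h; have := congrArg Prod.snd h; simp [bar] at this

theorem mk_bar {ι : Type*} (a : ι × Bool) : (mk [bar a] : FreeGroup ι) = (mk [a])⁻¹ := by
  simp [bar, inv_mk, invRev]

variable {ι : Type*} [DecidableEq ι]

/-- The first letter of a word. -/
def hd (w : FreeGroup ι) : Option (ι × Bool) := w.toWord.head?

theorem hd_one : hd (1 : FreeGroup ι) = none := by simp [hd]

theorem hd_eq_none {w : FreeGroup ι} : hd w = none ↔ w = 1 := by simp [hd]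

theorem toWord_mk_mul {a : ι × Bool} {w : FreeGroup ι} (h : hd w ≠ some (bar a)) :
    (mk [a] * w).toWord = a :: w.toWord := by
  unfold hd at h
  simp only [toWord_mul, toWord_mk, reduce.cons, reduce_nil, List.cons_append, List.nil_append,
    reduce_toWord]
  cases hw : w.toWord with
  | nil => simp
  | cons b l =>
    rw [hw] at h
    simp only [List.head?_cons, ne_eq, Option.some.injEq] at h
    have : ¬ (a.1 = b.1 ∧ a.2 = !b.2) := by
      rintro ⟨h1, h2⟩
      exact h (by ext <;> simp [bar, h1, h2])
    simp [this]

theorem hd_mk_mul {a : ι × Bool} {w : FreeGroup ι} (h : hd w ≠ some (bar a)) :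
    hd (mk [a] * w) = some a := by
  rw [hd, toWord_mk_mul h]; rfl

theorem exists_of_toWord_cons {w : FreeGroup ι} {a : ι × Bool} {l : List (ι × Bool)}
    (h : w.toWord = a :: l) : ∃ v : FreeGroup ι, w = mk [a] * v ∧ v.toWord = l ∧
      hd v ≠ some (bar a) := by
  have hr : IsReduced (a :: l) := h ▸ isReduced_toWord
  refine ⟨mk l, ?_, ?_, ?_⟩
  · rw [mul_mk, ← mk_toWord (x := w), h]; rfl
  · rw [toWord_mk]
    cases l with
    | nil => rfl
    | cons b l => exact (isReduced_cons_cons.mp hr).2.reduce_eq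
  · rw [hd, toWord_mk]
    cases l with
    | nil => simp
    | cons b l =>
      obtain ⟨h1, h2⟩ := isReduced_cons_cons.mp hr
      rw [h2.reduce_eq]
      simp only [List.head?_cons, ne_eq, Option.some.injEq]
      rintro rfl
      have := h1 rfl
      simp [bar] at this

theorem exists_of_hd {w : FreeGroup ι} {a : ι × Bool} (h : hd w = some a) :
    ∃ v : FreeGroup ι, w = mk [a] * v ∧ hd v ≠ some (bar a) := by
  obtain ⟨l, hl⟩ := List.head?_eq_some_iff.mp h
  obtain ⟨v, h1, _, h2⟩ := exists_of_toWord_cons hl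
  exact ⟨v, h1, h2⟩

theorem hd_mk (a : ι × Bool) : hd (mk [a] : FreeGroup ι) = some a := by simp [hd]

theorem hd_mul_mk (b : ι × Bool) : ∀ (l : List (ι × Bool)) (t : ι × Bool) (y : FreeGroup ι),
    y.toWord = t :: l → hd (y * mk [b]) = none ∨ hd (y * mk [b]) = some t := by
  intro l
  induction l with
  | nil =>
    intro t y hy
    obtain ⟨v, rfl, hv, _⟩ := exists_of_toWord_cons hy
    rw [toWord_eq_nil_iff] at hv
    subst hv
    by_cases hb : b = bar t
    · left; rw [hb, mk_bar, mul_one, mul_inv_cancel, hd_one]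
    · right; rw [mul_one]; apply hd_mk_mul; rw [hd_mk]; simpa using hb
  | cons t' l ih =>
    intro t y hy
    obtain ⟨v, rfl, hv, hv'⟩ := exists_of_toWord_cons hy
    right
    rw [mul_assoc]
    apply hd_mk_mul
    rcases ih t' v hv with h | h <;> rw [h]
    · simp
    · intro h'; apply hv'; rw [hd, hv]; exact h'

theorem hd_conj {w : FreeGroup ι} {s : ι × Bool} (h1 : w ≠ 1) (h : hd w ≠ some (bar s)) :
    hd (mk [s] * w * (mk [s])⁻¹) = some s := by
  rw [← mk_bar]
  obtain ⟨t, ht⟩ : ∃ t, hd w = some t := Option.ne_none_iff_exists'.mp (mt hd_eq_none.mp h1)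
  obtain ⟨l, hl⟩ := List.head?_eq_some_iff.mp ht
  rw [mul_assoc]
  apply hd_mk_mul
  rcases hd_mul_mk (bar s) l t w hl with h' | h' <;> rw [h']
  · simp
  · rwa [← ht]

variable {Y : Type*} [MulAction (FreeGroup ι) Y]

/-- The letters with which infinitely many elements of the stabilizer of `y` start. -/
def stabLetters (y : Y) : Set (ι × Bool) :=
  {a | {w : FreeGroup ι | w • y = y ∧ hd w = some a}.Infinite}

theorem stabLetters_smul {y : Y} {s t : ι × Bool} (ht : t ∈ stabLetters y) (h : t ≠ bar s) :
    s ∈ stabLetters ((mk [s] : FreeGroup ι) • y) := by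
  refine (ht.image (f := fun w => mk [s] * w * (mk [s])⁻¹)
    (fun x _ y _ hxy => by simpa using hxy)).mono ?_
  rintro _ ⟨w, ⟨h1, h2⟩, rfl⟩
  refine ⟨by rw [mul_smul, inv_smul_smul, mul_smul, h1], hd_conj ?_ (by rw [h2]; simpa using h)⟩
  rintro rfl
  simp [hd_one] at h2

theorem bar_mem_stabLetters {y : Y} {s t : ι × Bool}
    (ht : t ∈ stabLetters ((mk [s] : FreeGroup ι) • y)) (h : t ≠ s) :
    bar s ∈ stabLetters y := by
  have := stabLetters_smul ht (s := bar s) (by rwa [bar_bar])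
  rwa [mk_bar, inv_smul_smul] at this

theorem stabLetters_nonempty [Finite ι] {y : Y} {w : FreeGroup ι} (hw : w • y = y) (h1 : w ≠ 1) :
    (stabLetters (ι := ι) y).Nonempty := by
  by_contra hne
  rw [Set.not_nonempty_iff_eq_empty] at hne
  have hfin : {w : FreeGroup ι | w • y = y}.Finite := by
    have : {w : FreeGroup ι | w • y = y} ⊆
        (⋃ a : ι × Bool, {w : FreeGroup ι | w • y = y ∧ hd w = some a}) ∪ {1} := by
      intro v hv
      rcases h : hd v with _ | a
      · right; exact hd_eq_none.mp h
      · left; exact Set.mem_iUnion.mpr ⟨a, hv, h⟩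
    refine Set.Finite.subset (Set.Finite.union (Set.finite_iUnion fun a => ?_)
      (Set.finite_singleton _)) this
    by_contra h
    have : a ∈ stabLetters (ι := ι) y := h
    rw [hne] at this
    exact this
  have hinj : Function.Injective fun n : ℕ => w ^ n := by
    rw [injective_pow_iff_not_isOfFinOrder]
    intro hfo
    exact h1 ((isOfFinOrder_iff_eq_one w).mp hfo)
  refine Set.infinite_range_of_injective hinj (hfin.subset ?_)
  rintro _ ⟨n, rfl⟩
  have : w ∈ MulAction.stabilizer (FreeGroup ι) y := hw
  exact (MulAction.stabilizer (FreeGroup ι) y).pow_mem this n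

/-- A ping-pong decomposition of an `FreeGroup ι`-set. -/
theorem exists_pingPong [Finite ι]
    (hY : ∀ y : Y, ∃ a : ι × Bool, {w : FreeGroup ι | w • y = y ∧ hd w = some a}.Finite) :
    ∃ P : ι × Bool → Set Y,
      (∀ s t, s ≠ t → Disjoint (P s) (P t)) ∧
      (∀ s t, t ≠ bar s → ∀ y ∈ P t, (mk [s] : FreeGroup ι) • y ∈ P s) ∧
      (∀ y, (∃ s, y ∈ P s) ∨ ∃ s, (mk [bar s] : FreeGroup ι) • y ∈ P (bar s)) := by
  classical
  let r : Y → Y := fun y => (Quotient.mk (MulAction.orbitRel (FreeGroup ι) Y) y).out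
  have hr1 : ∀ y, ∃ f : FreeGroup ι, y = f • r y := by
    intro y
    have : (MulAction.orbitRel (FreeGroup ι) Y).r (r y) y := Quotient.mk_out y
    obtain ⟨f, hf⟩ := MulAction.orbitRel_apply.mp this
    exact ⟨f⁻¹, by simp only at hf; rw [← hf, inv_smul_smul]⟩
  have hr2 : ∀ (f : FreeGroup ι) y, r (f • y) = r y := by
    intro f y
    have : Quotient.mk (MulAction.orbitRel (FreeGroup ι) Y) (f • y) =
        Quotient.mk (MulAction.orbitRel (FreeGroup ι) Y) y :=
      Quotient.sound (s := MulAction.orbitRel (FreeGroup ι) Y) ⟨f, rfl⟩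
    simp only [r, this]
  let triv : Y → Prop := fun y => ∀ w : FreeGroup ι, w • y = y → w = 1
  have htriv : ∀ (f : FreeGroup ι) y, triv y → triv (f • y) := by
    intro f y h w hw
    have := h (f⁻¹ * w * f) (by rw [mul_smul, mul_smul, hw, inv_smul_smul])
    have h2 : w = f * (f⁻¹ * w * f) * f⁻¹ := by group
    rw [h2, this]; simp
  have huniq : ∀ (f g : FreeGroup ι) y, triv y → f • r y = g • r y → f = g := by
    intro f g y hy h
    obtain ⟨k, hk⟩ := hr1 y
    have h3 : triv (r y) := by
      have := htriv k⁻¹ y hy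
      rwa [show k⁻¹ • y = r y by conv_lhs => rw [hk, inv_smul_smul]] at this
    have := h3 (g⁻¹ * f) (by rw [mul_smul, h, inv_smul_smul])
    exact (inv_mul_eq_one.mp this).symm
  have hnt : ∀ s y, stabLetters (ι := ι) y = {s} → ¬ triv y := by
    intro s y hy ht
    have h1 : s ∈ stabLetters y := by rw [hy]; rfl
    obtain ⟨w, hw1, hw2⟩ := h1.nonempty
    have := ht w hw1
    rw [this, hd_one] at hw2
    simp at hw2
  refine ⟨fun s => {y | stabLetters y = {s} ∨ triv y ∧ ∃ f : FreeGroup ι, y = f • r y ∧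
    hd f = some s}, ?_, ?_, ?_⟩
  · intro s t hst
    rw [Set.disjoint_left]
    rintro y (h | ⟨h, f, hf, hfs⟩) (h' | ⟨h', g, hg, hgs⟩)
    · rw [h] at h'; exact hst (Set.singleton_injective h')
    · exact hnt _ _ h h'
    · exact hnt _ _ h' h
    · have := huniq f g y h (hf.symm.trans hg)
      rw [this, hgs] at hfs
      exact hst (Option.some_injective _ hfs).symm
  · rintro s t hts y (h | ⟨h, f, hf, hft⟩)
    · left
      have hs : s ∈ stabLetters ((mk [s] : FreeGroup ι) • y) :=
        stabLetters_smul (t := t) (by rw [h]; rfl) hts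
      refine Set.eq_singleton_iff_unique_mem.mpr ⟨hs, fun x hx => ?_⟩
      by_contra hxs
      have := bar_mem_stabLetters hx hxs
      rw [h] at this
      exact hts this.symm
    · right
      refine ⟨htriv _ _ h, mk [s] * f, ?_, hd_mk_mul ?_⟩
      · rw [hr2, mul_smul, ← hf]
      · rw [hft]; simpa using hts
  · intro y
    by_cases ht : triv y
    · obtain ⟨f, hf⟩ := hr1 y
      rcases hfs : hd f with _ | s
      · right
        obtain ⟨a, _⟩ := hY y
        refine ⟨a, Or.inr ⟨htriv _ _ ht, mk [bar a], ?_, hd_mk _⟩⟩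
        rw [hr2]
        rw [hd_eq_none.mp hfs, one_smul] at hf
        rw [← hf]
      · left; exact ⟨s, Or.inr ⟨ht, f, hf, hfs⟩⟩
    · right
      obtain ⟨a, ha⟩ := hY y
      refine ⟨a, Or.inl ?_⟩
      have hay : a ∉ stabLetters (ι := ι) y := fun h => h ha
      obtain ⟨w, hw, hw1⟩ : ∃ w : FreeGroup ι, w • y = y ∧ w ≠ 1 := by
        by_contra hcon; push Not at hcon; exact ht hcon
      have hne : (stabLetters (ι := ι) ((mk [bar a] : FreeGroup ι) • y)).Nonempty := by
        refine stabLetters_nonempty (w := mk [bar a] * w * (mk [bar a])⁻¹) ?_ ?_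
        · rw [mul_smul, inv_smul_smul, mul_smul, hw]
        · rwa [Ne, conj_eq_one_iff]
      have hsub : ∀ b ∈ stabLetters (ι := ι) ((mk [bar a] : FreeGroup ι) • y), b = bar a := by
        intro b hb
        by_contra hba
        have := bar_mem_stabLetters hb hba
        rw [bar_bar] at this
        exact hay this
      obtain ⟨b, hb⟩ := hne
      refine Set.eq_singleton_iff_unique_mem.mpr ⟨hsub b hb ▸ hb, hsub⟩

/-- A uniform gap for almost invariant positive functionals on a set with a ping-pong
decomposition. -/
theorem functional_gap [Fintype ι] (hι : 2 ≤ Fintype.card ι)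
    (hY : ∀ y : Y, ∃ a : ι × Bool, {w : FreeGroup ι | w • y = y ∧ hd w = some a}.Finite)
    (M : (Y → ℝ) →ₗ[ℝ] ℝ) (hM : ∀ φ : Y → ℝ, (∀ y, 0 ≤ φ y) → 0 ≤ M φ) (ε : ℝ) (hε : 0 ≤ ε)
    (hinv : ∀ (a : ι × Bool) (φ : Y → ℝ), (∀ y, 0 ≤ φ y) → (∀ y, φ y ≤ 1) →
      |M (fun y => φ ((mk [a] : FreeGroup ι) • y)) - M φ| ≤ ε) :
    M (fun _ => 1) ≤ (2 * Fintype.card ι + 4) * ε := by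
  classical
  obtain ⟨P, hdisj, hmaps, hcov⟩ := exists_pingPong hY
  let p : ι × Bool → Y → ℝ := fun s => (P s).indicator 1
  have hp0 : ∀ s y, 0 ≤ p s y := fun s y => Set.indicator_nonneg (fun _ _ => zero_le_one) _
  have hp1 : ∀ s y, p s y ≤ 1 := fun s y => Set.indicator_le_self' (fun _ _ => zero_le_one) _
  have hmono : ∀ φ φ' : Y → ℝ, (∀ y, φ y ≤ φ' y) → M φ ≤ M φ' := by
    intro φ φ' h
    have := hM (φ' - φ) (fun y => sub_nonneg.mpr (h y))
    rw [map_sub] at this; linarith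
  set N := ∑ s, M (p s) with hN
  have hcardL : (Fintype.card (ι × Bool) : ℝ) = 2 * Fintype.card ι := by
    rw [Fintype.card_prod, Fintype.card_bool]; push_cast; ring
  have hdis' : ∀ (y : Y) (s : Finset (ι × Bool)), ∑ t ∈ s, p t y ≤ 1 := by
    intro y s
    by_cases h : ∃ t ∈ s, y ∈ P t
    · obtain ⟨t, ht, hy⟩ := h
      rw [Finset.sum_eq_single_of_mem t ht]
      · exact hp1 _ _
      · intro b _ hb
        exact Set.indicator_of_notMem (Set.disjoint_left.mp (hdisj t b hb.symm) hy) _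
    · push Not at h
      rw [Finset.sum_eq_zero]
      · exact zero_le_one
      · intro t ht; exact Set.indicator_of_notMem (h t ht) _
  have hkey : ∀ s, N - M (p (bar s)) - ε ≤ M (p s) := by
    intro s
    have h1 : M (fun y => ∑ t ∈ Finset.univ.erase (bar s), p t y) ≤
        M (fun y => p s ((mk [s] : FreeGroup ι) • y)) := by
      apply hmono
      intro y
      by_cases h : ∃ t ∈ Finset.univ.erase (bar s), y ∈ P t
      · obtain ⟨t, ht, hy⟩ := h
        have : p s ((mk [s] : FreeGroup ι) • y) = 1 :=
          Set.indicator_of_mem (hmaps s t (Finset.ne_of_mem_erase ht) y hy) _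
        rw [this]; exact hdis' _ _
      · push Not at h
        rw [Finset.sum_eq_zero]
        · exact hp0 _ _
        · intro t ht; exact Set.indicator_of_notMem (h t ht) _
    have h2 : (fun y => ∑ t ∈ Finset.univ.erase (bar s), p t y) =
        ∑ t ∈ Finset.univ.erase (bar s), p t := by ext y; simp
    rw [h2, map_sum] at h1
    have h3 := Finset.add_sum_erase Finset.univ (fun t => M (p t)) (Finset.mem_univ (bar s))
    have h4 := abs_le.mp (hinv s (p s) (hp0 s) (hp1 s))
    linarith [h4.1, h4.2]
  have hsum : ∑ s : ι × Bool, M (p (bar s)) = N :=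
    Fintype.sum_equiv ⟨bar, bar, bar_bar, bar_bar⟩ _ _ (fun _ => rfl)
  have hN1 : (2 * Fintype.card ι - 2 : ℝ) * N ≤ 2 * Fintype.card ι * ε := by
    have := Finset.sum_le_sum (fun s (_ : s ∈ Finset.univ) => hkey s)
    rw [Finset.sum_sub_distrib, Finset.sum_sub_distrib, hsum, ← hN] at this
    simp only [Finset.sum_const, Finset.card_univ, nsmul_eq_mul, hcardL] at this
    linarith
  have hcard2 : (2 : ℝ) ≤ Fintype.card ι := by exact_mod_cast hι
  have hN2 : N ≤ 2 * ε := by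
    have h0 : (2 * Fintype.card ι - 2 : ℝ) * N ≤ (2 * Fintype.card ι - 2 : ℝ) * (2 * ε) := by
      refine hN1.trans ?_
      nlinarith
    exact le_of_mul_le_mul_left h0 (by linarith)
  have hfin : M (fun _ => 1) ≤
      M (∑ s, p s + ∑ s, fun y => p (bar s) ((mk [bar s] : FreeGroup ι) • y)) := by
    apply hmono
    intro y
    simp only [Pi.add_apply, Finset.sum_apply]
    have h0 : 0 ≤ ∑ s, p s y := Finset.sum_nonneg fun s _ => hp0 s y
    have h0' : 0 ≤ ∑ s, p (bar s) ((mk [bar s] : FreeGroup ι) • y) :=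
      Finset.sum_nonneg fun s _ => hp0 _ _
    rcases hcov y with ⟨s, hs⟩ | ⟨s, hs⟩
    · have h1 : p s y = 1 := Set.indicator_of_mem hs _
      have := Finset.single_le_sum (f := fun s => p s y) (fun s _ => hp0 s y) (Finset.mem_univ s)
      linarith
    · have h1 : p (bar s) ((mk [bar s] : FreeGroup ι) • y) = 1 := Set.indicator_of_mem hs _
      have := Finset.single_le_sum
        (f := fun s => p (bar s) ((mk [bar s] : FreeGroup ι) • y))
        (fun s _ => hp0 _ _) (Finset.mem_univ s)
      linarith
  rw [map_add, map_sum, map_sum, ← hN] at hfin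
  have hlast : ∑ s, M (fun y => p (bar s) ((mk [bar s] : FreeGroup ι) • y)) ≤
      N + 2 * Fintype.card ι * ε := by
    have : ∀ s ∈ (Finset.univ : Finset (ι × Bool)),
        M (fun y => p (bar s) ((mk [bar s] : FreeGroup ι) • y)) ≤ M (p (bar s)) + ε := by
      intro s _
      have := abs_le.mp (hinv (bar s) (p (bar s)) (hp0 _) (hp1 _))
      linarith [this.2]
    have := Finset.sum_le_sum this
    rw [Finset.sum_add_distrib, hsum] at this
    simpa only [Finset.sum_const, Finset.card_univ, nsmul_eq_mul, hcardL] using this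
  linarith

end FreeGroup

namespace CommProj

open MvPolynomial
open FreeGroup (mk hd)

variable {V : Type*} [AddCommGroup V] [Module ℝ V] {Y : Type*}

theorem exists_aeval (P : Y → Module.End ℝ V) (hcomm : ∀ e e', P e * P e' = P e' * P e) :
    ∃ ρ : MvPolynomial Y ℝ →ₐ[ℝ] Module.End ℝ V, ∀ e, ρ (X e) = P e := by
  have h : IsMulCommutative (Algebra.adjoin ℝ (Set.range P)) :=
    Algebra.isMulCommutative_adjoin ℝ (by rintro _ ⟨a, rfl⟩ _ ⟨b, rfl⟩; exact hcomm a b)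
  let I : CommRing (Algebra.adjoin ℝ (Set.range P)) :=
    { (inferInstance : Ring (Algebra.adjoin ℝ (Set.range P))) with
      mul_comm := h.is_comm.comm }
  let I2 : Algebra ℝ (Algebra.adjoin ℝ (Set.range P)) := Subalgebra.algebra _
  let ρ : MvPolynomial Y ℝ →ₐ[ℝ] Algebra.adjoin ℝ (Set.range P) :=
    aeval (fun e => ⟨P e, Algebra.subset_adjoin ⟨e, rfl⟩⟩)
  refine ⟨(Subalgebra.val _).comp ρ, fun e => ?_⟩
  have : ρ (X e) = ⟨P e, Algebra.subset_adjoin ⟨e, rfl⟩⟩ := aeval_X _ _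
  simp only [AlgHom.comp_apply]
  erw [this]
  rfl

theorem abs_bilin_le (B : V →ₗ[ℝ] V →ₗ[ℝ] ℝ) (hs : ∀ f g, B f g = B g f) (hp : ∀ f, 0 ≤ B f f)
    (u v : V) (a b : ℝ) (ha : 0 ≤ a) (hb : 0 ≤ b) (hu : B u u ≤ a ^ 2) (hv : B v v ≤ b ^ 2) :
    |B u v| ≤ a * b := by
  have hq : ∀ t : ℝ, 0 ≤ B v v * (t * t) + 2 * B u v * t + B u u := by
    intro t
    have := hp (u + t • v)
    simp only [map_add, LinearMap.add_apply, map_smul, LinearMap.smul_apply, smul_eq_mul] at this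
    rw [hs v u] at this
    linarith
  have hd := discrim_le_zero hq
  rw [discrim] at hd
  have h1 : B u v ^ 2 ≤ (a * b) ^ 2 := by
    have : B u u * B v v ≤ a ^ 2 * b ^ 2 := mul_le_mul hu hv (hp v) (sq_nonneg a)
    nlinarith
  exact abs_le_of_sq_le_sq h1 (mul_nonneg ha hb)

/-- The average of `φ` over `T`. -/
noncomputable def avg (T : Finset Y) (φ : Y → ℝ) : ℝ := (∑ e ∈ T, φ e) / T.card

theorem avg_nonneg (T : Finset Y) {φ : Y → ℝ} (h : ∀ y, 0 ≤ φ y) : 0 ≤ avg T φ :=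
  div_nonneg (Finset.sum_nonneg fun e _ => h e) (Nat.cast_nonneg _)

theorem avg_le_one (T : Finset Y) {φ : Y → ℝ} (h : ∀ y, φ y ≤ 1) : avg T φ ≤ 1 := by
  refine div_le_one_of_le₀ ?_ (Nat.cast_nonneg _)
  simpa using Finset.sum_le_sum (fun e (_ : e ∈ T) => h e)

theorem avg_one {T : Finset Y} (hT : T ≠ ∅) : avg T (fun _ => 1) = 1 := by
  have : (T.card : ℝ) ≠ 0 := by simpa using hT
  simp [avg, this]

theorem avg_map (σ : Y ≃ Y) (T : Finset Y) (φ : Y → ℝ) :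
    avg (T.map σ.toEmbedding) φ = avg T (fun y => φ (σ y)) := by
  simp [avg]

section
variable [DecidableEq Y]

/-- The product of `1 - X e` over `T` and of `X e` over the rest of `W`. -/
noncomputable def Q (W T : Finset Y) : MvPolynomial Y ℝ :=
  (∏ e ∈ T, (1 - X e)) * ∏ e ∈ W \ T, X e

theorem sum_Q (W : Finset Y) : ∑ T ∈ W.powerset, Q W T = 1 := by
  have := Finset.prod_add (fun e : Y => (1 - X e : MvPolynomial Y ℝ)) (fun e => X e) W
  simp only [sub_add_cancel, Finset.prod_const_one] at this
  exact this.symm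

theorem rename_Q (σ : Y ≃ Y) (W T : Finset Y) :
    rename σ (Q W T) = Q (W.map σ.toEmbedding) (T.map σ.toEmbedding) := by
  simp [Q, map_prod, ← Finset.map_sdiff]

variable (ρ : MvPolynomial Y ℝ →ₐ[ℝ] Module.End ℝ V)

theorem fix_prod (f : V) (S : Finset Y) (h : ∀ e ∈ S, ρ (X e) f = f) :
    ρ (∏ e ∈ S, X e) f = f := by
  induction S using Finset.induction_on with
  | empty => simp
  | insert a s ha ih =>
    rw [Finset.prod_insert ha, map_mul, Module.End.mul_apply,
      ih (fun e he => h e (Finset.mem_insert_of_mem he)), h a (Finset.mem_insert_self _ _)]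

theorem Q_of_subset (f : V) {W W' T : Finset Y} (hW : W ⊆ W') (hT : T ⊆ W)
    (hf : ∀ e ∉ W, ρ (X e) f = f) : ρ (Q W' T) f = ρ (Q W T) f := by
  have h1 : W' \ T = (W \ T) ∪ (W' \ W) := by
    ext x; simp only [Finset.mem_sdiff, Finset.mem_union]
    constructor
    · rintro ⟨a, b⟩; by_cases hx : x ∈ W <;> simp [hx, a, b]
    · rintro (⟨a, b⟩ | ⟨a, b⟩)
      · exact ⟨hW a, b⟩
      · exact ⟨a, fun h => b (hT h)⟩
  have h2 : Disjoint (W \ T) (W' \ W) := by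
    rw [Finset.disjoint_left]; intro x hx hx'
    exact (Finset.mem_sdiff.mp hx').2 (Finset.mem_sdiff.mp hx).1
  rw [Q, h1, Finset.prod_union h2, ← mul_assoc, map_mul, Module.End.mul_apply,
    fix_prod ρ f _ (fun e he => hf e (Finset.mem_sdiff.mp he).2)]
  rfl

theorem Q_of_not_subset (f : V) {W W' T : Finset Y} (hT : ¬ T ⊆ W)
    (hf : ∀ e ∉ W, ρ (X e) f = f) : ρ (Q W' T) f = 0 := by
  obtain ⟨e, he, heW⟩ := Finset.not_subset.mp hT
  rw [Q, ← Finset.mul_prod_erase _ _ he, mul_assoc, mul_comm, map_mul, Module.End.mul_apply,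
    map_sub, LinearMap.sub_apply, hf e heW, map_one, Module.End.one_apply, sub_self, map_zero]

/-- The bilinear form `∑ T, avg_T φ * ⟨Q_T f, g⟩`. -/
noncomputable def form (B : V →ₗ[ℝ] V →ₗ[ℝ] ℝ) (W : Finset Y) (φ : Y → ℝ) :
    V →ₗ[ℝ] V →ₗ[ℝ] ℝ :=
  ∑ T ∈ W.powerset, avg T φ • (B.comp (ρ (Q W T)))

theorem form_apply (B : V →ₗ[ℝ] V →ₗ[ℝ] ℝ) (W : Finset Y) (φ : Y → ℝ) (f g : V) :
    form ρ B W φ f g = ∑ T ∈ W.powerset, avg T φ * B (ρ (Q W T) f) g := by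
  simp [form, LinearMap.sum_apply]

theorem form_extend (B : V →ₗ[ℝ] V →ₗ[ℝ] ℝ) {W W' : Finset Y} (hW : W ⊆ W') (φ : Y → ℝ) (f g : V)
    (hf : ∀ e ∉ W, ρ (X e) f = f) : form ρ B W' φ f g = form ρ B W φ f g := by
  rw [form_apply, form_apply]
  symm
  refine Finset.sum_subset_zero_on_sdiff (Finset.powerset_mono.mpr hW) ?_ ?_
  · intro T hT
    rw [Q_of_not_subset ρ f (fun h => (Finset.mem_sdiff.mp hT).2 (Finset.mem_powerset.mpr h)) hf]
    simp
  · intro T hT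
    rw [Q_of_subset ρ f hW (Finset.mem_powerset.mp hT) hf]

end

/-- Spectral gap for commuting projections permuted by a free group acting with small
stabilizers. -/
theorem gap {ι : Type*} [DecidableEq ι] [Fintype ι] (hι : 2 ≤ Fintype.card ι)
    [MulAction (FreeGroup ι) Y]
    (hY : ∀ y : Y, ∃ a : ι × Bool, {w : FreeGroup ι | w • y = y ∧ hd w = some a}.Finite)
    (B : V →ₗ[ℝ] V →ₗ[ℝ] ℝ) (hs : ∀ f g, B f g = B g f) (hp : ∀ f, 0 ≤ B f f)
    (P : Y → Module.End ℝ V) (hcomm : ∀ e e' f, P e (P e' f) = P e' (P e f))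
    (hid : ∀ e f, P e (P e f) = P e f)
    (hself : ∀ e f g, B (P e f) g = B f (P e g))
    (U : ι × Bool → Module.End ℝ V) (hU : ∀ a f g, B (U a f) (U a g) = B f g)
    (hUP : ∀ a e f, U a (P e f) = P ((mk [a] : FreeGroup ι) • e) (U a f))
    (f : V) (W : Finset Y) (hf : ∀ e ∉ W, P e f = f) (ε : ℝ) (hε : 0 ≤ ε)
    (hf1 : B f f ≤ 1) (hUf : ∀ a, B (f - U a f) (f - U a f) ≤ ε ^ 2) :
    ∃ l : List Y, (∀ e, P e ((l.map P).prod f) = (l.map P).prod f) ∧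
      B (f - (l.map P).prod f) (f - (l.map P).prod f) ≤ (2 * Fintype.card ι + 4) * (2 * ε) := by
  classical
  obtain ⟨ρ, hρ⟩ := exists_aeval P (fun e e' => LinearMap.ext fun f => hcomm e e' f)
  have hself' : ∀ (q : MvPolynomial Y ℝ) f g, B (ρ q f) g = B f (ρ q g) := by
    intro q
    induction q using MvPolynomial.induction_on with
    | C a => intro f g; simp [← MvPolynomial.algebraMap_eq, Module.algebraMap_end_apply]
    | add p q hp hq => intro f g; simp [hp, hq]
    | mul_X p e hp =>
      intro f g
      rw [map_mul, Module.End.mul_apply, hp, hρ, hself, ← Module.End.mul_apply, ← hρ,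
        ← _root_.map_mul ρ, mul_comm (X e) p, _root_.map_mul ρ]
  have hUρ : ∀ a (q : MvPolynomial Y ℝ) f, U a (ρ q f) =
      ρ (rename (MulAction.toPerm (mk [a] : FreeGroup ι)) q) (U a f) := by
    intro a q
    induction q using MvPolynomial.induction_on with
    | C a => intro f; simp [← MvPolynomial.algebraMap_eq, Module.algebraMap_end_apply]
    | add p q hp hq => intro f; simp [hp, hq]
    | mul_X p e hp =>
      intro f
      simp only [map_mul, Module.End.mul_apply, hp, hρ, hUP, rename_X, MulAction.toPerm_apply]
  have hidem : ∀ W T : Finset Y, IsIdempotentElem (ρ (Q W T)) := by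
    have hmul : ∀ p q, IsIdempotentElem (ρ p) → IsIdempotentElem (ρ q) →
        IsIdempotentElem (ρ (p * q)) := by
      intro p q hp hq
      rw [map_mul]
      refine hp.mul_of_commute ?_ hq
      rw [Commute, SemiconjBy, ← map_mul, mul_comm, map_mul]
    have hX : ∀ e, IsIdempotentElem (ρ (X e)) := fun e => by
      rw [hρ]; exact LinearMap.ext fun f => hid e f
    have hone : IsIdempotentElem (ρ 1) := by rw [map_one]; exact IsIdempotentElem.one
    intro W T
    refine hmul _ _ ?_ ?_
    · refine Finset.prod_induction _ (fun q => IsIdempotentElem (ρ q)) hmul hone ?_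
      intro e _
      rw [map_sub, map_one]; exact (hX e).one_sub
    · exact Finset.prod_induction _ (fun q => IsIdempotentElem (ρ q)) hmul hone fun e _ => hX e
  have hQ0 : ∀ W T f, 0 ≤ B (ρ (Q W T) f) f := by
    intro W T f
    rw [← (hidem W T), Module.End.mul_apply, hself']
    exact hp _
  have hfs : ∀ W φ f g, form ρ B W φ f g = form ρ B W φ g f := by
    intro W φ f g
    rw [form_apply, form_apply]
    exact Finset.sum_congr rfl fun T _ => by rw [hself', hs]
  have hfp : ∀ W φ, (∀ y, 0 ≤ φ y) → ∀ f, 0 ≤ form ρ B W φ f f := by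
    intro W φ h f
    rw [form_apply]
    exact Finset.sum_nonneg fun T _ => mul_nonneg (avg_nonneg T h) (hQ0 _ _ _)
  have hsumQ : ∀ W f, ∑ T ∈ W.powerset, B (ρ (Q W T) f) f = B f f := by
    intro W f
    have := congrArg (fun q => B (ρ q f) f) (sum_Q W)
    simpa [map_sum, LinearMap.sum_apply] using this
  have hfle : ∀ W φ, (∀ y, φ y ≤ 1) → ∀ f, form ρ B W φ f f ≤ B f f := by
    intro W φ h f
    rw [form_apply, ← hsumQ W f]
    exact Finset.sum_le_sum fun T _ => mul_le_of_le_one_left (hQ0 _ _ _) (avg_le_one T h)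
  let M : (Y → ℝ) →ₗ[ℝ] ℝ :=
    { toFun := fun φ => form ρ B W φ f f
      map_add' := fun φ φ' => by
        simp only [form_apply, ← Finset.sum_add_distrib, ← add_mul]
        refine Finset.sum_congr rfl fun T _ => ?_
        simp [avg, Finset.sum_add_distrib, add_div]
      map_smul' := fun c φ => by
        simp only [form_apply, RingHom.id_apply, smul_eq_mul, Finset.mul_sum, ← mul_assoc]
        refine Finset.sum_congr rfl fun T _ => ?_
        simp [avg, ← Finset.mul_sum, mul_div_assoc] }
  have hM : M (fun _ => 1) ≤ (2 * Fintype.card ι + 4) * (2 * ε) := by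
    refine FreeGroup.functional_gap hι hY M (fun φ h => hfp W φ h f) (2 * ε) (by positivity) ?_
    intro a φ h0 h1
    set σ : Y ≃ Y := MulAction.toPerm (mk [a] : FreeGroup ι) with hσ
    have e1 : M (fun y => φ ((mk [a] : FreeGroup ι) • y)) =
        form ρ B (W.map σ.toEmbedding) φ (U a f) (U a f) := by
      change form ρ B W (fun y => φ (σ y)) f f = _
      rw [form_apply, form_apply]
      refine Finset.sum_nbij' (fun T => T.map σ.toEmbedding) (fun T => T.map σ.symm.toEmbedding)
        ?_ ?_ ?_ ?_ ?_
      · intro T hT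
        exact Finset.mem_powerset.mpr (Finset.map_subset_map.mpr (Finset.mem_powerset.mp hT))
      · intro T hT
        rw [Finset.mem_powerset, ← Finset.map_subset_map (f := σ.toEmbedding), Finset.map_map]
        simpa using hT
      · intro T _; simp [Finset.map_map]
      · intro T _; simp [Finset.map_map]
      · intro T _
        rw [avg_map, ← rename_Q, ← hUρ, hU]
    have hUfix : ∀ e ∉ W.map σ.toEmbedding, ρ (X e) (U a f) = U a f := by
      intro e he
      have : e = (mk [a] : FreeGroup ι) • ((mk [a] : FreeGroup ι)⁻¹ • e) :=
        (smul_inv_smul _ _).symm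
      rw [hρ, this, ← hUP, hf]
      intro h
      apply he
      rw [Finset.mem_map]
      exact ⟨_, h, smul_inv_smul (mk [a] : FreeGroup ι) e⟩
    rw [e1]
    change |_ - form ρ B W φ f f| ≤ _
    rw [← form_extend ρ B (Finset.subset_union_left (s₂ := W)) φ (U a f) (U a f) hUfix,
      ← form_extend ρ B (Finset.subset_union_right (s₁ := W.map σ.toEmbedding)) φ f f
        (fun e he => by rw [hρ]; exact hf e he)]
    set W' := W.map σ.toEmbedding ∪ W
    have e2 : form ρ B W' φ (U a f) (U a f) - form ρ B W' φ f f =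
        -form ρ B W' φ (f - U a f) (f + U a f) := by
      simp only [map_sub, map_add, LinearMap.sub_apply]
      rw [hfs W' φ (U a f) f]; ring
    rw [e2, abs_neg, mul_comm 2 ε]
    refine abs_bilin_le _ (hfs W' φ) (hfp W' φ h0) _ _ ε 2 hε (by norm_num)
      ((hfle W' φ h1 _).trans (hUf a)) ((hfle W' φ h1 _).trans ?_)
    have h3 := hp (f - U a f)
    have h4 := hU a f f
    simp only [map_sub, map_add, LinearMap.sub_apply, LinearMap.add_apply] at h3 ⊢
    linarith
  have hl : (W.toList.map P).prod = ρ (Q W ∅) := by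
    rw [Q, Finset.prod_empty, one_mul, Finset.sdiff_empty, ← Finset.prod_map_toList, map_list_prod,
      List.map_map]
    congr 1
    exact List.map_congr_left fun e _ => (hρ e).symm
  refine ⟨W.toList, fun e => ?_, ?_⟩
  · rw [hl, ← hρ, ← Module.End.mul_apply, ← map_mul]
    by_cases he : e ∈ W
    · rw [Q, Finset.prod_empty, one_mul, Finset.sdiff_empty, ← Finset.mul_prod_erase _ _ he,
        ← mul_assoc, map_mul, map_mul, hρ]
      rw [show P e * P e = P e from LinearMap.ext fun f => hid e f, ← hρ, ← map_mul]
    · rw [mul_comm, map_mul, Module.End.mul_apply, hρ, hf e he]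
  · rw [hl]
    have h1 : M (fun _ => 1) = B f f - B (ρ (Q W ∅) f) f := by
      change form ρ B W _ f f = _
      rw [form_apply, ← hsumQ W f, ← Finset.add_sum_erase _ _ (Finset.empty_mem_powerset W),
        ← Finset.add_sum_erase _ (fun T => B (ρ (Q W T) f) f) (Finset.empty_mem_powerset W)]
      rw [Finset.sum_congr rfl (g := fun T => B (ρ (Q W T) f) f)]
      · simp [avg]
      · intro T hT
        rw [avg_one (Finset.ne_of_mem_erase hT), one_mul]
    have h2 : B (ρ (Q W ∅) f) (ρ (Q W ∅) f) = B (ρ (Q W ∅) f) f := by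
      rw [← hself', ← Module.End.mul_apply, hidem]
    have h3 : B f (ρ (Q W ∅) f) = B (ρ (Q W ∅) f) f := hs _ _
    simp only [map_sub, LinearMap.sub_apply]
    rw [h2, h3]
    linarith

end CommProj

namespace RelT

open Finset

section Quadrant

variable {n : ℕ}

/-- Both coordinates have small representatives. -/
def Good (x : ZMod n × ZMod n) : Prop :=
  6 * |x.1.valMinAbs| < n ∧ 6 * |x.2.valMinAbs| < n

theorem Good.add [NeZero n] {x : ZMod n × ZMod n} (h : Good x) :
    (x.1 + x.2).valMinAbs = x.1.valMinAbs + x.2.valMinAbs := by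
  obtain ⟨h1, h2⟩ := h
  rw [abs_eq_max_neg] at h1 h2
  rw [ZMod.valMinAbs_spec]
  refine ⟨by push_cast; simp, ?_, ?_⟩ <;> omega

open scoped Classical in
theorem sum_quadrant [NeZero n] (ν : ZMod n × ZMod n → ℝ) (hν : ∀ x, 0 ≤ ν x) {δ η : ℝ}
    (hU : ∀ A : Finset (ZMod n × ZMod n), ∑ x ∈ A, ν x ≤ ∑ x ∈ A, ν (x.1 + x.2, x.2) + δ)
    (hL : ∀ A : Finset (ZMod n × ZMod n), ∑ x ∈ A, ν x ≤ ∑ x ∈ A, ν (x.1, x.1 + x.2) + δ)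
    (hbad : ∑ x with ¬ Good x, ν x ≤ η) :
    ∑ x with 0 < x.1.valMinAbs * x.2.valMinAbs, ν x +
      ∑ x with x.1 = 0 ∧ x.2 ≠ 0, ν x ≤ 2 * δ + 2 * η := by
  set P : Finset (ZMod n × ZMod n) := {x | 0 < x.1.valMinAbs * x.2.valMinAbs} with hP
  set Z : Finset (ZMod n × ZMod n) := {x | x.1 = 0 ∧ x.2 ≠ 0} with hZ
  set N : Finset (ZMod n × ZMod n) := {x | ¬ Good x} with hN
  set A : Finset (ZMod n × ZMod n) := (P ∪ Z) \ N with hA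
  set A' : Finset (ZMod n × ZMod n) := P \ N with hA'
  have hPZ : Disjoint P Z := by
    rw [Finset.disjoint_left]
    intro x h1 h2
    simp only [hP, hZ, mem_filter, mem_univ, true_and] at h1 h2
    rw [h2.1] at h1
    simp at h1
  have h1 : ∑ x ∈ P, ν x + ∑ x ∈ Z, ν x ≤ ∑ x ∈ A, ν x + η := by
    rw [← sum_union hPZ]
    have : P ∪ Z ⊆ A ∪ N := by
      intro x hx
      simp only [hA, mem_union, Finset.mem_sdiff] at hx ⊢
      tauto
    calc _ ≤ ∑ x ∈ A ∪ N, ν x := sum_le_sum_of_subset_of_nonneg this fun x _ _ => hν x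
      _ ≤ ∑ x ∈ A, ν x + ∑ x ∈ N, ν x := by
        rw [← sum_union_inter]
        have := sum_nonneg (s := A ∩ N) fun x _ => hν x
        linarith
      _ ≤ _ := by linarith
  have h2 : ∑ x ∈ P, ν x ≤ ∑ x ∈ A', ν x + η := by
    have : P ⊆ A' ∪ N := by
      intro x hx
      simp only [hA', mem_union, Finset.mem_sdiff] at hx ⊢
      tauto
    calc _ ≤ ∑ x ∈ A' ∪ N, ν x := sum_le_sum_of_subset_of_nonneg this fun x _ _ => hν x
      _ ≤ ∑ x ∈ A', ν x + ∑ x ∈ N, ν x := by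
        rw [← sum_union_inter]
        have := sum_nonneg (s := A' ∩ N) fun x _ => hν x
        linarith
      _ ≤ _ := by linarith
  have key : ∑ x ∈ A, ν (x.1 + x.2, x.2) + ∑ x ∈ A', ν (x.1, x.1 + x.2) ≤ ∑ x ∈ P, ν x := by
    rw [← sum_image (s := A) (g := fun x : ZMod n × ZMod n => (x.1 + x.2, x.2)) (f := ν),
      ← sum_image (s := A') (g := fun x : ZMod n × ZMod n => (x.1, x.1 + x.2)) (f := ν),
      ← sum_union]
    · refine sum_le_sum_of_subset_of_nonneg ?_ fun x _ _ => hν x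
      intro x hx
      rw [mem_union, mem_image, mem_image] at hx
      rcases hx with ⟨y, hy, rfl⟩ | ⟨y, hy, rfl⟩
      · simp only [hA, hP, hZ, hN, Finset.mem_sdiff, mem_union, mem_filter, mem_univ, true_and,
          not_not] at hy ⊢
        rw [hy.2.add]
        rcases hy.1 with h | ⟨h, h'⟩
        · nlinarith [mul_self_nonneg y.2.valMinAbs]
        · rw [h, ZMod.valMinAbs_zero, zero_add]
          have : y.2.valMinAbs ≠ 0 := by rwa [Ne, ZMod.valMinAbs_eq_zero]
          exact mul_self_pos.mpr this
      · simp only [hA', hP, hN, Finset.mem_sdiff, mem_filter, mem_univ, true_and,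
          not_not] at hy ⊢
        rw [hy.2.add]
        nlinarith [mul_self_nonneg y.1.valMinAbs]
    · rw [Finset.disjoint_left]
      rintro x hx hx'
      rw [mem_image] at hx hx'
      obtain ⟨y, hy, rfl⟩ := hx
      obtain ⟨z, hz, h⟩ := hx'
      simp only [hA, hA', hP, hZ, hN, Finset.mem_sdiff, mem_union, mem_filter, mem_univ, true_and,
          not_not] at hy hz
      have e1 := congrArg (fun x => x.1.valMinAbs) h
      have e2 := congrArg (fun x => x.2.valMinAbs) h
      simp only [hy.2.add, hz.2.add] at e1 e2
      have hz1 := hz.1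
      have hy0 : 0 ≤ y.1.valMinAbs * y.2.valMinAbs := by
        rcases hy.1 with h | ⟨h, -⟩
        · exact h.le
        · rw [h]; simp
      rw [e1] at e2 hz1
      have : y.1.valMinAbs = - z.2.valMinAbs := by linarith
      rw [this] at hz1 hy0
      nlinarith [mul_self_nonneg z.2.valMinAbs]
    · intro x _ y _ h
      simp only [Prod.mk.injEq] at h
      ext1
      · exact h.1
      · have := h.2; rw [h.1] at this; exact add_left_cancel this
    · intro x _ y _ h
      simp only [Prod.mk.injEq] at h
      ext1
      · have := h.1; rw [h.2] at this; exact add_right_cancel this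
      · exact h.2
  have h3 := hU A
  have h4 := hL A'
  linarith

end Quadrant

end RelT

namespace RelT

open Finset ComplexConjugate

/-- Sum of all values of `ν` away from the origin. -/
theorem sum_ne_zero {n : ℕ} [NeZero n] (ν : ZMod n × ZMod n → ℝ) (hν : ∀ x, 0 ≤ ν x) {δ η₁ η₂ : ℝ}
    (hU : ∀ A : Finset (ZMod n × ZMod n), |∑ x ∈ A, ν (x.1 + x.2, x.2) - ∑ x ∈ A, ν x| ≤ δ)
    (hL : ∀ A : Finset (ZMod n × ZMod n), |∑ x ∈ A, ν (x.1, x.1 + x.2) - ∑ x ∈ A, ν x| ≤ δ)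
    (h₁ : ∑ x with (n : ℤ) ≤ 6 * |x.1.valMinAbs|, ν x ≤ η₁)
    (h₂ : ∑ x with (n : ℤ) ≤ 6 * |x.2.valMinAbs|, ν x ≤ η₂) :
    ∑ x with x ≠ 0, ν x ≤ 6 * δ + 7 * (η₁ + η₂) := by
  classical
  have hbad : ∑ x with ¬ Good x, ν x ≤ η₁ + η₂ := by
    refine le_trans ?_ (add_le_add h₁ h₂)
    rw [← sum_union_inter]
    refine le_trans (sum_le_sum_of_subset_of_nonneg (t := _ ∪ _) ?_ fun x _ _ => hν x)
      (le_add_of_nonneg_right (sum_nonneg fun x _ => hν x))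
    intro x hx
    simp only [Good, mem_filter, mem_univ, true_and, mem_union, not_and_or, not_lt] at hx ⊢
    exact hx
  have hU' : ∀ A : Finset (ZMod n × ZMod n),
      |∑ x ∈ A, ν (x.1 - x.2, x.2) - ∑ x ∈ A, ν x| ≤ δ := by
    intro A
    have := hU (A.image fun x => (x.1 - x.2, x.2))
    rw [sum_image, sum_image] at this
    · rw [abs_sub_comm]; simpa using this
    all_goals
      intro x _ y _ h
      simp only [Prod.mk.injEq] at h
      ext1
      · have := h.1; rw [h.2] at this; simpa using this
      · exact h.2
  have hL' : ∀ A : Finset (ZMod n × ZMod n),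
      |∑ x ∈ A, ν (x.1, x.2 - x.1) - ∑ x ∈ A, ν x| ≤ δ := by
    intro A
    have := hL (A.image fun x => (x.1, x.2 - x.1))
    rw [sum_image, sum_image] at this
    · rw [abs_sub_comm]; simpa using this
    all_goals
      intro x _ y _ h
      simp only [Prod.mk.injEq] at h
      ext1
      · exact h.1
      · have := h.2; rw [h.1] at this; simpa using this
  have q1 := sum_quadrant ν hν (δ := δ)
    (fun A => by have := abs_le.mp (hU A); linarith [this.1])
    (fun A => by have := abs_le.mp (hL A); linarith [this.1]) hbad
  have sw : ∀ (A : Finset (ZMod n × ZMod n)) (f : ZMod n × ZMod n → ℝ),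
      ∑ x ∈ A, f (x.2, x.1) = ∑ x ∈ A.image (fun x => (x.2, x.1)), f x := by
    intro A f
    rw [sum_image]
    intro x _ y _ h
    simp only [Prod.mk.injEq] at h
    exact Prod.ext h.2 h.1
  have q2 := sum_quadrant (fun x => ν (x.2, x.1)) (fun x => hν _) (δ := δ) (η := η₁ + η₂)
    (fun A => by
      have := abs_le.mp (hL (A.image fun x => (x.2, x.1)))
      rw [← sw A, ← sw A] at this
      simp only [add_comm] at this ⊢
      linarith [this.1])
    (fun A => by
      have := abs_le.mp (hU (A.image fun x => (x.2, x.1)))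
      rw [← sw A, ← sw A] at this
      simp only [add_comm] at this ⊢
      linarith [this.1])
    (by
      refine le_trans (le_of_eq ?_) hbad
      rw [sw]
      refine sum_congr ?_ fun _ _ => rfl
      ext x
      simp only [mem_image, mem_filter, mem_univ, true_and]
      constructor
      · rintro ⟨y, hy, rfl⟩; exact fun h => hy ⟨h.2, h.1⟩
      · intro h; exact ⟨(x.2, x.1), fun h' => h ⟨h'.2, h'.1⟩, rfl⟩)
  have ng : ∀ (A : Finset (ZMod n × ZMod n)) (f : ZMod n × ZMod n → ℝ),
      ∑ x ∈ A, f (-x.1, x.2) = ∑ x ∈ A.image (fun x => (-x.1, x.2)), f x := by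
    intro A f
    rw [sum_image]
    intro x _ y _ h
    simp only [Prod.mk.injEq, neg_inj] at h
    exact Prod.ext h.1 h.2
  have hneg : ∀ x : ZMod n × ZMod n, Good (-x.1, x.2) ↔ Good x := by
    intro x
    simp only [Good, Int.abs_eq_natAbs, ZMod.natAbs_valMinAbs_neg]
  have q3 := sum_quadrant (fun x => ν (-x.1, x.2)) (fun x => hν _) (δ := δ) (η := η₁ + η₂)
    (fun A => by
      have := abs_le.mp (hU' (A.image fun x => (-x.1, x.2)))
      rw [← ng A ν, ← ng A fun x => ν (x.1 - x.2, x.2)] at this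
      simp only [neg_add, ← sub_eq_add_neg] at this ⊢
      linarith [this.1])
    (fun A => by
      have := abs_le.mp (hL' (A.image fun x => (-x.1, x.2)))
      rw [← ng A ν, ← ng A fun x => ν (x.1, x.2 - x.1)] at this
      simp only [sub_neg_eq_add, add_comm] at this ⊢
      linarith [this.1])
    (by
      refine le_trans (le_of_eq ?_) hbad
      rw [ng]
      refine sum_congr ?_ fun _ _ => rfl
      ext x
      simp only [mem_image, mem_filter, mem_univ, true_and]
      constructor
      · rintro ⟨y, hy, rfl⟩; rwa [hneg]
      · intro h; exact ⟨(-x.1, x.2), by rwa [hneg], by rw [neg_neg]⟩)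
  have z2 : ∑ x : ZMod n × ZMod n with x.1 = 0 ∧ x.2 ≠ 0, ν (x.2, x.1) =
      ∑ x with x.2 = 0 ∧ x.1 ≠ 0, ν x := by
    rw [sw]
    refine sum_congr ?_ fun _ _ => rfl
    ext x
    simp only [mem_image, mem_filter, mem_univ, true_and]
    constructor
    · rintro ⟨y, hy, rfl⟩; exact hy
    · intro h; exact ⟨(x.2, x.1), h, rfl⟩
  have z3 : ∑ x : ZMod n × ZMod n with 0 < x.1.valMinAbs * x.2.valMinAbs, ν (-x.1, x.2) =
      ∑ x with 0 < (-x.1).valMinAbs * x.2.valMinAbs, ν x := by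
    rw [ng]
    refine sum_congr ?_ fun _ _ => rfl
    ext x
    simp only [mem_image, mem_filter, mem_univ, true_and]
    constructor
    · rintro ⟨y, hy, rfl⟩; simpa using hy
    · intro h; exact ⟨(-x.1, x.2), h, by rw [neg_neg]⟩
  have p2 : 0 ≤ ∑ x : ZMod n × ZMod n with 0 < x.1.valMinAbs * x.2.valMinAbs, ν (x.2, x.1) :=
    sum_nonneg fun x _ => hν _
  have p3 : 0 ≤ ∑ x : ZMod n × ZMod n with x.1 = 0 ∧ x.2 ≠ 0, ν (-x.1, x.2) :=
    sum_nonneg fun x _ => hν _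
  rw [z2] at q2
  rw [z3] at q3
  have cov : ∑ x with x ≠ 0, ν x ≤ ∑ x with 0 < x.1.valMinAbs * x.2.valMinAbs, ν x +
      ∑ x with x.1 = 0 ∧ x.2 ≠ 0, ν x + ∑ x with x.2 = 0 ∧ x.1 ≠ 0, ν x +
      ∑ x with 0 < (-x.1).valMinAbs * x.2.valMinAbs, ν x + ∑ x with ¬ Good x, ν x := by
    simp only [sum_filter, ← sum_add_distrib]
    refine sum_le_sum fun x _ => ?_
    have h0 := hν x
    have : x ≠ 0 → (0 < x.1.valMinAbs * x.2.valMinAbs) ∨ (x.1 = 0 ∧ x.2 ≠ 0) ∨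
        (x.2 = 0 ∧ x.1 ≠ 0) ∨ (0 < (-x.1).valMinAbs * x.2.valMinAbs) ∨ ¬ Good x := by
      intro hx
      by_cases h1 : x.1 = 0
      · exact .inr (.inl ⟨h1, fun h2 => hx (Prod.ext h1 h2)⟩)
      by_cases h2 : x.2 = 0
      · exact .inr (.inr (.inl ⟨h2, h1⟩))
      by_cases hg : Good x
      · rw [ZMod.valMinAbs_neg_of_ne_half]
        · have a1 : x.1.valMinAbs ≠ 0 := by rwa [Ne, ZMod.valMinAbs_eq_zero]
          have a2 : x.2.valMinAbs ≠ 0 := by rwa [Ne, ZMod.valMinAbs_eq_zero]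
          rcases (mul_ne_zero a1 a2).lt_or_gt with h | h
          · right; right; right; left; rw [neg_mul]; exact neg_pos.mpr h
          · exact .inl h
        · intro h
          have e1 : (x.1.valMinAbs : ℤ) * 2 = n := by
            have h0 : (2 * x.1.val) = n := h
            rw [ZMod.valMinAbs_def_pos, if_pos (by omega)]
            exact_mod_cast (mul_comm _ _).trans h0
          have := hg.1
          rw [abs_eq_max_neg] at this
          have := NeZero.pos n
          omega
      · exact .inr (.inr (.inr (.inr hg)))
    by_cases hx : x = 0
    · rw [if_neg (not_not.mpr hx)]; positivity
    · rw [if_pos hx]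
      have b1 : ∀ (q : Prop) [Decidable q], 0 ≤ if q then ν x else 0 := by
        intro q _; split_ifs <;> [exact h0; exact le_rfl]
      have c1 := b1 (0 < x.1.valMinAbs * x.2.valMinAbs)
      have c2 := b1 (x.1 = 0 ∧ x.2 ≠ 0)
      have c3 := b1 (x.2 = 0 ∧ x.1 ≠ 0)
      have c4 := b1 (0 < (-x.1).valMinAbs * x.2.valMinAbs)
      have c5 := b1 (¬ Good x)
      rcases this hx with h | h | h | h | h
      · rw [if_pos h]; linarith
      · rw [if_pos h]; linarith
      · rw [if_pos h]; linarith
      · rw [if_pos h]; linarith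
      · rw [if_pos h]; linarith
  linarith

end RelT

namespace RelT

open Finset ComplexConjugate

section Spectral

variable {n : ℕ} [NeZero n] {V : Type*} [NormedAddCommGroup V] [InnerProductSpace ℂ V]

/-- The pairing of `(ℤ/n)²` with its dual. -/
noncomputable def chi (c v : ZMod n × ZMod n) : ℂ := ZMod.stdAddChar (c.1 * v.1 + c.2 * v.2)

theorem chi_add (c v w : ZMod n × ZMod n) : chi c (v + w) = chi c v * chi c w := by
  simp only [chi, Prod.fst_add, Prod.snd_add, ← AddChar.map_add_eq_mul]
  congr 1; ring

theorem chi_zero (c : ZMod n × ZMod n) : chi c 0 = 1 := by simp [chi]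

theorem norm_chi (c v : ZMod n × ZMod n) : ‖chi c v‖ = 1 := by
  rw [chi, ZMod.stdAddChar_apply]; exact Circle.norm_coe _

theorem chi_neg_mul (c v : ZMod n × ZMod n) : chi c (-v) * chi c v = 1 := by
  rw [← chi_add, neg_add_cancel, chi_zero]

theorem sum_chi (v : ZMod n × ZMod n) (hv : v ≠ 0) : ∑ c, chi c v = 0 := by
  have h : ∀ c : ZMod n × ZMod n,
      chi c v = ZMod.stdAddChar (c.1 * v.1) * ZMod.stdAddChar (c.2 * v.2) := by
    intro c; rw [chi, AddChar.map_add_eq_mul]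
  simp only [h]
  rw [← univ_product_univ, sum_product]
  dsimp only
  rw [← Finset.sum_mul_sum, AddChar.sum_mulShift _ (ZMod.isPrimitive_stdAddChar n),
    AddChar.sum_mulShift _ (ZMod.isPrimitive_stdAddChar n)]
  by_cases h1 : v.1 = 0
  · have h2 : v.2 ≠ 0 := fun h2 => hv (Prod.ext h1 h2)
    simp [h2]
  · simp [h1]

theorem exists_chi_ne {c c' : ZMod n × ZMod n} (h : c ≠ c') : ∃ v, chi c v ≠ chi c' v := by
  by_contra! hc
  apply h
  have h1 := hc (1, 0)
  have h2 := hc (0, 1)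
  simp only [chi, mul_one, mul_zero, add_zero, zero_add] at h1 h2
  exact Prod.ext (ZMod.injective_stdAddChar h1) (ZMod.injective_stdAddChar h2)

variable (π : ZMod n × ZMod n → V →ₗᵢ[ℂ] V)

/-- The isotypic projection. -/
noncomputable def proj (c : ZMod n × ZMod n) (f : V) : V :=
  ((n : ℂ) ^ 2)⁻¹ • ∑ v, chi c (-v) • π v f

theorem proj_sub (c : ZMod n × ZMod n) (f g : V) : proj π c (f - g) = proj π c f - proj π c g := by
  simp [proj, smul_sub, sum_sub_distrib]

variable {π}

theorem sum_proj (h0 : ∀ f, π 0 f = f)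
    (f : V) : ∑ c, proj π c f = f := by
  simp only [proj]
  rw [← smul_sum, sum_comm]
  simp only [← sum_smul]
  rw [sum_eq_single 0]
  · have : (n : ℂ) ≠ 0 := by exact_mod_cast NeZero.ne n
    simp only [neg_zero, chi_zero, h0, sum_const, card_univ, Fintype.card_prod, ZMod.card,
      nsmul_eq_mul, mul_one, Nat.cast_mul]
    rw [smul_smul, ← pow_two, inv_mul_cancel₀ (pow_ne_zero 2 this), one_smul]
  · intro v _ hv
    rw [sum_chi _ (neg_ne_zero.mpr hv), zero_smul]
  · simp

theorem apply_proj
    (hadd : ∀ v w f, π (v + w) f = π v (π w f))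
    (w c : ZMod n × ZMod n) (f : V) : π w (proj π c f) = chi c w • proj π c f := by
  simp only [proj, map_smul, map_sum, ← hadd]
  rw [smul_comm (chi c w)]
  congr 1
  rw [smul_sum]
  refine Fintype.sum_equiv (Equiv.addLeft w) _ _ fun v => ?_
  simp only [Equiv.coe_addLeft]
  rw [smul_smul, neg_add, chi_add, ← mul_assoc, mul_comm (chi c w), chi_neg_mul, one_mul]

theorem inner_proj
    (hadd : ∀ v w f, π (v + w) f = π v (π w f))
    {c c' : ZMod n × ZMod n} (h : c ≠ c') (f g : V) :
    inner ℂ (proj π c f) (proj π c' g) = 0 := by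
  obtain ⟨v, hv⟩ := exists_chi_ne h
  have h1 := (π v).inner_map_map (proj π c f) (proj π c' g)
  rw [apply_proj hadd, apply_proj hadd, inner_smul_left, inner_smul_right] at h1
  have h2 : conj (chi c v) * chi c v = 1 := by
    rw [Complex.conj_mul', norm_chi]; simp
  by_contra h3
  apply hv
  have h4 : conj (chi c v) * chi c' v = 1 := by
    apply mul_right_cancel₀ h3; rw [one_mul, mul_assoc, h1]
  have h5 : conj (chi c v) ≠ 0 := left_ne_zero_of_mul_eq_one h2
  exact mul_left_cancel₀ h5 (h2.trans h4.symm)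

theorem norm_sum_proj
    (hadd : ∀ v w f, π (v + w) f = π v (π w f))
    (A : Finset (ZMod n × ZMod n)) (z : ZMod n × ZMod n → ℂ) (f : V) :
    ‖∑ c ∈ A, z c • proj π c f‖ ^ 2 = ∑ c ∈ A, ‖z c‖ ^ 2 * ‖proj π c f‖ ^ 2 := by
  classical
  induction A using Finset.induction_on with
  | empty => simp
  | insert a A ha ih =>
    rw [sum_insert ha, sum_insert ha, ← ih, pow_two,
      norm_add_sq_eq_norm_sq_add_norm_sq_of_inner_eq_zero (𝕜 := ℂ), norm_smul]
    · ring
    · rw [inner_sum]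
      refine sum_eq_zero fun c hc => ?_
      rw [inner_smul_left, inner_smul_right, inner_proj hadd, mul_zero, mul_zero]
      rintro rfl; exact ha hc

theorem norm_apply_sub (h0 : ∀ f, π 0 f = f)
    (hadd : ∀ v w f, π (v + w) f = π v (π w f))
    (w : ZMod n × ZMod n) (f : V) :
    ‖π w f - f‖ ^ 2 = ∑ c, ‖chi c w - 1‖ ^ 2 * ‖proj π c f‖ ^ 2 := by
  rw [← norm_sum_proj hadd]
  congr 2
  conv_lhs => rw [← sum_proj h0 f, map_sum, ← sum_sub_distrib]
  refine sum_congr rfl fun c _ => ?_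
  rw [apply_proj hadd, sub_smul, one_smul]

theorem sum_norm_proj (h0 : ∀ f, π 0 f = f)
    (hadd : ∀ v w f, π (v + w) f = π v (π w f))
    (f : V) : ∑ c, ‖proj π c f‖ ^ 2 = ‖f‖ ^ 2 := by
  have := norm_sum_proj hadd univ (fun _ => 1) f
  simp only [one_smul, norm_one, one_pow, one_mul, sum_proj h0] at this
  exact this.symm

theorem abs_sum_norm_proj_sub (h0 : ∀ f, π 0 f = f)
    (hadd : ∀ v w f, π (v + w) f = π v (π w f))
    (A : Finset (ZMod n × ZMod n)) (f g : V) {ε : ℝ} (hf : ‖f‖ ≤ 1)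
    (hg : ‖g‖ ≤ 1) (hfg : ‖f - g‖ ≤ ε) :
    |∑ c ∈ A, ‖proj π c f‖ ^ 2 - ∑ c ∈ A, ‖proj π c g‖ ^ 2| ≤ 2 * ε := by
  have e : ∀ f : V, ∑ c ∈ A, ‖proj π c f‖ ^ 2 = ‖∑ c ∈ A, proj π c f‖ ^ 2 := by
    intro f
    have := norm_sum_proj hadd A (fun _ => 1) f
    simp only [one_smul, norm_one, one_pow, one_mul] at this
    exact this.symm
  have le : ∀ f : V, ‖∑ c ∈ A, proj π c f‖ ≤ ‖f‖ := by
    intro f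
    refine le_of_sq_le_sq ?_ (norm_nonneg f)
    rw [← e, ← sum_norm_proj h0 hadd f]
    exact sum_le_sum_of_subset_of_nonneg (subset_univ A) fun _ _ _ => by positivity
  have d : |‖∑ c ∈ A, proj π c f‖ - ‖∑ c ∈ A, proj π c g‖| ≤ ε := by
    refine (abs_norm_sub_norm_le _ _).trans ?_
    rw [← sum_sub_distrib]
    simp only [← proj_sub]
    exact (le _).trans hfg
  rw [e, e, sq_sub_sq, abs_mul, mul_comm 2 ε, mul_comm]
  refine mul_le_mul d ?_ (abs_nonneg _) ((abs_nonneg _).trans d)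
  rw [abs_of_nonneg (by positivity)]
  linarith [le f, le g]

theorem one_le_norm_stdAddChar_sub (a : ZMod n) (h : (n : ℤ) ≤ 6 * |a.valMinAbs|) :
    1 ≤ ‖(ZMod.stdAddChar a : ℂ) - 1‖ ^ 2 := by
  have hn : (0 : ℝ) < n := by exact_mod_cast NeZero.pos n
  have h1 : (ZMod.stdAddChar a : ℂ) =
      Complex.exp (((2 * Real.pi * a.valMinAbs / n : ℝ) : ℂ) * Complex.I) := by
    conv_lhs => rw [← ZMod.coe_valMinAbs a]
    rw [ZMod.stdAddChar_coe]
    congr 1; push_cast; ring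
  set t : ℝ := 2 * Real.pi * a.valMinAbs / n with ht
  have h2 : ‖Complex.exp ((t : ℂ) * Complex.I) - 1‖ ^ 2 = 2 - 2 * Real.cos t := by
    rw [Complex.exp_mul_I, ← Complex.normSq_eq_norm_sq, Complex.normSq_apply]
    simp only [Complex.sub_re, Complex.add_re, Complex.mul_re, Complex.I_re, Complex.I_im,
      Complex.sub_im, Complex.add_im, Complex.mul_im, Complex.one_re, Complex.one_im,
      Complex.cos_ofReal_re, Complex.sin_ofReal_re, Complex.sin_ofReal_im, Complex.cos_ofReal_im]
    nlinarith [Real.sin_sq_add_cos_sq t]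
  rw [h1, h2]
  have h3 : Real.cos t ≤ 1 / 2 := by
    rw [← Real.cos_abs, ← Real.cos_pi_div_three]
    have hb := a.valMinAbs_mem_Ioc
    have hb' : |a.valMinAbs| * 2 ≤ n := by
      rw [abs_eq_max_neg]; have := hb.1; have := hb.2; omega
    have hb2 : |(a.valMinAbs : ℝ)| * 2 ≤ n := by exact_mod_cast hb'
    have hb3 : (n : ℝ) ≤ 6 * |(a.valMinAbs : ℝ)| := by exact_mod_cast h
    have habs : |t| = 2 * Real.pi * |(a.valMinAbs : ℝ)| / n := by
      rw [ht, abs_div, abs_mul, abs_of_pos (by positivity : 0 < 2 * Real.pi), abs_of_pos hn]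
    apply Real.cos_le_cos_of_nonneg_of_le_pi (by positivity)
    · rw [habs, div_le_iff₀ hn]
      nlinarith [Real.pi_pos]
    · rw [habs, le_div_iff₀ hn]
      nlinarith [Real.pi_pos]
  linarith

theorem relative_gap (h0 : ∀ f, π 0 f = f)
    (hadd : ∀ v w f, π (v + w) f = π v (π w f))
    (T S : V →ₗᵢ[ℂ] V) (hT : ∀ v f, T (π v f) = π (v.1 + v.2, v.2) (T f))
    (hS : ∀ v f, S (π v f) = π (v.1, v.1 + v.2) (S f)) (f : V) (hf : ‖f‖ ≤ 1) {ε : ℝ}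
    (hε : 0 ≤ ε) (hε1 : ε ≤ 1)
    (h1 : ‖π (1, 0) f - f‖ ≤ ε) (h2 : ‖π (0, 1) f - f‖ ≤ ε) (h3 : ‖T f - f‖ ≤ ε)
    (h4 : ‖S f - f‖ ≤ ε) (v : ZMod n × ZMod n) : ‖π v f - f‖ ^ 2 ≤ 104 * ε := by
  have key : ∀ (T : V →ₗᵢ[ℂ] V) (g g' : ZMod n × ZMod n ≃ ZMod n × ZMod n),
      (∀ v f, T (π v f) = π (g v) (T f)) → (∀ c v, chi (g' c) (- v) = chi c (- g v)) →
      ‖T f - f‖ ≤ ε →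
      ∀ A : Finset (ZMod n × ZMod n),
        |∑ c ∈ A, ‖proj π (g' c) f‖ ^ 2 - ∑ c ∈ A, ‖proj π c f‖ ^ 2| ≤ 2 * ε := by
    intro T g g' hg hgg' hTf A
    have e : ∀ c, ‖proj π (g' c) f‖ = ‖proj π c (T f)‖ := by
      intro c
      rw [← T.norm_map]
      congr 1
      simp only [proj, map_smul, map_sum, hg]
      congr 1
      refine Fintype.sum_equiv g _ _ fun v => ?_
      rw [hgg']
    simp only [e]
    exact abs_sum_norm_proj_sub h0 hadd A _ _ (by rw [T.norm_map]; exact hf) hf hTf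
  have kT := key T ⟨fun v => (v.1 + v.2, v.2), fun v => (v.1 - v.2, v.2),
    fun v => by simp, fun v => by simp⟩
    ⟨fun v => (v.1, v.1 + v.2), fun v => (v.1, v.2 - v.1),
    fun v => by simp, fun v => by simp⟩ hT
    (fun c v => by
      simp only [chi, Equiv.coe_fn_mk, Prod.fst_neg, Prod.snd_neg]
      congr 1; ring) h3
  have kS := key S ⟨fun v => (v.1, v.1 + v.2), fun v => (v.1, v.2 - v.1),
    fun v => by simp, fun v => by simp⟩
    ⟨fun v => (v.1 + v.2, v.2), fun v => (v.1 - v.2, v.2),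
    fun v => by simp, fun v => by simp⟩ hS
    (fun c v => by
      simp only [chi, Equiv.coe_fn_mk, Prod.fst_neg, Prod.snd_neg]
      congr 1; ring) h4
  have b1 : ∑ x : ZMod n × ZMod n with (n : ℤ) ≤ 6 * |x.1.valMinAbs|, ‖proj π x f‖ ^ 2 ≤ ε ^ 2 := by
    refine le_trans ?_ (pow_le_pow_left₀ (norm_nonneg _) h1 2)
    rw [norm_apply_sub h0 hadd, sum_filter]
    refine sum_le_sum fun x _ => ?_
    split_ifs with h
    · have := one_le_norm_stdAddChar_sub x.1 h
      simp only [chi, mul_one, mul_zero, add_zero]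
      exact le_mul_of_one_le_left (by positivity) this
    · positivity
  have b2 : ∑ x : ZMod n × ZMod n with (n : ℤ) ≤ 6 * |x.2.valMinAbs|, ‖proj π x f‖ ^ 2 ≤ ε ^ 2 := by
    refine le_trans ?_ (pow_le_pow_left₀ (norm_nonneg _) h2 2)
    rw [norm_apply_sub h0 hadd, sum_filter]
    refine sum_le_sum fun x _ => ?_
    split_ifs with h
    · have := one_le_norm_stdAddChar_sub x.2 h
      simp only [chi, mul_one, mul_zero, zero_add]
      exact le_mul_of_one_le_left (by positivity) this
    · positivity
  have hsum := sum_ne_zero (fun x => ‖proj π x f‖ ^ 2) (fun x => by positivity) kS kT b1 b2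
  rw [norm_apply_sub h0 hadd]
  have : ∑ c, ‖chi c v - 1‖ ^ 2 * ‖proj π c f‖ ^ 2 ≤ 4 * ∑ c with c ≠ 0, ‖proj π c f‖ ^ 2 := by
    rw [mul_sum, sum_filter]
    refine sum_le_sum fun c _ => ?_
    split_ifs with hc
    · have : ‖chi c v - 1‖ ≤ 2 := by
        refine (norm_sub_le _ _).trans ?_
        rw [norm_chi, norm_one]; norm_num
      have : ‖chi c v - 1‖ ^ 2 ≤ 2 ^ 2 := pow_le_pow_left₀ (norm_nonneg _) this 2
      nlinarith [sq_nonneg ‖proj π c f‖]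
    · rw [not_not.mp hc]; simp [chi]
  nlinarith

end Spectral

end RelT

namespace SLThree

open Matrix Matrix.SpecialLinearGroup

/-- The group `SL₃`. -/
abbrev G3 (R : Type*) [CommRing R] := Matrix.SpecialLinearGroup (Fin 3) R

section Field

variable {K : Type*} [Field K]

theorem transvection_mul_apply {R : Type*} [CommRing R] {i j : Fin 3} (h : i ≠ j) (t : R)
    (g : G3 R) (a b : Fin 3) :
    (Matrix.SpecialLinearGroup.transvection h t * g) a b =
      g a b + if a = i then t * g j b else 0 := by
  change (Matrix.transvection i j t * g.1) a b = _
  split_ifs with ha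
  · subst ha; rw [transvection_mul_apply_same]
  · rw [transvection_mul_apply_of_ne _ _ _ _ ha, add_zero]

/-- Elements which become trivial after a prescribed sequence of row operations. -/
def Pattern {ι R H : Type*} [Group H] (e : ι → R → H) : List ι → H → Prop
  | [], g => g = 1
  | i :: L, g => ∃ t, Pattern e L (e i t * g)

/-- The index set of elementary matrices. -/
abbrev Ix := {q : Fin 3 × Fin 3 // q.1 ≠ q.2}

/-- Elementary matrices. -/
def elem {R : Type*} [CommRing R] (q : Ix) (t : R) : G3 R :=
  Matrix.SpecialLinearGroup.transvection q.2 t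

theorem elem_mul_apply {R : Type*} [CommRing R] (q : Ix) (t : R)
    (g : G3 R) (a b : Fin 3) :
    (elem q t * g) a b = g a b + if a = q.1.1 then t * g q.1.2 b else 0 :=
  transvection_mul_apply q.2 t g a b

/-- The position `(0, 1)`. -/
def q01 : Ix := ⟨(0, 1), by decide⟩
/-- The position `(0, 2)`. -/
def q02 : Ix := ⟨(0, 2), by decide⟩
/-- The position `(1, 2)`. -/
def q12 : Ix := ⟨(1, 2), by decide⟩
/-- The position `(1, 0)`. -/
def q10 : Ix := ⟨(1, 0), by decide⟩
/-- The position `(2, 0)`. -/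
def q20 : Ix := ⟨(2, 0), by decide⟩
/-- The position `(2, 1)`. -/
def q21 : Ix := ⟨(2, 1), by decide⟩

theorem exists_pattern (g : G3 K) :
    Pattern elem [q10, q12, q01, q10, q20, q21, q12, q21, q12, q02, q01] g := by
  have s1 : ∃ t t' : K, (elem q12 t' * (elem q10 t * g)) 1 0 ≠ 0 := by
    have hd : g.1.det = 1 := g.2
    rw [Matrix.det_fin_three] at hd
    simp only [elem_mul_apply, q12, q10]
    by_cases h1 : g 1 0 = 0
    · by_cases h0 : g 0 0 = 0
      · by_cases h2 : g 2 0 = 0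
        · simp [h0, h1, h2] at hd
        · exact ⟨0, 1, by simpa [h1] using h2⟩
      · exact ⟨1, 0, by simpa [h1] using h0⟩
    · exact ⟨0, 0, by simpa using h1⟩
  obtain ⟨t, t', s1⟩ := s1
  refine ⟨t, t', ?_⟩
  generalize elem q12 t' * (elem q10 t * g) = g at s1
  have s2 : ∃ t : K, (elem q01 t * g) 0 0 = 1 := by
    refine ⟨(1 - g 0 0) / g 1 0, ?_⟩
    simp only [elem_mul_apply, q01, if_true]
    field_simp
    ring
  obtain ⟨t, s2⟩ := s2
  refine ⟨t, ?_⟩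
  generalize elem q01 t * g = g at s2
  have s3 : ∃ t t' : K, (elem q20 t' * (elem q10 t * g)) 0 0 = 1 ∧
      (elem q20 t' * (elem q10 t * g)) 1 0 = 0 ∧ (elem q20 t' * (elem q10 t * g)) 2 0 = 0 := by
    refine ⟨- g 1 0, - g 2 0, ?_⟩
    simp [elem_mul_apply, q20, q10, s2]
  obtain ⟨t, t', s3⟩ := s3
  refine ⟨t, t', ?_⟩
  generalize elem q20 t' * (elem q10 t * g) = g at s3
  obtain ⟨c0, c1, c2⟩ := s3
  have s4 : ∃ t : K, (elem q21 t * g) 2 1 ≠ 0 ∧ ∀ a, (elem q21 t * g) a 0 = g a 0 := by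
    have hd : g.1.det = 1 := g.2
    rw [Matrix.det_fin_three] at hd
    have h0 : ∀ (t : K) a, (elem q21 t * g) a 0 = g a 0 := by
      intro t a; simp [elem_mul_apply, q21, c1]
    by_cases h2 : g 2 1 = 0
    · refine ⟨1, ?_, h0 1⟩
      simp only [elem_mul_apply, q21, h2, if_true]
      intro h1
      simp at h1
      simp [h1, h2, c1, c2] at hd
    · exact ⟨0, by simpa [elem_mul_apply] using h2, h0 0⟩
  obtain ⟨t, s4, h⟩ := s4
  rw [← h] at c0 c1 c2
  refine ⟨t, ?_⟩
  generalize elem q21 t * g = g at s4 c0 c1 c2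
  have s5 : ∃ t : K, (elem q12 t * g) 1 1 = 1 ∧ ∀ a, (elem q12 t * g) a 0 = g a 0 := by
    refine ⟨(1 - g 1 1) / g 2 1, ?_, ?_⟩
    · simp only [elem_mul_apply, q12, if_true]
      field_simp
      ring
    · intro a; simp [elem_mul_apply, q12, c2]
  obtain ⟨t, s5, h⟩ := s5
  rw [← h] at c0 c1 c2
  refine ⟨t, ?_⟩
  clear s4
  generalize elem q12 t * g = g at s5 c0 c1 c2
  have s6 : ∃ t : K, (elem q21 t * g) 2 1 = 0 ∧ (elem q21 t * g) 1 1 = 1 ∧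
      ∀ a, (elem q21 t * g) a 0 = g a 0 := by
    refine ⟨- g 2 1, ?_, ?_, ?_⟩
    · simp [elem_mul_apply, q21, s5]
    · simp [elem_mul_apply, q21, s5]
    · intro a; simp [elem_mul_apply, q21, c1]
  obtain ⟨t, s6, s6', h⟩ := s6
  rw [← h] at c0 c1 c2
  refine ⟨t, ?_⟩
  clear s5
  generalize elem q21 t * g = g at s6 s6' c0 c1 c2
  have c3 : g 2 2 = 1 := by
    have hd : g.1.det = 1 := g.2
    rw [Matrix.det_fin_three] at hd
    simpa [c0, c1, c2, s6, s6'] using hd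
  refine ⟨- g 1 2, - g 0 2, - g 0 1, ?_⟩
  change _ = _
  ext a b
  simp only [elem_mul_apply, q01, q02, q12]
  fin_cases a <;> fin_cases b <;> simp [c0, c1, c2, c3, s6, s6']

end Field

end SLThree

namespace SLThree

open Matrix Finset

section Relations

variable {R : Type*} [CommRing R]

theorem elem_zero (q : Ix) : elem q (0 : R) = 1 :=
  Matrix.SpecialLinearGroup.transvection_coeff_zero q.2

theorem elem_add (q : Ix) (s t : R) : elem q (s + t) = elem q s * elem q t :=
  Matrix.SpecialLinearGroup.transvection_add q.2 s t

/-- `elem` for explicit indices. -/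
def el (i j : Fin 3) (h : i ≠ j) (t : R) : G3 R := elem ⟨(i, j), h⟩ t

theorem el_comm {i j k : Fin 3} (hij : i ≠ j) (hkj : k ≠ j) (x y : R) :
    el i j hij x * el k j hkj y = el k j hkj y * el i j hij x := by
  apply Subtype.ext
  simp [el, elem, Matrix.SpecialLinearGroup.transvection_coe, mul_add, add_mul,
    single_mul_single_of_ne _ _ _ _ hij.symm, single_mul_single_of_ne _ _ _ _ hkj.symm, add_comm,
    add_left_comm]

theorem el_conj {i j k : Fin 3} (hij : i ≠ j) (hkj : k ≠ j) (hik : i ≠ k) (x y : R) :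
    el i k hik 1 * (el i j hij x * el k j hkj y) =
      el i j hij (x + y) * el k j hkj y * el i k hik 1 := by
  apply Subtype.ext
  simp [el, elem, Matrix.SpecialLinearGroup.transvection_coe, mul_add, add_mul, single_add,
    single_mul_single_of_ne _ _ _ _ hij.symm, single_mul_single_of_ne _ _ _ _ hkj.symm,
    single_mul_single_of_ne _ _ _ _ hik.symm]
  abel

end Relations

variable {J : Type*} [Fintype J] (p : J → ℕ)

/-- The product of the groups `SL₃(ℤ/p)`. -/
abbrev PG := ∀ j, G3 (ZMod (p j))

/-- Diagonal elementary matrices. -/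
noncomputable def pel (q : Ix) (t : ZMod (∏ j, p j)) : PG p :=
  fun j => elem q (ZMod.castHom (Finset.dvd_prod_of_mem p (Finset.mem_univ j)) (ZMod (p j)) t)

theorem pel_zero (q : Ix) : pel p q 0 = 1 := by
  funext j; simp [pel, elem_zero]

theorem pel_add (q : Ix) (s t) : pel p q (s + t) = pel p q s * pel p q t := by
  funext j; simp only [pel, map_add, elem_add, Pi.mul_apply]

theorem exists_castHom_eq (hp : ∀ j, (p j).Prime) (hinj : Function.Injective p)
    (t : ∀ j, ZMod (p j)) : ∃ r : ZMod (∏ j, p j), ∀ j,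
      ZMod.castHom (Finset.dvd_prod_of_mem p (Finset.mem_univ j)) (ZMod (p j)) r = t j := by
  classical
  have : ∀ j, NeZero (p j) := fun j => ⟨(hp j).ne_zero⟩
  let c := Nat.chineseRemainderOfFinset (fun j => (t j).val) p Finset.univ
    (fun j _ => (hp j).ne_zero) (fun i _ j _ hij => (Nat.coprime_primes (hp i) (hp j)).mpr
      (fun h => hij (hinj h)))
  refine ⟨(c.1 : ℕ), fun j => ?_⟩
  rw [map_natCast, (ZMod.natCast_eq_natCast_iff _ _ _).mpr (c.2 j (Finset.mem_univ j)),
    ZMod.natCast_zmod_val]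

theorem pattern_pi (hp : ∀ j, (p j).Prime) (hinj : Function.Injective p) :
    ∀ (L : List Ix) (g : PG p), (∀ j, Pattern elem L (g j)) → Pattern (pel p) L g
  | [], g, h => funext h
  | q :: L, g, h => by
    choose t ht using h
    obtain ⟨r, hr⟩ := exists_castHom_eq p hp hinj t
    refine ⟨r, pattern_pi hp hinj L _ fun j => ?_⟩
    have := ht j
    rwa [← hr j] at this

variable {V : Type*} [NormedAddCommGroup V] [InnerProductSpace ℂ V]

theorem norm_pel_sub (hp : ∀ j, (p j).Prime) (ρ : PG p → V →ₗᵢ[ℂ] V) (h1 : ∀ f, ρ 1 f = f)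
    (hmul : ∀ g h f, ρ (g * h) f = ρ g (ρ h f)) (f : V) (hf : ‖f‖ ≤ 1) {ε : ℝ} (hε : 0 ≤ ε)
    (hε1 : ε ≤ 1) (h : ∀ q, ‖ρ (pel p q 1) f - f‖ ≤ ε) (q : Ix) (t) :
    ‖ρ (pel p q t) f - f‖ ^ 2 ≤ 104 * ε := by
  have : NeZero (∏ j, p j) := ⟨Finset.prod_ne_zero_iff.mpr fun j _ => (hp j).ne_zero⟩
  obtain ⟨⟨i, j⟩, hij⟩ := q
  have hex : ∃ k : Fin 3, i ≠ k ∧ k ≠ j := by revert i j; decide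
  obtain ⟨k, hik, hkj⟩ := hex
  set x : ZMod (∏ j, p j) → PG p := pel p ⟨(i, j), hij⟩ with hx
  set y : ZMod (∏ j, p j) → PG p := pel p ⟨(k, j), hkj⟩ with hy
  have comm : ∀ s t, x s * y t = y t * x s := fun s t => funext fun l => el_comm hij hkj _ _
  have c1 : ∀ s t, pel p ⟨(i, k), hik⟩ 1 * (x s * y t) =
      x (s + t) * y t * pel p ⟨(i, k), hik⟩ 1 := by
    intro s t
    funext l
    have := el_conj hij hkj hik
      (ZMod.castHom (Finset.dvd_prod_of_mem p (Finset.mem_univ l)) (ZMod (p l)) s)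
      (ZMod.castHom (Finset.dvd_prod_of_mem p (Finset.mem_univ l)) (ZMod (p l)) t)
    simp only [hx, hy, Pi.mul_apply, pel, map_add, map_one]
    exact this
  have c2 : ∀ s t, pel p ⟨(k, i), hik.symm⟩ 1 * (x s * y t) =
      x s * y (s + t) * pel p ⟨(k, i), hik.symm⟩ 1 := by
    intro s t
    rw [comm, comm, add_comm s t]
    funext l
    have := el_conj hkj hij hik.symm
      (ZMod.castHom (Finset.dvd_prod_of_mem p (Finset.mem_univ l)) (ZMod (p l)) t)
      (ZMod.castHom (Finset.dvd_prod_of_mem p (Finset.mem_univ l)) (ZMod (p l)) s)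
    simp only [hx, hy, Pi.mul_apply, pel, map_add, map_one]
    exact this
  have key := RelT.relative_gap (π := fun v => ρ (x v.1 * y v.2))
    (fun f => by rw [Prod.fst_zero, Prod.snd_zero, hx, hy, pel_zero, pel_zero, one_mul, h1])
    (fun v w f => by
      rw [← hmul, Prod.fst_add, Prod.snd_add, hx, hy, pel_add, pel_add, ← hx, ← hy]
      rw [mul_assoc (x v.1) (y v.2), ← mul_assoc (y v.2), ← comm w.1 v.2]
      simp only [mul_assoc])
    (ρ (pel p ⟨(i, k), hik⟩ 1)) (ρ (pel p ⟨(k, i), hik.symm⟩ 1))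
    (fun v f => by rw [← hmul, c1, hmul])
    (fun v f => by rw [← hmul, c2, hmul]) f hf hε hε1
    (by simpa only [hy, pel_zero, mul_one] using h _)
    (by simpa only [hx, pel_zero, one_mul] using h _) (h _) (h _) (t, 0)
  simpa only [hy, pel_zero, mul_one] using key

theorem norm_sub_of_pattern (ρ : PG p → V →ₗᵢ[ℂ] V) (h1 : ∀ f, ρ 1 f = f)
    (hmul : ∀ g h f, ρ (g * h) f = ρ g (ρ h f)) (f : V) {κ : ℝ}
    (h : ∀ q t, ‖ρ (pel p q t) f - f‖ ≤ κ) :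
    ∀ (L : List Ix) (g : PG p), Pattern (pel p) L g → ‖ρ g f - f‖ ≤ L.length * κ
  | [], g, hg => by rw [show g = 1 from hg, h1]; simp
  | q :: L, g, ⟨t, ht⟩ => by
    have ih := norm_sub_of_pattern ρ h1 hmul f h L _ ht
    rw [hmul] at ih
    have e : ρ (pel p q t) (ρ g f - f) = (ρ (pel p q t) (ρ g f) - f) - (ρ (pel p q t) f - f) := by
      rw [map_sub]; abel
    rw [← (ρ (pel p q t)).norm_map, e]
    refine (norm_sub_le _ _).trans ((add_le_add ih (h q t)).trans ?_)
    push_cast [List.length_cons]; linarith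

theorem norm_sub_le (hp : ∀ j, (p j).Prime) (hinj : Function.Injective p) (ρ : PG p → V →ₗᵢ[ℂ] V)
    (h1 : ∀ f, ρ 1 f = f)
    (hmul : ∀ g h f, ρ (g * h) f = ρ g (ρ h f)) (f : V) (hf : ‖f‖ ≤ 1) {ε : ℝ} (hε : 0 ≤ ε)
    (hε1 : ε ≤ 1) (h : ∀ q, ‖ρ (pel p q 1) f - f‖ ≤ ε) (g : PG p) :
    ‖ρ g f - f‖ ^ 2 ≤ 12584 * ε := by
  have k1 : ∀ q t, ‖ρ (pel p q t) f - f‖ ≤ √(104 * ε) := fun q t =>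
    Real.le_sqrt_of_sq_le (norm_pel_sub p hp ρ h1 hmul f hf hε hε1 h q t)
  have hP : ∃ L : List Ix, L.length = 11 ∧ Pattern (pel p) L g :=
    ⟨_, by rfl, pattern_pi p hp hinj _ g fun j => haveI := Fact.mk (hp j); exists_pattern (g j)⟩
  obtain ⟨L, hL, hP⟩ := hP
  have k2 := norm_sub_of_pattern p ρ h1 hmul f k1 L g hP
  rw [hL] at k2
  have k3 := pow_le_pow_left₀ (norm_nonneg _) k2 2
  rw [mul_pow, Real.sq_sqrt (by positivity)] at k3
  push_cast at k3
  linarith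

/-- Uniform spectral gap for the left regular representation. -/
theorem variance_le (hp : ∀ j, (p j).Prime) (hinj : Function.Injective p) [Fintype (PG p)]
    (f : PG p → ℝ) (hf : ∑ x, f x ^ 2 ≤ Fintype.card (PG p)) {ε : ℝ} (hε : 0 ≤ ε)
    (hε1 : ε ≤ 1) (h : ∀ q, ∑ x, (f (pel p q 1 * x) - f x) ^ 2 ≤ ε ^ 2 * Fintype.card (PG p)) :
    (∑ x, f x ^ 2) / Fintype.card (PG p) - ((∑ x, f x) / Fintype.card (PG p)) ^ 2 ≤ 6292 * ε := by
  classical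
  set N : ℝ := (Fintype.card (PG p) : ℝ) with hN
  have hN0 : 0 < N := by rw [hN]; exact_mod_cast Fintype.card_pos
  let ρ : PG p → EuclideanSpace ℂ (PG p) →ₗᵢ[ℂ] EuclideanSpace ℂ (PG p) := fun g =>
    (LinearIsometryEquiv.piLpCongrLeft 2 ℂ ℂ (Equiv.mulLeft g)).toLinearIsometry
  have hρ : ∀ g F x, ρ g F x = F (g⁻¹ * x) := fun g F x => rfl
  let F : EuclideanSpace ℂ (PG p) := WithLp.toLp 2 fun x => ((f x / √N : ℝ) : ℂ)
  have hF : ∀ x, F x = ((f x / √N : ℝ) : ℂ) := fun x => rfl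
  have hnorm : ∀ g, ‖ρ g F - F‖ ^ 2 = (∑ x, (f (g⁻¹ * x) - f x) ^ 2) / N := by
    intro g
    rw [EuclideanSpace.norm_sq_eq, Finset.sum_div]
    refine Finset.sum_congr rfl fun x _ => ?_
    rw [PiLp.sub_apply, hρ, hF, hF, ← Complex.ofReal_sub, Complex.norm_real, Real.norm_eq_abs,
      sq_abs, ← sub_div, div_pow, Real.sq_sqrt hN0.le]
  have key : ∀ g : PG p, ∑ x, (f (g⁻¹ * x) - f x) ^ 2 ≤ 12584 * ε * N := by
    intro g
    rw [← div_le_iff₀ hN0, ← hnorm]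
    refine norm_sub_le p hp hinj ρ ?_ ?_ F ?_ hε hε1 ?_ g
    · intro F; ext x; rw [hρ, inv_one, one_mul]
    · intro g h F; ext x; rw [hρ, hρ, hρ, _root_.mul_inv_rev, mul_assoc]
    · refine (sq_le_one_iff₀ (norm_nonneg _)).mp ?_
      rw [EuclideanSpace.norm_sq_eq]
      rw [← div_le_one hN0, Finset.sum_div] at hf
      refine le_trans (le_of_eq (Finset.sum_congr rfl fun x _ => ?_)) hf
      rw [hF, Complex.norm_real, Real.norm_eq_abs, sq_abs, div_pow, Real.sq_sqrt hN0.le]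
    · intro q
      refine le_of_sq_le_sq ?_ hε
      rw [hnorm, div_le_iff₀ hN0]
      refine le_trans (le_of_eq ?_) (h q)
      refine (Fintype.sum_equiv (Equiv.mulLeft (pel p q 1)) _ _ fun x => ?_).symm
      rw [Equiv.coe_mulLeft, inv_mul_cancel_left]
      ring
  have tot : ∑ g : PG p, ∑ x, (f (g⁻¹ * x) - f x) ^ 2 =
      2 * N * ∑ x, f x ^ 2 - 2 * (∑ x, f x) ^ 2 := by
    have e1 : ∀ x, ∑ g : PG p, f (g⁻¹ * x) = ∑ y, f y := fun x =>
      Fintype.sum_equiv ((Equiv.inv _).trans (Equiv.mulRight x)) _ _ fun g => rfl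
    have e2 : ∀ x, ∑ g : PG p, f (g⁻¹ * x) ^ 2 = ∑ y, f y ^ 2 := fun x =>
      Fintype.sum_equiv ((Equiv.inv _).trans (Equiv.mulRight x)) _ _ fun g => rfl
    rw [Finset.sum_comm]
    have : ∀ x, ∑ g : PG p, (f (g⁻¹ * x) - f x) ^ 2 =
        ∑ y, f y ^ 2 - 2 * (∑ y, f y) * f x + N * f x ^ 2 := by
      intro x
      simp only [sub_sq, Finset.sum_add_distrib, Finset.sum_sub_distrib, ← Finset.sum_mul,
        ← Finset.mul_sum, e1, e2]
      simp [hN]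
    simp only [this, Finset.sum_add_distrib, Finset.sum_sub_distrib, ← Finset.mul_sum,
      Finset.sum_const, Finset.card_univ, nsmul_eq_mul, ← hN]
    ring
  have le := Finset.sum_le_sum (s := Finset.univ) fun g _ => key g
  rw [tot, Finset.sum_const, Finset.card_univ, nsmul_eq_mul, ← hN] at le
  rw [div_pow, show (∑ x, f x ^ 2) / N = (N * ∑ x, f x ^ 2) / N ^ 2 by field_simp, ← sub_div,
    div_le_iff₀ (by positivity)]
  linarith

end SLThree

theorem MeasureTheory.IsSetAlgebra.setOf_mem {X ι : Type*} [Finite ι] {𝒞 : Set (Set X)}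
    (h : IsSetAlgebra 𝒞) {C : ι → Set X} (hC : ∀ l, C l ∈ 𝒞) (Φ : (ι → Prop) → Prop) :
    {x | Φ fun l => x ∈ C l} ∈ 𝒞 := by
  classical
  cases nonempty_fintype ι
  have h1 : {x | Φ fun l => x ∈ C l} = ⋃ χ ∈ (Finset.univ.filter Φ : Finset (ι → Prop)),
      ⋂ l ∈ (Finset.univ : Finset ι), {x | x ∈ C l ↔ χ l} := by
    ext x
    simp only [Set.mem_ofPred_eq, Finset.mem_filter, Finset.mem_univ, true_and, Set.mem_iUnion,
      Set.mem_iInter, forall_const, exists_prop]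
    constructor
    · intro hx
      exact ⟨_, hx, fun l => Iff.rfl⟩
    · rintro ⟨χ, hχ, hx⟩
      have : (fun l => x ∈ C l) = χ := funext fun l => propext (hx l)
      rwa [this]
  rw [h1]
  refine h.biUnion_mem _ fun χ _ => h.biInter_mem _ fun l _ => ?_
  by_cases hl : χ l
  · simpa [hl] using hC l
  · have := h.compl_mem (hC l)
    simpa [hl, Set.compl_def] using this

theorem MeasureTheory.Measure.MeasureDense.exists_fin_approx {X : Type*} [MeasurableSpace X]
    {μ : Measure X} [IsFiniteMeasure μ] {𝒞 : Set (Set X)} (hd : μ.MeasureDense 𝒞)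
    (h : IsSetAlgebra 𝒞) {k : ℕ} {f : X → Fin k} (hf : Measurable f) {ε : ℝ} (hε : 0 < ε) :
    ∃ f' : X → Fin k, (∀ s : Set (Fin k), f' ⁻¹' s ∈ 𝒞) ∧ μ.real {x | f x ≠ f' x} ≤ ε := by
  classical
  rcases Nat.eq_zero_or_pos k with rfl | hk
  · refine ⟨f, fun s => ?_, ?_⟩
    · have : s = ∅ := Set.eq_empty_of_isEmpty s
      simpa [this] using h.empty_mem
    · simpa using hε.le
  have : Nonempty (Fin k) := ⟨⟨0, hk⟩⟩
  choose C hC hCε using fun j : Fin k => hd.approx (f ⁻¹' {j})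
    (hf (measurableSet_singleton j)) (measure_ne_top _ _) (ε / k) (by positivity)
  let F : (Fin k → Prop) → Fin k := fun χ => if hχ : ∃ j, ∀ l, χ l ↔ l = j then hχ.choose
    else Classical.arbitrary _
  refine ⟨fun x => F fun l => x ∈ C l, fun s => ?_, ?_⟩
  · exact h.setOf_mem hC fun χ => F χ ∈ s
  · have hsub : {x | f x ≠ F fun l => x ∈ C l} ⊆ ⋃ j, symmDiff (f ⁻¹' {j}) (C j) := by
      intro x hx
      by_contra hn
      simp only [Set.mem_iUnion, not_exists, Set.mem_symmDiff, not_or, not_and, not_not,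
        Set.mem_preimage, Set.mem_singleton_iff] at hn
      have hχ : ∃ j, ∀ l, x ∈ C l ↔ l = j :=
        ⟨f x, fun l => ⟨fun hl => ((hn l).2 hl).symm, fun hl => (hn l).1 hl.symm⟩⟩
      apply hx
      simp only [F, dif_pos hχ]
      exact (hχ.choose_spec _).1 ((hn (f x)).1 rfl)
    calc μ.real {x | f x ≠ F fun l => x ∈ C l} ≤ μ.real (⋃ j, symmDiff (f ⁻¹' {j}) (C j)) :=
          measureReal_mono hsub
      _ ≤ ∑ j, μ.real (symmDiff (f ⁻¹' {j}) (C j)) := measureReal_iUnion_fintype_le _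
      _ ≤ ∑ _j : Fin k, ε / k := Finset.sum_le_sum fun j _ => by
          have := ENNReal.toReal_mono ENNReal.ofReal_ne_top (hCε j).le
          rwa [ENNReal.toReal_ofReal (by positivity)] at this
      _ = ε := by
          have : (k : ℝ) ≠ 0 := by positivity
          simp; field_simp

theorem MeasureTheory.abs_measureReal_sub_le_of_subset {X : Type*} [MeasurableSpace X]
    {μ : Measure X} [IsFiniteMeasure μ] (s t u : Set X) (hs : s ⊆ t ∪ u) (ht : t ⊆ s ∪ u) :
    |μ.real s - μ.real t| ≤ μ.real u := by
  have h1 := (measureReal_mono (μ := μ) hs).trans (measureReal_union_le _ _)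
  have h2 := (measureReal_mono (μ := μ) ht).trans (measureReal_union_le _ _)
  rw [abs_le]
  constructor <;> linarith

namespace PMP

theorem measureReal_preimage_act (a : PMP Γ) (γ : Γ) {s : Set a.X}
    (hs : NullMeasurableSet s a.μ) : a.μ.real (a.act γ ⁻¹' s) = a.μ.real s :=
  congrArg ENNReal.toReal ((a.preserves γ).measure_preimage hs)

theorem act_inv_act (a : PMP Γ) (γ : Γ) (x : a.X) : a.act γ⁻¹ (a.act γ x) = x := by
  rw [← a.mul_act, inv_mul_cancel, a.one_act]

theorem act_act_inv (a : PMP Γ) (γ : Γ) (x : a.X) : a.act γ (a.act γ⁻¹ x) = x := by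
  rw [← a.mul_act, mul_inv_cancel, a.one_act]

theorem dist_M_le (a : PMP Γ) (S : Finset Γ) (k : ℕ) {f f' : a.X → Fin k}
    (hf : Measurable f) (hf' : Measurable f') :
    dist (a.M S k f) (a.M S k f') ≤ 2 * a.μ.real {x | f x ≠ f' x} := by
  refine (dist_pi_le_iff (by positivity)).2 fun q => ?_
  have hm : MeasurableSet {x | f x ≠ f' x} := (measurableSet_eq_fun hf hf').compl
  rw [Real.dist_eq]
  refine (abs_measureReal_sub_le_of_subset _ _
    ({x | f x ≠ f' x} ∪ a.act q.1 ⁻¹' {x | f x ≠ f' x}) ?_ ?_).trans ?_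
  · intro x hx
    simp only [Set.mem_union, Set.mem_ofPred_eq, Set.mem_preimage] at hx ⊢
    grind
  · intro x hx
    simp only [Set.mem_union, Set.mem_ofPred_eq, Set.mem_preimage] at hx ⊢
    grind
  · refine (measureReal_union_le _ _).trans ?_
    rw [a.measureReal_preimage_act _ hm.nullMeasurableSet]
    linarith

theorem exists_injective_sumElim [Infinite Γ] {γ : Γ} (hγ : γ ≠ 1) (r : ℕ) :
    ∃ δ : Fin r → Γ, Function.Injective (Sum.elim δ fun l => γ * δ l) := by
  induction r with
  | zero => exact ⟨Fin.elim0, fun x => by rcases x with x | x <;> exact x.elim0⟩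
  | succ r ih =>
    obtain ⟨δ, hδ⟩ := ih
    have hfin : (Set.range δ ∪ Set.range (fun l => γ * δ l) ∪
        Set.range (fun l => γ⁻¹ * δ l)).Finite :=
      ((Set.finite_range _).union (Set.finite_range _)).union (Set.finite_range _)
    obtain ⟨z, hz⟩ := hfin.exists_notMem
    simp only [Set.mem_union, Set.mem_range, not_or, not_exists] at hz
    obtain ⟨⟨h1, h2⟩, h3⟩ := hz
    have hz' : ∀ l, ¬ γ * z = δ l := fun l h => h3 l (by rw [← h]; group)
    have e1 : γ * z ≠ z := by simpa using hγ
    refine ⟨Fin.cons z δ, ?_⟩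
    rw [Sum.elim_injective] at hδ ⊢
    obtain ⟨i1, i2, i3⟩ := hδ
    refine ⟨Fin.cons_injective_iff.2 ⟨by simpa using h1, i1⟩, ?_, ?_⟩
    · exact (mul_right_injective γ).comp (Fin.cons_injective_iff.2 ⟨by simpa using h1, i1⟩)
    · intro x y
      refine Fin.cases ?_ (fun x => ?_) x <;> refine Fin.cases ?_ (fun y => ?_) y
      · simpa using e1.symm
      · simpa using fun h => h2 y h.symm
      · simpa using fun h => hz' x h.symm
      · simpa using i3 x y

/-- The translates of `b` are sufficiently independent to separate generic points. -/
def Spread (a : PMP Γ) (b : Set a.X) : Prop :=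
  ∀ γ : Γ, γ ≠ 1 → ∀ (r : ℕ) (δ : Fin r → Γ),
    Function.Injective (Sum.elim δ fun l => γ * δ l) →
    a.μ.real {x | ∀ l, a.act (δ l)⁻¹ x ∈ b ↔ a.act (γ * δ l)⁻¹ x ∈ b} ≤ (5 / 9 : ℝ) ^ r

theorem Spread.free [Countable Γ] [Infinite Γ] {a : PMP Γ} {b : Set a.X} (h : a.Spread b) :
    a.Free := by
  have h0 : ∀ γ : Γ, γ ≠ 1 → a.μ {x | a.act γ x = x} = 0 := by
    intro γ hγ
    have h1 : ∀ r : ℕ, a.μ.real {x | a.act γ x = x} ≤ (5 / 9 : ℝ) ^ r := by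
      intro r
      obtain ⟨δ, hδ⟩ := exists_injective_sumElim hγ r
      refine (measureReal_mono fun x hx => ?_).trans (h γ hγ r δ hδ)
      intro l
      have hx' : a.act γ⁻¹ x = x := by
        conv_lhs => rw [← show a.act γ x = x from hx]
        exact a.act_inv_act _ _
      rw [mul_inv_rev, a.mul_act, hx']
    have h2 := ge_of_tendsto' (tendsto_pow_atTop_nhds_zero_of_lt_one (by norm_num) (by norm_num)) h1
    exact (measureReal_eq_zero_iff).1 (le_antisymm h2 measureReal_nonneg)
  have h3 : a.μ {x | ∀ γ : Γ, γ ≠ 1 → a.act γ x ≠ x}ᶜ = 0 := by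
    have : {x | ∀ γ : Γ, γ ≠ 1 → a.act γ x ≠ x}ᶜ ⊆ ⋃ γ : {γ : Γ // γ ≠ 1},
        {x | a.act γ x = x} := by
      intro x hx
      simpa using hx
    exact measure_mono_null this (measure_iUnion_null fun γ => h0 _ γ.2)
  have h4 : {x | ∀ γ : Γ, γ ≠ 1 → a.act γ x ≠ x} =ᵐ[a.μ] Set.univ := by
    rwa [ae_eq_univ]
  rw [Free, measure_congr h4, measure_univ]

theorem Free.noAtoms [Infinite Γ] {a : PMP Γ} [MeasurableSingletonClass a.X] (h : a.Free) :
    NoAtoms a.μ := by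
  refine ⟨fun x => ?_⟩
  by_contra hx
  have hfree : ∀ γ : Γ, γ ≠ 1 → a.act γ x ≠ x := by
    by_contra hn
    have h1 : a.μ {y | ∀ γ : Γ, γ ≠ 1 → a.act γ y ≠ y} ≤ a.μ {x}ᶜ := measure_mono fun y hy => by
      rintro rfl
      exact hn hy
    rw [show a.μ _ = 1 from h, prob_compl_eq_one_sub (measurableSet_singleton x)] at h1
    have : 1 - a.μ {x} < 1 := ENNReal.sub_lt_self ENNReal.one_ne_top one_ne_zero hx
    exact absurd h1 (not_le.2 this)
  have hinj : Function.Injective fun γ => a.act γ x := by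
    intro γ δ hγδ
    by_contra hne
    refine hfree (δ⁻¹ * γ) (fun h => hne (inv_mul_eq_one.1 h).symm) ?_
    rw [a.mul_act, show a.act γ x = a.act δ x from hγδ, a.act_inv_act]
  have hm : ∀ γ, a.μ {a.act γ x} = a.μ {x} := by
    intro γ
    rw [← (a.preserves γ⁻¹).measure_preimage (measurableSet_singleton x).nullMeasurableSet]
    congr 1
    ext y
    simp only [Set.mem_singleton_iff, Set.mem_preimage]
    constructor
    · rintro rfl; exact a.act_inv_act _ _
    · rintro rfl; exact (a.act_act_inv _ _).symm
  have hsum : ∑' γ : Γ, a.μ {a.act γ x} ≤ 1 := by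
    rw [← (measure_univ : a.μ Set.univ = 1)]
    exact tsum_meas_le_meas_iUnion_of_disjoint _ (fun γ => measurableSet_singleton _)
      (fun γ δ hγδ => by simpa using fun h => hγδ (hinj h)) |>.trans
        (measure_mono (Set.subset_univ _))
  simp only [hm] at hsum
  rw [ENNReal.tsum_const_eq_top_of_ne_zero hx] at hsum
  exact absurd hsum (by simp)

end PMP

/-- A set of functions that depends on finitely many coordinates only. -/
def FinDep {I : Type*} {Z : I → Type*} (C : Set (∀ i, Z i)) : Prop :=
  ∃ W : Finset I, ∀ ω ω' : ∀ i, Z i, (∀ w ∈ W, ω w = ω' w) → ω ∈ C → ω' ∈ C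

namespace FinDep

variable {I : Type*} {Z : I → Type*} {C D : Set (∀ i, Z i)}

theorem compl (h : FinDep C) : FinDep Cᶜ := by
  obtain ⟨W, hW⟩ := h
  exact ⟨W, fun ω ω' hω hC hC' => hC (hW ω' ω (fun w hw => (hω w hw).symm) hC')⟩

theorem union (h : FinDep C) (h' : FinDep D) : FinDep (C ∪ D) := by
  classical
  obtain ⟨W, hW⟩ := h
  obtain ⟨W', hW'⟩ := h'
  refine ⟨W ∪ W', fun ω ω' hω =>
    Or.imp (hW ω ω' fun w hw => hω w ?_) (hW' ω ω' fun w hw => hω w ?_)⟩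
  · exact Finset.mem_union_left _ hw
  · exact Finset.mem_union_right _ hw

theorem eval (i : I) (T : Set (Z i)) : FinDep {ω : ∀ i, Z i | ω i ∈ T} :=
  ⟨{i}, fun ω ω' h (hω : ω i ∈ T) => by
    have := h i (Finset.mem_singleton_self i)
    simpa [← this] using hω⟩

theorem exists_preimage (h : FinDep C) :
    ∃ (W : Finset I) (T : Set (∀ w : W, Z w)), C = (fun ω (w : W) => ω w) ⁻¹' T := by
  obtain ⟨W, hW⟩ := h
  refine ⟨W, (fun ω (w : W) => ω w) '' C, Set.Subset.antisymm (Set.subset_preimage_image _ _) ?_⟩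
  rintro ω ⟨ω', h', e⟩
  exact hW ω' ω (fun w hw => congrFun e ⟨w, hw⟩) h'

variable [∀ i, MeasurableSpace (Z i)] [∀ i, MeasurableSingletonClass (Z i)] [∀ i, Finite (Z i)]

theorem measurableSet (h : FinDep C) : MeasurableSet C := by
  obtain ⟨W, T, rfl⟩ := h.exists_preimage
  exact (measurable_pi_lambda _ fun w => measurable_pi_apply _) (Set.toFinite T).measurableSet

variable (Z) in
theorem generateFrom :
    (MeasurableSpace.pi : MeasurableSpace (∀ i, Z i)) =
      MeasurableSpace.generateFrom {C | FinDep C} := by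
  apply le_antisymm
  · refine iSup_le fun p => ?_
    rintro _ ⟨T, -, rfl⟩
    exact MeasurableSpace.measurableSet_generateFrom (FinDep.eval p T)
  · exact MeasurableSpace.generateFrom_le fun C hC => hC.measurableSet

end FinDep

theorem isSetAlgebra_finDep {I : Type*} (Z : I → Type*) :
    IsSetAlgebra {C : Set (∀ i, Z i) | FinDep C} where
  empty_mem := ⟨∅, fun _ _ _ h => h⟩
  compl_mem _ h := h.compl
  union_mem _ _ h h' := h.union h'

namespace PMP

/-- An action whose values on an algebra of measurable sets are the limits, along an ultrafilter,
of the values of the actions `A i`. -/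
structure Limit (A : ℕ → PMP Γ) (𝒟 : ∀ i, Set (Set (A i).X)) where
  /-- the limit action -/
  α : PMP Γ
  std : StandardBorelSpace α.X
  /-- the comparison maps -/
  θ : ∀ i, (A i).X → α.X
  /-- the algebra on which the measures converge -/
  𝒞 : Set (Set α.X)
  alg : IsSetAlgebra 𝒞
  gen : α.mX = MeasurableSpace.generateFrom 𝒞
  act_mem : ∀ γ, ∀ C ∈ 𝒞, α.act γ ⁻¹' C ∈ 𝒞
  equivariant : ∀ i γ x, θ i ((A i).act γ x) = α.act γ (θ i x)
  preimage_mem : ∀ i, ∀ C ∈ 𝒞, θ i ⁻¹' C ∈ 𝒟 i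
  tendsto : ∀ C ∈ 𝒞,
    Tendsto (fun i => (A i).μ.real (θ i ⁻¹' C)) (hyperfilter ℕ) (𝓝 (α.μ.real C))

section exists_limit

variable {J : Type} [Countable J] [Countable Γ]

theorem exists_limit_of_sets (A : ℕ → PMP Γ) (𝒟 : ∀ i, Set (Set (A i).X))
    (halg : ∀ i, IsSetAlgebra (𝒟 i)) (hmeas : ∀ i, ∀ D ∈ 𝒟 i, MeasurableSet D)
    (hact : ∀ i γ, ∀ D ∈ 𝒟 i, (A i).act γ ⁻¹' D ∈ 𝒟 i)
    (B : ∀ i, J → Set (A i).X) (hB : ∀ i j, B i j ∈ 𝒟 i) :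
    ∃ l : Limit A 𝒟, ∀ j, ∃ c ∈ l.𝒞, ∀ i, l.θ i ⁻¹' c = B i j := by
  classical
  let Ω := J × Γ → Bool
  let θ : ∀ i, (A i).X → Ω := fun i x p => decide ((A i).act p.2⁻¹ x ∈ B i p.1)
  let act : Γ → Ω → Ω := fun γ ω p => ω (p.1, γ⁻¹ * p.2)
  let 𝒞 : Set (Set Ω) := {C | FinDep C}
  have hgen : (inferInstance : MeasurableSpace Ω) = MeasurableSpace.generateFrom 𝒞 :=
    FinDep.generateFrom fun _ => Bool
  have hclopen : ∀ C ∈ 𝒞, IsClopen C := by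
    intro C hC
    obtain ⟨W, T, rfl⟩ := FinDep.exists_preimage hC
    exact (isClopen_discrete T).preimage (continuous_pi fun w => continuous_apply _)
  have hCm : ∀ C ∈ 𝒞, MeasurableSet C := fun C hC => hC.measurableSet
  have hactC : ∀ γ, ∀ C ∈ 𝒞, act γ ⁻¹' C ∈ 𝒞 := by
    rintro γ C ⟨W, hW⟩
    refine ⟨W.image fun p => (p.1, γ⁻¹ * p.2), fun ω ω' h => hW _ _ fun w hw => h _ ?_⟩
    exact Finset.mem_image_of_mem _ hw
  have hequi : ∀ i γ x, θ i ((A i).act γ x) = act γ (θ i x) := by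
    intro i γ x
    ext p
    simp only [θ, act, ← (A i).mul_act, mul_inv_rev, inv_inv]
  have hpre : ∀ i, ∀ C ∈ 𝒞, θ i ⁻¹' C ∈ 𝒟 i := by
    intro i C hC
    obtain ⟨W, T, rfl⟩ := FinDep.exists_preimage hC
    exact (halg i).setOf_mem (ι := W) (C := fun w => (A i).act w.1.2⁻¹ ⁻¹' B i w.1.1)
      (fun w => hact _ _ _ (hB _ _)) fun χ => (fun w => decide (χ w)) ∈ T
  have hθ : ∀ i, Measurable (θ i) := fun i =>
    (measurable_generateFrom fun C hC => hmeas i _ (hpre i C hC)).mono le_rfl hgen.le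
  let P : ℕ → ProbabilityMeasure Ω := fun i =>
    ⟨(A i).μ.map (θ i), Measure.isProbabilityMeasure_map (hθ i).aemeasurable⟩
  obtain ⟨ν, hν⟩ : ∃ ν, Tendsto P (hyperfilter ℕ) (𝓝 ν) :=
    ⟨_, ((hyperfilter ℕ).map P).le_nhds_lim⟩
  have htend : ∀ C ∈ 𝒞, Tendsto (fun i => (A i).μ.real (θ i ⁻¹' C)) (hyperfilter ℕ)
      (𝓝 ((ν : Measure Ω).real C)) := by
    intro C hC
    have h1 := ProbabilityMeasure.tendsto_measure_of_null_frontier_of_tendsto' hν (E := C)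
      (by rw [(hclopen C hC).frontier_eq]; simp)
    have h2 := (ENNReal.tendsto_toReal (measure_ne_top (ν : Measure Ω) C)).comp h1
    refine h2.congr fun i => ?_
    simp only [Function.comp, P, ProbabilityMeasure.coe_mk]
    rw [Measure.map_apply (hθ i) (hCm C hC)]
    rfl
  have hactm : ∀ γ, Measurable (act γ) := fun γ =>
    measurable_pi_lambda _ fun p => measurable_pi_apply _
  have hpres : ∀ γ, MeasurePreserving (act γ) (ν : Measure Ω) ν := by
    intro γ
    refine ⟨hactm γ, ?_⟩
    have : IsProbabilityMeasure ((ν : Measure Ω).map (act γ)) :=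
      Measure.isProbabilityMeasure_map (hactm γ).aemeasurable
    refine ext_of_generate_finite 𝒞 hgen ?_ ?_ (by simp)
    · exact fun s hs t ht _ => (isSetAlgebra_finDep _).inter_mem hs ht
    · intro C hC
      rw [Measure.map_apply (hactm γ) (hCm C hC)]
      have h1 := htend _ (hactC γ C hC)
      have h2 := htend C hC
      have h3 : ∀ i, (A i).μ.real (θ i ⁻¹' (act γ ⁻¹' C)) = (A i).μ.real (θ i ⁻¹' C) := by
        intro i
        rw [← (A i).measureReal_preimage_act γ (hmeas i _ (hpre i C hC)).nullMeasurableSet]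
        congr 1
        ext x
        simp [hequi]
      simp only [h3] at h1
      exact (measureReal_eq_measureReal_iff).1 (tendsto_nhds_unique h1 h2)
  refine ⟨⟨⟨Ω, ν, act, ?_, ?_, hpres⟩, ?_, θ, 𝒞, isSetAlgebra_finDep _, hgen, hactC, hequi,
    hpre, htend⟩, fun j => ⟨{ω | ω (j, 1) ∈ ({true} : Set Bool)}, FinDep.eval _ _, fun i => ?_⟩⟩
  · intro ω; ext p; simp [act]
  · intro γ δ ω; ext p; simp [act, mul_assoc]
  · show StandardBorelSpace Ω
    infer_instance
  · ext x
    simp [θ, (A i).one_act]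

end exists_limit

namespace Limit

variable {A : ℕ → PMP Γ} {𝒟 : ∀ i, Set (Set (A i).X)} (l : Limit A 𝒟)

theorem measureDense : l.α.μ.MeasureDense l.𝒞 :=
  Measure.MeasureDense.of_generateFrom_isSetAlgebra_finite _ l.alg l.gen

theorem tendsto_M (S : Finset Γ) (k : ℕ) {f : l.α.X → Fin k} (hf : ∀ s, f ⁻¹' s ∈ l.𝒞) :
    Tendsto (fun i => (A i).M S k (f ∘ l.θ i)) (hyperfilter ℕ) (𝓝 (l.α.M S k f)) := by
  refine tendsto_pi_nhds.2 fun q => ?_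
  have := l.tendsto _ (l.alg.inter_mem (hf {q.2.1}) (l.act_mem q.1 _ (hf {q.2.2})))
  refine this.congr fun i => ?_
  simp only [M, Measure.real]
  congr 2
  ext x
  simp [l.equivariant]

theorem spread {c : Set l.α.X} (hc : c ∈ l.𝒞) (h : ∀ i, (A i).Spread (l.θ i ⁻¹' c)) :
    l.α.Spread c := by
  intro γ hγ r δ hδ
  have hmem : {x | ∀ j, l.α.act (δ j)⁻¹ x ∈ c ↔ l.α.act (γ * δ j)⁻¹ x ∈ c} ∈ l.𝒞 :=
    l.alg.setOf_mem (ι := Fin r ⊕ Fin r)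
      (C := Sum.elim (fun j => l.α.act (δ j)⁻¹ ⁻¹' c) fun j => l.α.act (γ * δ j)⁻¹ ⁻¹' c)
      (by rintro (j | j) <;> exact l.act_mem _ _ hc)
      fun χ => ∀ j, χ (Sum.inl j) ↔ χ (Sum.inr j)
  refine le_of_tendsto' (l.tendsto _ hmem) fun i => ?_
  refine le_trans (le_of_eq ?_) (h i γ hγ r δ hδ)
  congr 1
  ext x
  simp [l.equivariant]

end Limit

theorem C_nonempty (a : PMP Γ) (S : Finset Γ) (k : ℕ) : (a.C S (k + 1)).Nonempty :=
  ⟨_, subset_closure ⟨fun _ => 0, measurable_const, rfl⟩⟩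

theorem M_mem_C (a : PMP Γ) (S : Finset Γ) (k : ℕ) {f : a.X → Fin k} (hf : Measurable f) :
    a.M S k f ∈ a.C S k :=
  subset_closure ⟨f, hf, rfl⟩

theorem C_subset_Icc (a : PMP Γ) (S : Finset Γ) (k : ℕ) :
    a.C S k ⊆ Set.Icc (fun _ => 0) (fun _ => 1) := by
  refine closure_minimal ?_ isClosed_Icc
  rintro _ ⟨f, -, rfl⟩
  exact ⟨fun q => ENNReal.toReal_nonneg, fun q => measureReal_le_one⟩

open Metric TopologicalSpace in
theorem exists_limit [Countable Γ] (A : ℕ → PMP Γ) (𝒟 : ∀ i, Set (Set (A i).X))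
    (halg : ∀ i, IsSetAlgebra (𝒟 i)) (hd : ∀ i, (A i).μ.MeasureDense (𝒟 i))
    (hact : ∀ i γ, ∀ D ∈ 𝒟 i, (A i).act γ ⁻¹' D ∈ 𝒟 i)
    (b : ∀ i, Set (A i).X) (hb : ∀ i, b i ∈ 𝒟 i) :
    ∃ l : Limit A 𝒟, (∃ c ∈ l.𝒞, ∀ i, l.θ i ⁻¹' c = b i) ∧
      ∀ (S : Finset Γ) (k : ℕ), 0 < k →
        Tendsto (fun i => hausdorffDist ((A i).C S k) (l.α.C S k)) (hyperfilter ℕ) (𝓝 0) := by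
  classical
  let v : ∀ (S : Finset Γ) (k : ℕ), ℕ → (↥S × Fin (k + 1) × Fin (k + 1) → ℝ) :=
    fun S k => denseSeq _
  have hf : ∀ i S k t, ∃ f : (A i).X → Fin (k + 1), (∀ s, f ⁻¹' s ∈ 𝒟 i) ∧
      dist (v S k t) ((A i).M S (k + 1) f) ≤
          infDist (v S k t) ((A i).C S (k + 1)) + 1 / (i + 1) := by
    intro i S k t
    have hi : (0 : ℝ) < 1 / (i + 1) := by positivity
    obtain ⟨u, hu, hut⟩ := (infDist_lt_iff ((A i).C_nonempty S k)).1
      (show infDist (v S k t) ((A i).C S (k + 1)) <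
        infDist (v S k t) ((A i).C S (k + 1)) + 1 / (i + 1) / 3 by linarith)
    obtain ⟨_, ⟨f, hfm, rfl⟩, hfu⟩ := Metric.mem_closure_iff.1 hu (1 / (i + 1) / 3) (by positivity)
    obtain ⟨f', hf', hff'⟩ := (hd i).exists_fin_approx (halg i) hfm
      (show (0 : ℝ) < 1 / (i + 1) / 6 by positivity)
    refine ⟨f', hf', ?_⟩
    have h1 := (A i).dist_M_le S (k + 1) hfm fun s _ => (hd i).measurable _ (hf' s)
    have h2 := dist_triangle4 (v S k t) u ((A i).M S (k + 1) f) ((A i).M S (k + 1) f')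
    linarith
  choose f hfD hfd using hf
  let J := Option (Finset Γ × ℕ × ℕ × ℕ)
  obtain ⟨l, hl⟩ := exists_limit_of_sets (J := J) A 𝒟 halg (fun i => (hd i).measurable) hact
    (fun i j => j.elim (b i) fun q => {x | (f i q.1 q.2.1 q.2.2.1 x : ℕ) = q.2.2.2}) (by
      rintro i (_ | ⟨S, k, t, n⟩)
      · exact hb i
      · exact hfD i S k t {z | (z : ℕ) = n})
  refine ⟨l, hl none, ?_⟩
  intro S k hk
  obtain ⟨k, rfl⟩ : ∃ k', k = k' + 1 := ⟨k - 1, by omega⟩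
  have hg : ∀ t, ∃ g : l.α.X → Fin (k + 1), (∀ s, g ⁻¹' s ∈ l.𝒞) ∧
      ∀ i, g ∘ l.θ i = f i S k t := by
    intro t
    choose c hc hcθ using fun n : Fin (k + 1) => hl (some (S, k, t, n))
    let F : (Fin (k + 1) → Prop) → Fin (k + 1) :=
      fun χ => if hχ : ∃ j, ∀ l, χ l ↔ l = j then hχ.choose else 0
    refine ⟨fun x => F fun n => x ∈ c n, fun s => l.alg.setOf_mem hc fun χ => F χ ∈ s, fun i => ?_⟩
    ext x
    have hχ : ∃ j, ∀ n, l.θ i x ∈ c n ↔ n = j := by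
      refine ⟨f i S k t x, fun n => ?_⟩
      rw [← Set.mem_preimage, hcθ]
      simp [Fin.ext_iff, eq_comm]
    have h1 : l.θ i x ∈ c (f i S k t x) := by
      rw [← Set.mem_preimage, hcθ]
      simp
    simp only [Function.comp, F, dif_pos hχ]
    rw [(hχ.choose_spec _).1 h1]
  choose g hgC hgf using hg
  have hlt := fun f' => l.tendsto_M S (k + 1) (f := f')
  have hm : ∀ f' : l.α.X → Fin (k + 1), (∀ s, f' ⁻¹' s ∈ l.𝒞) → Measurable f' :=
    fun f' hf' s _ => l.measureDense.measurable _ (hf' s)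
  have hmi : ∀ i, ∀ f' : l.α.X → Fin (k + 1), (∀ s, f' ⁻¹' s ∈ l.𝒞) → Measurable (f' ∘ l.θ i) :=
    fun i f' hf' s _ => (hd i).measurable _ (l.preimage_mem i _ (hf' s))
  rw [Metric.tendsto_nhds]
  intro ε hε
  have hK : TotallyBounded (Set.Icc (fun _ => (0 : ℝ)) (fun _ => 1) :
      Set (↥S × Fin (k + 1) × Fin (k + 1) → ℝ)) := isCompact_Icc.totallyBounded
  have hδ : 0 < ε / 10 := by positivity
  set δ := ε / 10 with hδd
  -- points of `C(α,S,k)` are near `C(A i,S,k)`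
  have h1 : ∀ᶠ i in (hyperfilter ℕ : Filter ℕ), ∀ u ∈ l.α.C S (k + 1),
      ∃ w ∈ (A i).C S (k + 1), dist u w ≤ 6 * δ := by
    obtain ⟨T, hTs, hTf, hT⟩ := Metric.finite_approx_of_totallyBounded
      (hK.subset (l.α.C_subset_Icc S (k + 1))) δ hδ
    have h2 : ∀ t ∈ T, ∃ f' : l.α.X → Fin (k + 1), (∀ s, f' ⁻¹' s ∈ l.𝒞) ∧
        dist t (l.α.M S (k + 1) f') ≤ 3 * δ := by
      intro t ht
      obtain ⟨_, ⟨f, hfm, rfl⟩, hfu⟩ := Metric.mem_closure_iff.1 (hTs ht) δ hδ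
      obtain ⟨f', hf', hff'⟩ := l.measureDense.exists_fin_approx l.alg hfm hδ
      refine ⟨f', hf', ?_⟩
      have h1 := l.α.dist_M_le S (k + 1) hfm (hm f' hf')
      have h2 := dist_triangle t (l.α.M S (k + 1) f) (l.α.M S (k + 1) f')
      linarith
    choose! f' hf' hft using h2
    have h3 := (hTf.eventually_all (l := (hyperfilter ℕ : Filter ℕ))).2 fun t ht =>
      Metric.tendsto_nhds.1 (hlt _ (hf' t ht)) δ hδ
    filter_upwards [h3] with i hi u hu
    obtain ⟨t, ht, hut⟩ := Set.mem_iUnion₂.1 (hT hu)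
    refine ⟨_, (A i).M_mem_C S (k + 1) (hmi i _ (hf' t ht)), ?_⟩
    have e1 := hi t ht
    have e2 := hft t ht
    have e3 := dist_triangle4 u t (l.α.M S (k + 1) (f' t)) ((A i).M S (k + 1) (f' t ∘ l.θ i))
    rw [dist_comm] at e1
    have e4 : dist u t < δ := hut
    linarith
  -- points of `C(A i,S,k)` are near `C(α,S,k)`
  have h2 : ∀ᶠ i in (hyperfilter ℕ : Filter ℕ), ∀ u ∈ (A i).C S (k + 1),
      ∃ w ∈ l.α.C S (k + 1), dist u w ≤ 6 * δ := by
    obtain ⟨T, hTs, hTf, hT⟩ := Metric.finite_approx_of_totallyBounded hK δ hδ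
    have hdense : ∀ t, ∃ n, dist t (v S k n) < δ := fun t =>
      (denseRange_denseSeq _).exists_dist_lt t hδ
    choose n hn using hdense
    have h3 : ∀ t, ∀ᶠ i in (hyperfilter ℕ : Filter ℕ),
        infDist (v S k (n t)) ((A i).C S (k + 1)) < 2 * δ →
          dist (v S k (n t)) (l.α.M S (k + 1) (g (n t))) ≤ 4 * δ := by
      intro t
      rcases Ultrafilter.eventually_or.1 (Eventually.of_forall (f := (hyperfilter ℕ : Filter ℕ))
        fun i => em (infDist (v S k (n t)) ((A i).C S (k + 1)) < 2 * δ)) with h | h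
      · have h4 : ∀ᶠ i : ℕ in (hyperfilter ℕ : Filter ℕ), 1 / ((i : ℝ) + 1) < δ :=
          (tendsto_one_div_add_atTop_nhds_zero_nat.mono_left Nat.hyperfilter_le_atTop).eventually
            (gt_mem_nhds hδ)
        obtain ⟨i, hi, hi', hi''⟩ :=
          (h.and (h4.and (Metric.tendsto_nhds.1 (hlt _ (hgC (n t))) δ hδ))).exists
        refine Eventually.of_forall fun _ _ => ?_
        rw [hgf] at hi''
        have e1 := hfd i S k (n t)
        have e2 := dist_triangle (v S k (n t)) ((A i).M S (k + 1) (f i S k (n t)))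
          (l.α.M S (k + 1) (g (n t)))
        linarith
      · filter_upwards [h] with i hi hi'
        exact absurd hi' hi
    filter_upwards [(hTf.eventually_all (l := (hyperfilter ℕ : Filter ℕ))).2 fun t _ => h3 t]
      with i hi u hu
    obtain ⟨t, ht, hut⟩ := Set.mem_iUnion₂.1 (hT ((A i).C_subset_Icc S (k + 1) hu))
    have e1 : dist u t < δ := hut
    have e2 := dist_triangle u t (v S k (n t))
    have e3 : infDist (v S k (n t)) ((A i).C S (k + 1)) < 2 * δ := by
      refine (infDist_le_dist_of_mem hu).trans_lt ?_
      rw [dist_comm]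
      linarith [hn t]
    refine ⟨_, l.α.M_mem_C S (k + 1) (hm _ (hgC (n t))), ?_⟩
    have e4 := dist_triangle u (v S k (n t)) (l.α.M S (k + 1) (g (n t)))
    have e5 := hi t ht e3
    linarith [hn t]
  filter_upwards [h1, h2] with i hi1 hi2
  rw [Real.dist_eq, sub_zero, abs_of_nonneg hausdorffDist_nonneg]
  refine (hausdorffDist_le_of_mem_dist (by positivity) hi2 hi1).trans_lt ?_
  rw [hδd]
  linarith

end PMP

/-- The normalized counting measure on a finite set. -/
noncomputable def unif (K : Type*) [MeasurableSpace K] : Measure K :=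
  ProbabilityTheory.uniformOn Set.univ

section unif

variable {K : Type*} [MeasurableSpace K] [MeasurableSingletonClass K] [Finite K]

instance [Nonempty K] : IsProbabilityMeasure (unif K) :=
  ProbabilityTheory.isProbabilityMeasure_uniformOn (Set.toFinite _) Set.univ_nonempty

theorem unif_real (s : Set K) : (unif K).real s = s.ncard / Nat.card K := by
  cases nonempty_fintype K
  rw [Measure.real, unif, ProbabilityTheory.uniformOn_univ, ENNReal.toReal_div,
    Measure.count_apply_finite _ s.toFinite, Nat.card_eq_fintype_card,
    Set.ncard_eq_toFinset_card s]
  simp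

theorem unif_preimage [Nonempty K] (e : Equiv.Perm K) (s : Set K) : unif K (e ⁻¹' s) = unif K s := by
  rw [← measureReal_eq_measureReal_iff, unif_real, unif_real, ← e.image_symm_eq_preimage,
    Set.ncard_image_of_injective _ e.symm.injective]

end unif

namespace Skew

variable {E J : Type} {K : J → Type} [∀ j, MeasurableSpace (K j)]
  [∀ j, MeasurableSingletonClass (K j)] [∀ j, Finite (K j)] [∀ j, Group (K j)]

/-- The product of the uniform measures. -/
noncomputable def haar (E : Type) {J : Type} (K : J → Type) [∀ j, MeasurableSpace (K j)]
    [∀ j, MeasurableSingletonClass (K j)] [∀ j, Finite (K j)] [∀ j, Group (K j)] :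
    Measure (∀ q : E × J, K q.2) :=
  Measure.infinitePi fun q : E × J => unif (K q.2)

instance : IsProbabilityMeasure (haar E K) := by
  unfold haar; infer_instance

theorem measurePreserving_perm (τ : Equiv.Perm E) (σ : ∀ q : E × J, Equiv.Perm (K q.2)) :
    MeasurePreserving (fun (ω : ∀ q : E × J, K q.2) q => σ q (ω (τ q.1, q.2)))
      (haar E K) (haar E K) := by
  classical
  have hm : Measurable fun (ω : ∀ q : E × J, K q.2) q => σ q (ω (τ q.1, q.2)) :=
    measurable_pi_lambda _ fun q => (measurable_of_countable _).comp (measurable_pi_apply _)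
  refine ⟨hm, ?_⟩
  refine Measure.eq_infinitePi _ fun s t ht => ?_
  rw [Measure.map_apply hm (MeasurableSet.pi s.countable_toSet fun q _ => ht q)]
  let t' : ∀ q : E × J, Set (K q.2) :=
    fun q => σ (τ.symm q.1, q.2) ⁻¹' t (τ.symm q.1, q.2)
  have h1 : (fun (ω : ∀ q : E × J, K q.2) q => σ q (ω (τ q.1, q.2))) ⁻¹' Set.pi s t =
      Set.pi (s.map (τ.prodCongr (Equiv.refl J)).toEmbedding) t' := by
    ext ω
    simp only [Set.mem_preimage, Set.mem_pi, Finset.mem_coe, Finset.mem_map,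
      forall_exists_index, and_imp, forall_apply_eq_imp_iff₂, Equiv.coe_toEmbedding, t']
    refine forall₂_congr fun ⟨e, j⟩ hq => ?_
    show _ ↔ σ (τ.symm (τ e), j) (ω (τ e, j)) ∈ t (τ.symm (τ e), j)
    rw [Equiv.symm_apply_apply]
  rw [h1, haar, Measure.infinitePi_pi _ fun q _ => (Set.toFinite _).measurableSet,
    Finset.prod_map]
  refine Finset.prod_congr rfl fun ⟨e, j⟩ hq => ?_
  show unif (K j) (σ (τ.symm (τ e), j) ⁻¹' t (τ.symm (τ e), j)) = unif (K j) (t (e, j))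
  rw [Equiv.symm_apply_apply, unif_preimage]

theorem apply_congr (ω : ∀ q : E × J, K q.2) {e e' : E} (h : e = e') (j : J) :
    (ω (e, j) : K j) = ω (e', j) := by
  rw [h]

variable [MulAction Γ E]

/-- The skew product action on functions defined by a cocycle. -/
noncomputable def pmp (c : Γ → E → ∀ j, K j)
    (hc : ∀ γ δ e, c (γ * δ) e = c γ (δ • e) * c δ e) : PMP Γ where
  X := ∀ q : E × J, K q.2
  μ := haar E K
  act γ ω q := c γ (γ⁻¹ • q.1) q.2 * ω (γ⁻¹ • q.1, q.2)
  one_act := by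
    have h1 : ∀ e, c 1 e = 1 := fun e => by simpa using hc 1 1 e
    intro ω
    ext q
    simp only [h1, Pi.one_apply, one_mul]
    exact apply_congr ω (by simp) q.2
  mul_act := by
    intro γ δ ω
    ext q
    simp only [_root_.mul_inv_rev, mul_smul, hc, Pi.mul_apply, mul_assoc, smul_inv_smul]
    rw [apply_congr ω (by simp [mul_smul] : (γ * δ)⁻¹ • q.1 = δ⁻¹ • γ⁻¹ • q.1) q.2]
  preserves γ := measurePreserving_perm (MulAction.toPerm γ⁻¹)
    fun q => Equiv.mulLeft (c γ (γ⁻¹ • q.1) q.2)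

section

variable (c : Γ → E → ∀ j, K j) (hc : ∀ γ δ e, c (γ * δ) e = c γ (δ • e) * c δ e)

theorem standardBorelSpace [Countable E] [Countable J] : StandardBorelSpace (pmp c hc).X :=
  inferInstanceAs (StandardBorelSpace (∀ q : E × J, K q.2))

theorem measureDense : (pmp c hc).μ.MeasureDense {C : Set (∀ q : E × J, K q.2) | FinDep C} :=
  Measure.MeasureDense.of_generateFrom_isSetAlgebra_finite _ (isSetAlgebra_finDep _)
    (FinDep.generateFrom fun q : E × J => K q.2)

theorem finDep_act (γ : Γ) {D : Set (∀ q : E × J, K q.2)} (hD : FinDep D) :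
    FinDep ((pmp c hc).act γ ⁻¹' D : Set (∀ q : E × J, K q.2)) := by
  classical
  obtain ⟨W, hW⟩ := hD
  refine ⟨W.image fun q => (γ⁻¹ • q.1, q.2), fun ω ω' h => hW _ _ fun q hq => ?_⟩
  have := h _ (Finset.mem_image_of_mem (fun q : E × J => (γ⁻¹ • q.1, q.2)) hq)
  simp only [pmp] at this ⊢
  rw [this]

theorem spread (e : E) (he : Function.Injective fun γ : Γ => γ • e)
    (hce : ∀ γ δ : Γ, c γ (δ • e) = 1)
    (j : J) (H : Set (K j)) (h1 : 1 / 3 ≤ (unif (K j)).real H) (h2 : (unif (K j)).real H ≤ 1 / 2) :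
    (pmp c hc).Spread {ω : ∀ q : E × J, K q.2 | ω (e, j) ∈ H} := by
  classical
  intro γ hγ r δ hδ
  let x : Fin r ⊕ Fin r → Γ := Sum.elim δ fun l => γ * δ l
  have hind : ProbabilityTheory.iIndepFun
      (fun (s : Fin r ⊕ Fin r) (ω : ∀ q : E × J, K q.2) => ω (x s • e, j)) (haar E K) :=
    (ProbabilityTheory.iIndepFun_infinitePi (P := fun q : E × J => unif (K q.2))
      (X := fun _ z => z) fun _ => measurable_id).precomp (g := fun s => (x s • e, j))
      fun s s' h => hδ (he (by simpa using h))
  have hact : ∀ (δ : Γ) (ω : ∀ q : E × J, K q.2),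
      (pmp c hc).act δ⁻¹ ω (e, j) = ω (δ • e, j) := by
    intro δ ω
    simp only [pmp, hce, Pi.one_apply, one_mul]
    exact apply_congr ω (by simp) j
  let Hb : Bool → Set (K j) := fun b => if b then H else Hᶜ
  have hsub : {ω | ∀ l, (pmp c hc).act (δ l)⁻¹ ω ∈ {ω : ∀ q : E × J, K q.2 | ω (e, j) ∈ H} ↔
      (pmp c hc).act (γ * δ l)⁻¹ ω ∈ {ω : ∀ q : E × J, K q.2 | ω (e, j) ∈ H}} ⊆
      ⋃ χ : Fin r → Bool, ⋂ s : Fin r ⊕ Fin r,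
        (fun ω : ∀ q : E × J, K q.2 => ω (x s • e, j)) ⁻¹' Hb (Sum.elim χ χ s) := by
    intro ω hω
    replace hω : ∀ l, ω (δ l • e, j) ∈ H ↔ ω ((γ * δ l) • e, j) ∈ H := fun l =>
      (Iff.of_eq (congrArg (· ∈ H) (hact (δ l) ω))).symm.trans
        ((hω l).trans (Iff.of_eq (congrArg (· ∈ H) (hact (γ * δ l) ω))))
    refine Set.mem_iUnion.2 ⟨fun l => decide (ω (δ l • e, j) ∈ H), Set.mem_iInter.2 ?_⟩
    rintro (l | l)
    · show ω (δ l • e, j) ∈ Hb (decide (ω (δ l • e, j) ∈ H))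
      by_cases h : ω (δ l • e, j) ∈ H <;> simp [h, Hb]
    · show ω ((γ * δ l) • e, j) ∈ Hb (decide (ω (δ l • e, j) ∈ H))
      have := hω l
      by_cases h : ω (δ l • e, j) ∈ H <;> simp [h, Hb, this.symm]
  have hprob : ∀ χ : Fin r → Bool, (haar E K).real (⋂ s : Fin r ⊕ Fin r,
        (fun ω : ∀ q : E × J, K q.2 => ω (x s • e, j)) ⁻¹' Hb (Sum.elim χ χ s)) =
        ∏ l, (unif (K j)).real (Hb (χ l)) ^ 2 := by
    intro χ
    rw [Measure.real, hind.meas_iInter fun s => ⟨_, (Set.toFinite _).measurableSet, rfl⟩,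
      ENNReal.toReal_prod]
    have : ∀ s : Fin r ⊕ Fin r, (haar E K ((fun ω : ∀ q : E × J, K q.2 => ω (x s • e, j)) ⁻¹'
        Hb (Sum.elim χ χ s))).toReal = (unif (K j)).real (Hb (Sum.elim χ χ s)) := by
      intro s
      rw [← Measure.map_apply (measurable_pi_apply _) (Set.toFinite _).measurableSet, haar]
      exact congrArg ENNReal.toReal (congrArg (fun ν : Measure (K j) => ν _)
        (Measure.infinitePi_map_eval (fun q : E × J => unif (K q.2)) (x s • e, j)))
    rw [Finset.prod_congr rfl fun s _ => this s, Fintype.prod_sum_type, ← Finset.prod_mul_distrib]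
    simp [sq]
  have ht : (unif (K j)).real Hᶜ = 1 - (unif (K j)).real H :=
    probReal_compl_eq_one_sub (Set.toFinite _).measurableSet
  calc (haar E K).real _ ≤ _ := measureReal_mono hsub
    _ ≤ ∑ χ : Fin r → Bool, ∏ l, (unif (K j)).real (Hb (χ l)) ^ 2 :=
        (measureReal_iUnion_fintype_le _).trans (Finset.sum_le_sum fun χ _ => (hprob χ).le)
    _ = (∑ b : Bool, (unif (K j)).real (Hb b) ^ 2) ^ r := by
        rw [Finset.sum_pow', Fintype.piFinset_univ]
    _ ≤ (5 / 9) ^ r := by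
        refine pow_le_pow_left₀ (by positivity) ?_ r
        simp only [Fintype.sum_bool, Hb, if_true, Bool.false_eq_true, if_false, ht]
        nlinarith

end

end Skew

namespace CoordGap

open FreeGroup (mk hd bar)

variable {E Z : Type}

/-- Functions on `E → Z` that depend on finitely many coordinates. -/
def finFun (E Z : Type) : Submodule ℝ ((E → Z) → ℝ) where
  carrier := {f | ∃ W : Finset E, ∀ ω ω' : E → Z, (∀ w ∈ W, ω w = ω' w) → f ω = f ω'}
  zero_mem' := ⟨∅, fun _ _ _ => rfl⟩
  add_mem' := by
    classical
    rintro f g ⟨W, hW⟩ ⟨W', hW'⟩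
    refine ⟨W ∪ W', fun ω ω' h => ?_⟩
    simp only [Pi.add_apply]
    rw [hW ω ω' fun w hw => h w (Finset.mem_union_left _ hw),
      hW' ω ω' fun w hw => h w (Finset.mem_union_right _ hw)]
  smul_mem' := by
    rintro c f ⟨W, hW⟩
    refine ⟨W, fun ω ω' h => ?_⟩
    simp only [Pi.smul_apply]
    rw [hW ω ω' h]

theorem mul_mem_finFun {f g : (E → Z) → ℝ} (hf : f ∈ finFun E Z) (hg : g ∈ finFun E Z) :
    (fun ω => f ω * g ω) ∈ finFun E Z := by
  classical
  obtain ⟨W, hW⟩ := hf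
  obtain ⟨W', hW'⟩ := hg
  refine ⟨W ∪ W', fun ω ω' h => ?_⟩
  simp only
  rw [hW ω ω' fun w hw => h w (Finset.mem_union_left _ hw),
    hW' ω ω' fun w hw => h w (Finset.mem_union_right _ hw)]

theorem indicator_mem_finFun {D : Set (E → Z)} (hD : FinDep D) :
    (D.indicator fun _ => 1) ∈ finFun E Z := by
  classical
  obtain ⟨W, hW⟩ := hD
  refine ⟨W, fun ω ω' h => ?_⟩
  have : ω ∈ D ↔ ω' ∈ D := ⟨hW ω ω' h, hW ω' ω fun w hw => (h w hw).symm⟩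
  simp only [Set.indicator_apply, this]

/-- Right multiplication of one coordinate. -/
noncomputable def rmul [Group Z] (e : E) (z : Z) (ω : E → Z) : E → Z :=
  open Classical in Function.update ω e (ω e * z)

/-- The skew action defined by `c`. -/
def skew {G : Type*} [Group G] [MulAction G E] [Group Z] (c : G → E → Z) (w : G) (ω : E → Z) :
    E → Z :=
  fun e => c w (w⁻¹ • e) * ω (w⁻¹ • e)

section

variable [Group Z]

theorem comp_rmul_mem {f : (E → Z) → ℝ} (hf : f ∈ finFun E Z) (e : E) (z : Z) :
    f ∘ rmul e z ∈ finFun E Z := by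
  classical
  obtain ⟨W, hW⟩ := hf
  refine ⟨W, fun ω ω' h => hW _ _ fun w hw => ?_⟩
  by_cases hwe : w = e
  · subst hwe; simp [rmul, h w hw]
  · simp [rmul, hwe, h w hw]

theorem comp_skew_mem {G : Type*} [Group G] [MulAction G E] {f : (E → Z) → ℝ}
    (hf : f ∈ finFun E Z) (c : G → E → Z) (w : G) : f ∘ skew c w ∈ finFun E Z := by
  classical
  obtain ⟨W, hW⟩ := hf
  refine ⟨W.image fun e => w⁻¹ • e, fun ω ω' h => hW _ _ fun e he => ?_⟩
  simp only [skew]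
  rw [h _ (Finset.mem_image_of_mem _ he)]

theorem rmul_rmul (e : E) (z z' : Z) (ω : E → Z) : rmul e z (rmul e z' ω) = rmul e (z' * z) ω := by
  classical
  simp [rmul, mul_assoc]

theorem rmul_comm {e e' : E} (h : e ≠ e') (z z' : Z) (ω : E → Z) :
    rmul e z (rmul e' z' ω) = rmul e' z' (rmul e z ω) := by
  classical
  simp only [rmul, Function.update_of_ne h, Function.update_of_ne h.symm]
  exact Function.update_comm h.symm _ _ _

theorem skew_rmul {G : Type*} [Group G] [MulAction G E] (c : G → E → Z) (w : G) (e : E) (z : Z)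
    (ω : E → Z) : skew c w (rmul e z ω) = rmul (w • e) z (skew c w ω) := by
  classical
  ext e'
  by_cases h : e' = w • e
  · subst h; simp [skew, rmul, mul_assoc]
  · have h' : w⁻¹ • e' ≠ e := fun h' => h (by rw [← h', smul_inv_smul])
    simp [skew, rmul, h, h']

/-- Averaging over one coordinate. -/
noncomputable def avg [Fintype Z] (e : E) : Module.End ℝ (finFun E Z) :=
  (Fintype.card Z : ℝ)⁻¹ • ∑ z : Z,
    (LinearMap.funLeft ℝ ℝ (rmul e z)).restrict fun _ hf => comp_rmul_mem hf e z

/-- The operator of composition with the skew action. -/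
def trans {G : Type*} [Group G] [MulAction G E] (c : G → E → Z) (w : G) :
    Module.End ℝ (finFun E Z) :=
  (LinearMap.funLeft ℝ ℝ (skew c w)).restrict fun _ hf => comp_skew_mem hf c w

theorem trans_apply {G : Type*} [Group G] [MulAction G E] (c : G → E → Z) (w : G)
    (f : finFun E Z) (ω : E → Z) : (trans c w f).1 ω = f.1 (skew c w ω) := rfl

variable [Fintype Z]

theorem avg_apply (e : E) (f : finFun E Z) (ω : E → Z) :
    (avg e f).1 ω = (∑ z, f.1 (rmul e z ω)) / Fintype.card Z := by
  simp [avg, LinearMap.funLeft, div_eq_inv_mul, LinearMap.sum_apply, Finset.sum_apply]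

theorem sum_rmul_rmul (e : E) (z : Z) (f : (E → Z) → ℝ) (ω : E → Z) :
    ∑ z', f (rmul e z' (rmul e z ω)) = ∑ z', f (rmul e z' ω) := by
  simp only [rmul_rmul]
  exact Fintype.sum_equiv (Equiv.mulLeft z) _ _ fun _ => rfl

theorem avg_comm (e e' : E) (f : finFun E Z) : avg e (avg e' f) = avg e' (avg e f) := by
  rcases eq_or_ne e e' with rfl | h
  · rfl
  ext ω
  simp only [avg_apply, ← Finset.sum_div]
  rw [Finset.sum_comm]
  simp only [rmul_comm h]

theorem avg_avg (e : E) (f : finFun E Z) : avg e (avg e f) = avg e f := by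
  ext ω
  simp only [avg_apply, sum_rmul_rmul]
  simp

theorem trans_avg {G : Type*} [Group G] [MulAction G E] (c : G → E → Z) (w : G) (e : E)
    (f : finFun E Z) : trans c w (avg (w • e) f) = avg e (trans c w f) := by
  ext ω
  simp only [avg_apply, trans_apply, skew_rmul]

variable [MeasurableSpace Z] [MeasurableSingletonClass Z]

theorem measurable_of_mem {f : (E → Z) → ℝ} (hf : f ∈ finFun E Z) : Measurable f := by
  obtain ⟨W, hW⟩ := hf
  intro s _
  refine FinDep.measurableSet ⟨W, fun ω ω' h => ?_⟩
  simp only [Set.mem_preimage, hW ω ω' h, imp_self]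

theorem integrable_of_mem (ν : Measure (E → Z)) [IsFiniteMeasure ν] {f : (E → Z) → ℝ}
    (hf : f ∈ finFun E Z) : Integrable f ν := by
  classical
  obtain ⟨W, hW⟩ := id hf
  have hfin : (Set.range f).Finite := by
    refine (Set.finite_range fun x : W → Z =>
      f fun e => if h : e ∈ W then x ⟨e, h⟩ else 1).subset ?_
    rintro _ ⟨ω, rfl⟩
    refine ⟨fun w => ω w, hW _ _ fun w hw => ?_⟩
    simp [hw]
  obtain ⟨C, hC⟩ := (hfin.image fun x => ‖x‖).bddAbove
  exact Integrable.of_bound (measurable_of_mem hf).aestronglyMeasurable C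
    (Eventually.of_forall fun ω => hC ⟨_, ⟨ω, rfl⟩, rfl⟩)

variable (ν : Measure (E → Z)) [IsProbabilityMeasure ν]

/-- The inner product of `L²(ν)`. -/
noncomputable def form : finFun E Z →ₗ[ℝ] finFun E Z →ₗ[ℝ] ℝ :=
  LinearMap.mk₂ ℝ (fun f g => ∫ ω, f.1 ω * g.1 ω ∂ν)
    (fun f f' g => by
      simp only [Submodule.coe_add, Pi.add_apply, add_mul]
      exact integral_add (integrable_of_mem ν (mul_mem_finFun f.2 g.2))
        (integrable_of_mem ν (mul_mem_finFun f'.2 g.2)))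
    (fun a f g => by
      simp only [Submodule.coe_smul, Pi.smul_apply, smul_eq_mul, mul_assoc]
      exact integral_const_mul _ _)
    (fun f g g' => by
      simp only [Submodule.coe_add, Pi.add_apply, mul_add]
      exact integral_add (integrable_of_mem ν (mul_mem_finFun f.2 g.2))
        (integrable_of_mem ν (mul_mem_finFun f.2 g'.2)))
    (fun a f g => by
      simp only [Submodule.coe_smul, Pi.smul_apply, smul_eq_mul, mul_left_comm _ a]
      exact integral_const_mul _ _)

theorem form_apply (f g : finFun E Z) : form ν f g = ∫ ω, f.1 ω * g.1 ω ∂ν := rfl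

theorem measurable_rmul (e : E) (z : Z) : Measurable (rmul e z : (E → Z) → E → Z) := by
  classical
  refine measurable_pi_lambda _ fun e' => ?_
  by_cases h : e' = e
  · subst h
    simpa [rmul, Function.comp_def] using
      (measurable_of_countable (· * z)).comp (measurable_pi_apply (X := fun _ : E => Z) e')
  · simpa [rmul, h] using measurable_pi_apply e'

variable {ν}

theorem integral_comp_of_preserving {T : (E → Z) → E → Z} (hT : MeasurePreserving T ν ν)
    {f : (E → Z) → ℝ} (hf : f ∈ finFun E Z) : ∫ ω, f (T ω) ∂ν = ∫ ω, f ω ∂ν := by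
  conv_rhs => rw [← hT.map_eq]
  rw [integral_map hT.aemeasurable (measurable_of_mem hf).aestronglyMeasurable]

theorem form_avg (hR : ∀ e z, MeasurePreserving (rmul e z) ν ν) (e : E) (f g : finFun E Z) :
    form ν (avg e f) g = form ν f (avg e g) := by
  simp only [form_apply, avg_apply, div_mul_eq_mul_div, mul_div_assoc', integral_div,
    Finset.sum_mul, Finset.mul_sum]
  congr 1
  rw [integral_finsetSum _ fun z _ =>
      show Integrable (fun ω => f.1 (rmul e z ω) * g.1 ω) ν from
        integrable_of_mem ν (mul_mem_finFun (comp_rmul_mem f.2 e z) g.2),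
    integral_finsetSum _ fun z _ =>
      show Integrable (fun ω => f.1 ω * g.1 (rmul e z ω)) ν from
        integrable_of_mem ν (mul_mem_finFun f.2 (comp_rmul_mem g.2 e z))]
  refine Fintype.sum_equiv (Equiv.inv Z) _ _ fun z => ?_
  refine Eq.trans ?_
    (integral_comp_of_preserving (hR e z) (mul_mem_finFun f.2 (comp_rmul_mem g.2 e z⁻¹)))
  simp [rmul]

theorem form_avg_le (hR : ∀ e z, MeasurePreserving (rmul e z) ν ν) (e : E) (f : finFun E Z) :
    form ν (avg e f) (avg e f) ≤ form ν f f := by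
  have h0 : 0 ≤ form ν (f - avg e f) (f - avg e f) :=
    integral_nonneg fun ω => mul_self_nonneg _
  have h1 : form ν (avg e f) (avg e f) = form ν f (avg e f) := by
    rw [form_avg hR, avg_avg]
  have h2 : form ν (avg e f) f = form ν f (avg e f) := form_avg hR e f f
  simp only [map_sub, LinearMap.sub_apply] at h0
  linarith

/-- A function unchanged by averaging over all coordinates but `o` is a function of `ω o`. -/
theorem eq_of_forall_avg {o : E} {g : finFun E Z} (hg : ∀ e, e ≠ o → avg e g = g) {ω ω' : E → Z}
    (h : ω o = ω' o) : g.1 ω = g.1 ω' := by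
  classical
  have h1 : ∀ e, e ≠ o → ∀ z ω, g.1 (rmul e z ω) = g.1 ω := by
    intro e he z ω
    rw [← hg e he, avg_apply, avg_apply, sum_rmul_rmul]
  obtain ⟨W, hW⟩ := g.2
  have h2 : ∀ S : Finset E, o ∉ S → g.1 (S.piecewise ω' ω) = g.1 ω := by
    intro S
    induction S using Finset.induction_on with
    | empty => intro; simp
    | insert e S he ih =>
      intro ho
      rw [Finset.mem_insert, not_or] at ho
      rw [← ih ho.2, ← h1 e (Ne.symm ho.1) ((ω e)⁻¹ * ω' e) (S.piecewise ω' ω),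
        Finset.piecewise_insert]
      simp [rmul, he]
  rw [← h2 (W.erase o) (by simp)]
  refine hW _ _ fun w hw => ?_
  by_cases hwo : w = o
  · subst hwo; simpa using h
  · simp [hw, hwo]

theorem integral_eval (hR : ∀ e z, MeasurePreserving (rmul e z) ν ν) (o : E) (k : Z → ℝ) :
    ∫ ω, k (ω o) ∂ν = (∑ z, k z) / Fintype.card Z := by
  have hk : (fun ω : E → Z => k (ω o)) ∈ finFun E Z :=
    ⟨{o}, fun ω ω' h => by simp only [h o (Finset.mem_singleton_self o)]⟩
  have h1 : ∀ z, ∫ ω, k (ω o * z) ∂ν = ∫ ω, k (ω o) ∂ν := by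
    intro z
    rw [← integral_comp_of_preserving (hR o z) hk]
    simp [rmul]
  have h2 : ∑ z : Z, ∫ ω, k (ω o * z) ∂ν = ∑ z, k z := by
    rw [← integral_finsetSum _ fun z _ => by
      simpa [Function.comp_def, rmul] using integrable_of_mem ν (comp_rmul_mem hk o z)]
    have : ∀ ω : E → Z, ∑ z, k (ω o * z) = ∑ z, k z := fun ω =>
      Fintype.sum_equiv (Equiv.mulLeft (ω o)) _ _ fun _ => rfl
    simp [this]
  rw [eq_div_iff (by positivity), ← h2, Finset.sum_congr rfl fun z _ => h1 z]
  simp [mul_comm]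

theorem exists_base_function {ι : Type} [DecidableEq ι] [Fintype ι] (hι : 2 ≤ Fintype.card ι)
    [MulAction (FreeGroup ι) E] (o : E) (ho : ∀ w : FreeGroup ι, w • o = o)
    (hE : ∀ e : E, e ≠ o → ∃ a : ι × Bool,
      {w : FreeGroup ι | w • e = e ∧ hd w = some a}.Finite)
    (c : FreeGroup ι → E → Z) (hR : ∀ e z, MeasurePreserving (rmul e z) ν ν)
    (hc : ∀ w, MeasurePreserving (skew c w) ν ν)
    {f : (E → Z) → ℝ} (hf : f ∈ finFun E Z) (hf1 : ∫ ω, f ω * f ω ∂ν ≤ 1) {ε : ℝ} (hε : 0 ≤ ε)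
    (hfε : ∀ a : ι × Bool, ∫ ω, (f ω - f (skew c (mk [a]) ω)) * (f ω - f (skew c (mk [a]) ω)) ∂ν
      ≤ ε ^ 2) :
    ∃ h : Z → ℝ, (∑ z, h z ^ 2) / Fintype.card Z ≤ 1 ∧
      ∫ ω, (f ω - h (ω o)) ^ 2 ∂ν ≤ (2 * Fintype.card ι + 4) * (2 * ε) := by
  classical
  let Y : SubMulAction (FreeGroup ι) E :=
    { carrier := {e | e ≠ o}
      smul_mem' := fun w e he h => he (by rw [← inv_smul_smul w e, h, ho]) }
  obtain ⟨W, hW⟩ := id hf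
  obtain ⟨l, hl, hlε⟩ := CommProj.gap (Y := Y) hι
    (fun y => by
      obtain ⟨a, ha⟩ := hE y.1 y.2
      refine ⟨a, ha.subset fun w hw => ⟨?_, hw.2⟩⟩
      simpa using congrArg Subtype.val hw.1)
    (form ν) (fun f g => by simp only [form_apply, mul_comm])
    (fun f => integral_nonneg fun ω => mul_self_nonneg _)
    (fun e => avg e.1) (fun e e' f => avg_comm _ _ f) (fun e f => avg_avg _ f)
    (fun e f g => form_avg hR _ f g)
    (fun a => trans c (mk [bar a]))
    (fun a f g => integral_comp_of_preserving (hc _) (mul_mem_finFun f.2 g.2))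
    (fun a e f => by
      have := trans_avg c (mk [bar a]) (mk [a] • e.1) f
      rwa [FreeGroup.mk_bar, inv_smul_smul, ← FreeGroup.mk_bar] at this)
    ⟨f, hf⟩ (W.subtype (· ∈ Y)) (fun e he => by
      ext ω
      rw [avg_apply]
      have : ∀ z, f (rmul e.1 z ω) = f ω := fun z => hW _ _ fun w hw => by
        have : w ≠ e.1 := by
          rintro rfl
          exact he (by simpa using hw)
        simp [rmul, this]
      simp [this])
    ε hε hf1 (fun a => hfε (bar a))
  set g := (l.map fun y => avg (Z := Z) y.1).prod ⟨f, hf⟩ with hg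
  have hgh : ∀ ω, g.1 ω = g.1 fun _ => ω o := fun ω =>
    eq_of_forall_avg (fun e he => hl ⟨e, he⟩) rfl
  refine ⟨fun z => g.1 fun _ => z, ?_, ?_⟩
  · rw [← integral_eval hR o]
    simp only [← hgh]
    refine le_trans ?_ hf1
    have : ∀ l : List Y, form ν ((l.map fun y => avg (Z := Z) y.1).prod ⟨f, hf⟩)
        ((l.map fun y => avg (Z := Z) y.1).prod ⟨f, hf⟩) ≤ form ν ⟨f, hf⟩ ⟨f, hf⟩ := by
      intro l
      induction l with
      | nil => simp
      | cons y l ih =>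
        rw [List.map_cons, List.prod_cons]
        exact (form_avg_le hR _ _).trans ih
    simpa only [form_apply, ← pow_two] using this l
  · simp only [← hgh]
    refine le_trans (le_of_eq ?_) hlε
    rw [form_apply]
    simp only [pow_two]
    rfl

end

open SLThree in
/-- An almost invariant finite-dimensional event has probability near `0` or `1`. -/
theorem measureReal_sub_sq_le {ι J : Type} [DecidableEq ι] [Fintype ι] (hι : 2 ≤ Fintype.card ι)
    [Fintype J] {p : J → ℕ} (hp : ∀ j, (p j).Prime) (hinj : Function.Injective p)
    [Fintype (PG p)] [MeasurableSpace (PG p)] [MeasurableSingletonClass (PG p)]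
    [MulAction (FreeGroup ι) E] (o : E) (ho : ∀ w : FreeGroup ι, w • o = o)
    (hE : ∀ e : E, e ≠ o → ∃ a : ι × Bool,
      {w : FreeGroup ι | w • e = e ∧ hd w = some a}.Finite)
    (c : FreeGroup ι → E → PG p) (u : ι → Ix) (hu : Function.Surjective u)
    (hcu : ∀ i, c (mk [(i, true)]) o = pel p (u i) 1)
    (ν : Measure (E → PG p)) [IsProbabilityMeasure ν]
    (hR : ∀ e z, MeasurePreserving (rmul e z) ν ν) (hc : ∀ w, MeasurePreserving (skew c w) ν ν)
    {D : Set (E → PG p)} (hD : FinDep D) {ε : ℝ} (hε : 0 ≤ ε)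
    (hει : ε * (2 * Fintype.card ι + 5) ≤ 1 / 10 ^ 14)
    (hDε : ∀ a, ν.real {ω | ¬(ω ∈ D ↔ skew c (mk [a]) ω ∈ D)} ≤ ε ^ 2) :
    ν.real D - ν.real D ^ 2 ≤ 1 / 10 := by
  classical
  have hDm : MeasurableSet D := hD.measurableSet
  set f : (E → PG p) → ℝ := D.indicator fun _ => 1 with hf
  have hfmem : f ∈ finFun E (PG p) := indicator_mem_finFun hD
  have hff : ∀ ω, f ω * f ω = f ω := fun ω => by
    by_cases h : ω ∈ D <;> simp [hf, h]
  have hfint : ∫ ω, f ω ∂ν = ν.real D := by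
    rw [hf, integral_indicator_const _ hDm]; simp
  have hmT : ∀ a, Measurable (skew c (mk [a])) := fun a => (hc _).measurable
  have hfε : ∀ a : ι × Bool,
      ∫ ω, (f ω - f (skew c (mk [a]) ω)) * (f ω - f (skew c (mk [a]) ω)) ∂ν ≤ ε ^ 2 := by
    intro a
    refine le_trans (le_of_eq ?_) (hDε a)
    have hm : MeasurableSet {ω | ¬(ω ∈ D ↔ skew c (mk [a]) ω ∈ D)} :=
      (hDm.iff (hDm.preimage (hmT a))).compl
    rw [← mul_one (ν.real _), ← smul_eq_mul, ← integral_indicator_const _ hm]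
    congr 1
    ext ω
    by_cases h : ω ∈ D <;> by_cases h' : skew c (mk [a]) ω ∈ D <;> simp [hf, h, h']
  obtain ⟨h, hh1, hh2⟩ := exists_base_function hι o ho hE c hR hc hfmem
    (by simp only [hff, hfint]; exact measureReal_le_one) hε hfε
  set η : ℝ := (2 * Fintype.card ι + 4) * (2 * ε) with hη
  have hcard : (0 : ℝ) < Fintype.card (PG p) := by exact_mod_cast Fintype.card_pos
  have hk : ∀ k : PG p → ℝ, (fun ω : E → PG p => k (ω o)) ∈ finFun E (PG p) := fun k =>
    ⟨{o}, fun ω ω' h => by simp only [h o (Finset.mem_singleton_self o)]⟩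
  have hη2 : 2 * η + ε ^ 2 ≤ 1 / 10 ^ 13 := by
    have h0 : (0 : ℝ) ≤ Fintype.card ι := by positivity
    have h1 : ε ≤ 1 := by nlinarith
    nlinarith
  have hη0 : 0 ≤ η := by positivity
  have sq_mem : ∀ {g g' : (E → PG p) → ℝ}, g ∈ finFun E (PG p) → g' ∈ finFun E (PG p) →
      (fun ω => (g ω - g' ω) ^ 2) ∈ finFun E (PG p) := by
    intro g g' hg hg'
    simp only [pow_two]
    exact mul_mem_finFun (Submodule.sub_mem _ hg hg') (Submodule.sub_mem _ hg hg')
  have sq_int : ∀ {g g' : (E → PG p) → ℝ}, g ∈ finFun E (PG p) → g' ∈ finFun E (PG p) →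
      Integrable (fun ω => (g ω - g' ω) ^ 2) ν := fun hg hg' => integrable_of_mem ν (sq_mem hg hg')
  have hvar := variance_le p hp hinj h (by rwa [div_le_one hcard] at hh1)
    (ε := 1 / 10 ^ 6) (by norm_num) (by norm_num) (fun q => by
      obtain ⟨i, rfl⟩ := hu q
      have hTo : ∀ ω, skew c (mk [(i, true)]) ω o = pel p (u i) 1 * ω o := by
        intro ω
        have : (mk [(i, true)] : FreeGroup ι)⁻¹ • o = o := ho _
        simp only [skew]
        rw [this, hcu]
      rw [← div_le_iff₀ hcard, ← integral_eval hR o fun z => (h (pel p (u i) 1 * z) - h z) ^ 2]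
      simp only [← hTo]
      set T := skew c (mk [(i, true)]) with hT
      have hTf : (fun ω => f (T ω)) ∈ finFun E (PG p) := comp_skew_mem hfmem c _
      have hTh : (fun ω => h (T ω o)) ∈ finFun E (PG p) := comp_skew_mem (hk h) c _
      have h1 : ∫ ω, (f (T ω) - h (T ω o)) ^ 2 ∂ν ≤ η := by
        refine le_trans (le_of_eq ?_) hh2
        exact integral_comp_of_preserving (hc _) (sq_mem hfmem (hk h))
      have h2 := hfε (i, true)
      simp only [← pow_two] at h2
      calc ∫ ω, (h (T ω o) - h (ω o)) ^ 2 ∂ν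
          ≤ ∫ ω, 3 * ((f (T ω) - h (T ω o)) ^ 2 + (f ω - f (T ω)) ^ 2 +
              (f ω - h (ω o)) ^ 2) ∂ν := by
            refine integral_mono (sq_int hTh (hk h))
              ((((sq_int hTf hTh).add
                (sq_int hfmem hTf)).add
                (sq_int hfmem (hk h))).const_mul 3) fun ω => ?_
            simp only
            nlinarith [sq_nonneg ((f (T ω) - h (T ω o)) - (f ω - f (T ω))),
              sq_nonneg ((f (T ω) - h (T ω o)) + (f ω - h (ω o))),
              sq_nonneg ((f ω - f (T ω)) + (f ω - h (ω o)))]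
        _ = 3 * (∫ ω, (f (T ω) - h (T ω o)) ^ 2 ∂ν + ∫ ω, (f ω - f (T ω)) ^ 2 ∂ν
              + ∫ ω, (f ω - h (ω o)) ^ 2 ∂ν) := by
            rw [integral_const_mul, integral_add
                (show Integrable (fun ω => (f (T ω) - h (T ω o)) ^ 2 + (f ω - f (T ω)) ^ 2) ν from
                  (sq_int hTf hTh).add (sq_int hfmem hTf)) (sq_int hfmem (hk h)),
              integral_add (sq_int hTf hTh)
                (sq_int hfmem hTf)]
        _ ≤ (1 / 10 ^ 6) ^ 2 := by norm_num at hη2 ⊢; linarith)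
  set m : ℝ := (∑ z, h z) / Fintype.card (PG p) with hm
  have hkm : ∫ ω, (h (ω o) - m) ^ 2 ∂ν ≤ 6292 * (1 / 10 ^ 6) := by
    refine le_trans (le_of_eq ?_) hvar
    rw [integral_eval hR o fun z => (h z - m) ^ 2]
    simp only [sub_sq, Finset.sum_add_distrib, Finset.sum_sub_distrib, ← Finset.sum_mul,
      ← Finset.mul_sum, Finset.sum_const, Finset.card_univ, nsmul_eq_mul]
    have : ∑ z, h z = m * Fintype.card (PG p) := by rw [hm]; field_simp
    rw [this]
    field_simp
    ring
  have hfm : ∫ ω, (f ω - m) ^ 2 ∂ν = ν.real D - 2 * m * ν.real D + m ^ 2 := by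
    have : ∀ ω, (f ω - m) ^ 2 = (1 - 2 * m) * f ω + m ^ 2 := fun ω => by
      linear_combination hff ω
    simp only [this]
    rw [integral_add ((integrable_of_mem ν hfmem).const_mul _) (integrable_const _),
      integral_const_mul, hfint]
    simp
    ring
  have hcm : (fun _ => m : (E → PG p) → ℝ) ∈ finFun E (PG p) := ⟨∅, fun _ _ _ => rfl⟩
  have hle : ∫ ω, (f ω - m) ^ 2 ∂ν ≤ 2 * η + 2 * (6292 * (1 / 10 ^ 6)) := by
    calc ∫ ω, (f ω - m) ^ 2 ∂ν
        ≤ ∫ ω, (2 * (f ω - h (ω o)) ^ 2 + 2 * (h (ω o) - m) ^ 2) ∂ν := by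
          refine integral_mono (sq_int hfmem hcm)
            (((sq_int hfmem (hk h)).const_mul 2).add
              ((sq_int (hk h) hcm).const_mul 2)) fun ω => ?_
          simp only
          nlinarith [sq_nonneg ((f ω - h (ω o)) - (h (ω o) - m))]
      _ = 2 * ∫ ω, (f ω - h (ω o)) ^ 2 ∂ν + 2 * ∫ ω, (h (ω o) - m) ^ 2 ∂ν := by
          rw [integral_add ((sq_int hfmem (hk h)).const_mul 2)
              ((sq_int (hk h) hcm).const_mul 2),
            integral_const_mul, integral_const_mul]
      _ ≤ _ := by linarith
  norm_num at hη2 hle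
  nlinarith [sq_nonneg (ν.real D - m), sq_nonneg ε]

end CoordGap

/-- The algebra of finite unions of rectangles. -/
def rectAlg {X Y : Type} (𝒞 : Set (Set X)) (ℬ : Set (Set Y)) : Set (Set (X × Y)) :=
  {D | ∃ (ι : Type) (_ : Finite ι) (v : Y → ι) (U : ι → Set X), (∀ t, v ⁻¹' {t} ∈ ℬ) ∧
    (∀ t, U t ∈ 𝒞) ∧ D = {p | p.1 ∈ U (v p.2)}}

section rectAlg

variable {X Y : Type} {𝒞 : Set (Set X)} {ℬ : Set (Set Y)}

theorem isSetAlgebra_rectAlg (hC : IsSetAlgebra 𝒞) (hB : IsSetAlgebra ℬ) :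
    IsSetAlgebra (rectAlg 𝒞 ℬ) where
  empty_mem := ⟨Unit, inferInstance, fun _ => (), fun _ => ∅,
    fun t => by simpa using hB.univ_mem, fun _ => hC.empty_mem, by simp⟩
  compl_mem := by
    rintro _ ⟨ι, hι, v, U, hv, hU, rfl⟩
    exact ⟨ι, hι, v, fun t => (U t)ᶜ, hv, fun t => hC.compl_mem (hU t), rfl⟩
  union_mem := by
    rintro _ _ ⟨ι, hι, v, U, hv, hU, rfl⟩ ⟨ι', hι', v', U', hv', hU', rfl⟩
    refine ⟨ι × ι', inferInstance, fun y => (v y, v' y), fun t => U t.1 ∪ U' t.2, fun t => ?_,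
      fun t => hC.union_mem (hU _) (hU' _), rfl⟩
    convert hB.inter_mem (hv t.1) (hv' t.2) using 1
    ext y
    simp [Prod.ext_iff]

theorem prod_mem_rectAlg (hC : IsSetAlgebra 𝒞) (hB : IsSetAlgebra ℬ) {C : Set X} {B : Set Y}
    (h : C ∈ 𝒞) (h' : B ∈ ℬ) : C ×ˢ B ∈ rectAlg 𝒞 ℬ := by
  classical
  refine ⟨Prop, inferInstance, fun y => y ∈ B, fun t => if t then C else ∅, fun t => ?_,
    fun t => ?_, ?_⟩
  · by_cases ht : t
    · convert h' using 1
      ext y; simp [ht]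
    · convert hB.compl_mem h' using 1
      ext y; simp [ht]
  · dsimp only; split_ifs
    exacts [h, hC.empty_mem]
  · ext ⟨x, y⟩
    by_cases hy : y ∈ B <;> simp [hy]

variable [mX : MeasurableSpace X] [mY : MeasurableSpace Y]

theorem measurableSet_of_mem_rectAlg (hC : ∀ C ∈ 𝒞, MeasurableSet C)
    (hB : ∀ B ∈ ℬ, MeasurableSet B) {D : Set (X × Y)} (hD : D ∈ rectAlg 𝒞 ℬ) :
    MeasurableSet D := by
  obtain ⟨ι, hι, v, U, hv, hU, rfl⟩ := hD
  have : {p : X × Y | p.1 ∈ U (v p.2)} = ⋃ t, U t ×ˢ (v ⁻¹' {t}) := by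
    ext ⟨x, y⟩; simp
  rw [this]
  exact MeasurableSet.iUnion fun t => (hC _ (hU t)).prod (hB _ (hv t))

theorem measureDense_rectAlg (μ : Measure X) (ν : Measure Y) [IsProbabilityMeasure μ]
    [IsProbabilityMeasure ν] (hC : IsSetAlgebra 𝒞) (hB : IsSetAlgebra ℬ)
    (hC' : mX = MeasurableSpace.generateFrom 𝒞) (hB' : mY = MeasurableSpace.generateFrom ℬ) :
    (μ.prod ν).MeasureDense (rectAlg 𝒞 ℬ) := by
  refine Measure.MeasureDense.of_generateFrom_isSetAlgebra_finite _ (isSetAlgebra_rectAlg hC hB)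
    (le_antisymm ?_ (MeasurableSpace.generateFrom_le fun D hD => measurableSet_of_mem_rectAlg
      (fun C h => ?_) (fun B h => ?_) hD))
  · have := generateFrom_prod_eq (C := 𝒞) (D := ℬ)
      ⟨fun _ => Set.univ, fun _ => hC.univ_mem, Set.iUnion_const _⟩
      ⟨fun _ => Set.univ, fun _ => hB.univ_mem, Set.iUnion_const _⟩
    rw [← hC', ← hB'] at this
    rw [this]
    refine MeasurableSpace.generateFrom_mono ?_
    rintro _ ⟨C, h, B, h', rfl⟩
    exact prod_mem_rectAlg hC hB h h'
  · rw [hC']; exact MeasurableSpace.measurableSet_generateFrom h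
  · rw [hB']; exact MeasurableSpace.measurableSet_generateFrom h

theorem prod_real_rect (μ : Measure X) (ν : Measure Y) [IsProbabilityMeasure μ]
    [IsProbabilityMeasure ν] {ι : Type} [Fintype ι] {v : Y → ι} {U : ι → Set X}
    (hv : ∀ t, MeasurableSet (v ⁻¹' {t})) (hU : ∀ t, MeasurableSet (U t)) :
    (μ.prod ν).real {p | p.1 ∈ U (v p.2)} = ∑ t, μ.real (U t) * ν.real (v ⁻¹' {t}) := by
  have : {p : X × Y | p.1 ∈ U (v p.2)} = ⋃ t, U t ×ˢ (v ⁻¹' {t}) := by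
    ext ⟨x, y⟩; simp
  rw [this, measureReal_iUnion_fintype (fun t t' htt' => ?_) fun t => (hU t).prod (hv t)]
  · simp [measureReal_prod_prod]
  · refine Set.disjoint_left.2 ?_
    rintro ⟨x, y⟩ h h'
    exact htt' (h.2.symm.trans h'.2)

end rectAlg

namespace PMP

variable {A : ℕ → PMP Γ} {𝒟 : ∀ i, Set (Set (A i).X)} (l : Limit A 𝒟)

theorem Limit.measurableSet {C : Set l.α.X} (hC : C ∈ l.𝒞) : MeasurableSet C := by
  have := MeasurableSpace.measurableSet_generateFrom hC
  rwa [← l.gen] at this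

theorem Limit.tendsto_rect (b : PMP Γ) {ℬ : Set (Set b.X)} (hB : ∀ B ∈ ℬ, MeasurableSet B)
    (h𝒟 : ∀ i, ∀ D ∈ 𝒟 i, MeasurableSet D)
    {D : Set (l.α.X × b.X)} (hD : D ∈ rectAlg l.𝒞 ℬ) :
    Tendsto (fun i => ((A i).μ.prod b.μ).real (Prod.map (l.θ i) id ⁻¹' D)) (hyperfilter ℕ)
      (𝓝 ((l.α.μ.prod b.μ).real D)) := by
  obtain ⟨ι, hι, v, U, hv, hU, rfl⟩ := hD
  cases nonempty_fintype ι
  rw [prod_real_rect _ _ (fun t => hB _ (hv t)) fun t => l.measurableSet (hU t)]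
  have : ∀ i, ((A i).μ.prod b.μ).real (Prod.map (l.θ i) id ⁻¹' {p | p.1 ∈ U (v p.2)}) =
      ∑ t, (A i).μ.real (l.θ i ⁻¹' U t) * b.μ.real (v ⁻¹' {t}) := fun i =>
    prod_real_rect (U := fun t => l.θ i ⁻¹' U t) _ _ (fun t => hB _ (hv t))
      fun t => h𝒟 i _ (l.preimage_mem i _ (hU t))
  simp only [this]
  exact tendsto_finsetSum _ fun t _ => (l.tendsto _ (hU t)).mul_const _

theorem Limit.preimage_act_mem_rectAlg (b : PMP Γ) {ℬ : Set (Set b.X)}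
    (hact : ∀ γ, ∀ B ∈ ℬ, b.act γ ⁻¹' B ∈ ℬ) (γ : Γ) {D : Set (l.α.X × b.X)}
    (hD : D ∈ rectAlg l.𝒞 ℬ) : (l.α.prod b).act γ ⁻¹' D ∈ rectAlg l.𝒞 ℬ := by
  obtain ⟨ι, hι, v, U, hv, hU, rfl⟩ := hD
  exact ⟨ι, hι, fun y => v (b.act γ y), fun t => l.α.act γ ⁻¹' U t, fun t => hact γ _ (hv t),
    fun t => l.act_mem γ _ (hU t), rfl⟩

theorem Limit.tendsto_prod_M (b : PMP Γ) {ℬ : Set (Set b.X)} (hBalg : IsSetAlgebra ℬ)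
    (hB : ∀ B ∈ ℬ, MeasurableSet B) (hact : ∀ γ, ∀ B ∈ ℬ, b.act γ ⁻¹' B ∈ ℬ)
    (h𝒟 : ∀ i, ∀ D ∈ 𝒟 i, MeasurableSet D)
    (S : Finset Γ) (k : ℕ) {f : l.α.X × b.X → Fin k} (hf : ∀ s, f ⁻¹' s ∈ rectAlg l.𝒞 ℬ) :
    Tendsto (fun i => ((A i).prod b).M S k (f ∘ Prod.map (l.θ i) id)) (hyperfilter ℕ)
      (𝓝 ((l.α.prod b).M S k f)) := by
  refine tendsto_pi_nhds.2 fun q => ?_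
  have := l.tendsto_rect b hB h𝒟 ((isSetAlgebra_rectAlg l.alg hBalg).inter_mem (hf {q.2.1})
    (l.preimage_act_mem_rectAlg b hact q.1 (hf {q.2.2})))
  refine this.congr fun i => ?_
  simp only [M, Measure.real]
  congr 2
  ext x
  simp [l.equivariant, PMP.prod]

/-- If the products with `b` are close to the product with the limit, then the values of a
coloring of one of them are almost attained by finite-dimensional colorings of others. -/
theorem Limit.exists_coloring (b : PMP Γ) {ℬ : Set (Set b.X)} (hBalg : IsSetAlgebra ℬ)
    (hB : b.mX = MeasurableSpace.generateFrom ℬ) (hact : ∀ γ, ∀ B ∈ ℬ, b.act γ ⁻¹' B ∈ ℬ)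
    (h𝒟 : ∀ i, ∀ D ∈ 𝒟 i, MeasurableSet D)
    (S : Finset Γ) (k : ℕ) (i : ℕ) {f : (A i).X × b.X → Fin k} (hf : Measurable f) {η : ℝ}
    (h : Metric.hausdorffDist (((A i).prod b).C S k) ((l.α.prod b).C S k) < η) :
    ∃ f' : l.α.X × b.X → Fin k, (∀ s, f' ⁻¹' s ∈ rectAlg l.𝒞 ℬ) ∧
      ∀ᶠ i' in hyperfilter ℕ, dist (((A i').prod b).M S k (f' ∘ Prod.map (l.θ i') id))
        (((A i).prod b).M S k f) < 2 * η := by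
  have hη : 0 < η := Metric.hausdorffDist_nonneg.trans_lt h
  have hk : k ≠ 0 := by
    rintro rfl
    obtain ⟨x⟩ : Nonempty ((A i).X × b.X) := nonempty_of_isProbabilityMeasure ((A i).μ.prod b.μ)
    exact (f x).elim0
  obtain ⟨k, rfl⟩ := Nat.exists_eq_succ_of_ne_zero hk
  have hmeas : ∀ B ∈ ℬ, MeasurableSet B := fun B h => by
    rw [hB]; exact MeasurableSpace.measurableSet_generateFrom h
  have hfin : Metric.hausdorffEDist (((A i).prod b).C S (k + 1)) ((l.α.prod b).C S (k + 1)) ≠ ⊤ :=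
    Metric.hausdorffEDist_ne_top_of_nonempty_of_bounded (C_nonempty _ _ _) (C_nonempty _ _ _)
      ((Metric.isBounded_Icc _ _).subset (C_subset_Icc _ _ _))
      ((Metric.isBounded_Icc _ _).subset (C_subset_Icc _ _ _))
  obtain ⟨y, hy, hy'⟩ := Metric.exists_dist_lt_of_hausdorffDist_lt
    (M_mem_C ((A i).prod b) S (k + 1) hf) h hfin
  set x := ((A i).prod b).M S (k + 1) f with hx
  obtain ⟨_, ⟨g, hg, rfl⟩, hyg⟩ := Metric.mem_closure_iff.1 hy (η - dist x y) (by linarith)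
  obtain ⟨f', hf', hf'g⟩ := (measureDense_rectAlg l.α.μ b.μ l.alg hBalg l.gen hB).exists_fin_approx
    (isSetAlgebra_rectAlg l.alg hBalg) hg (ε := η / 4) (by linarith)
  refine ⟨f', hf', ?_⟩
  have hf'm : Measurable f' := fun s _ =>
    measurableSet_of_mem_rectAlg (fun C h => l.measurableSet h) hmeas (hf' s)
  have h1 := dist_M_le (l.α.prod b) S (k + 1) hg hf'm
  have h2 : dist ((l.α.prod b).M S (k + 1) f') x < 2 * η := by
    have : (l.α.prod b).μ.real {x | g x ≠ f' x} ≤ η / 4 := hf'g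
    calc _ ≤ dist ((l.α.prod b).M S (k + 1) f') ((l.α.prod b).M S (k + 1) g)
          + dist ((l.α.prod b).M S (k + 1) g) y + dist y x := dist_triangle4 _ _ _ _
      _ < 2 * η := by
        rw [dist_comm _ y, dist_comm y x, dist_comm _ ((l.α.prod b).M S (k + 1) g)]
        linarith
  have h3 := l.tendsto_prod_M b hBalg hmeas hact h𝒟 S (k + 1) hf'
  exact (h3.dist tendsto_const_nhds).eventually_lt_const h2

end PMP

namespace CosetAction

open SLThree

section cocycle

variable (Λ : Subgroup Γ)

/-- The cosets of a subgroup together with a free orbit. -/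
abbrev Pt := (Γ ⧸ Λ) ⊕ Γ

/-- The base point. -/
abbrev base : Pt Λ := Sum.inl ((1 : Γ) : Γ ⧸ Λ)

/-- Coset representatives. -/
noncomputable def rep (q : Γ ⧸ Λ) : Γ :=
  open Classical in if q = ((1 : Γ) : Γ ⧸ Λ) then 1 else q.out

theorem mk_rep (q : Γ ⧸ Λ) : ((rep Λ q : Γ) : Γ ⧸ Λ) = q := by
  unfold rep
  split_ifs with h
  · exact h.symm
  · exact q.out_eq'

theorem rep_mem (γ : Γ) (q : Γ ⧸ Λ) : (rep Λ (γ • q))⁻¹ * γ * rep Λ q ∈ Λ := by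
  rw [mul_assoc, ← QuotientGroup.eq, mk_rep]
  conv_lhs => rw [← mk_rep Λ q]
  rfl

variable {Λ} {K : Type} [Group K] (φ : Λ →* K)

/-- The cocycle inducing `φ`. -/
noncomputable def coc (γ : Γ) : Pt Λ → K
  | Sum.inl q => φ ⟨_, rep_mem Λ γ q⟩
  | Sum.inr _ => 1

theorem coc_mul (γ δ : Γ) (e : Pt Λ) : coc φ (γ * δ) e = coc φ γ (δ • e) * coc φ δ e := by
  rcases e with q | x
  · simp only [coc, Sum.smul_inl]
    rw [← map_mul]
    congr 1
    ext
    simp only [Subgroup.coe_mul, mul_smul]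
    group
  · simp [coc]

theorem smul_base (γ : Λ) : (γ : Γ) • base Λ = base Λ := by
  simp only [base, Sum.smul_inl]
  congr 1
  rw [← QuotientGroup.mk_mul_of_mem (1 : Γ) γ.2]
  simp [MulAction.Quotient.smul_mk]

theorem coc_base (γ : Λ) : coc φ (γ : Γ) (base Λ) = φ γ := by
  have h1 : (γ : Γ) • ((1 : Γ) : Γ ⧸ Λ) = ((1 : Γ) : Γ ⧸ Λ) := Sum.inl_injective (smul_base γ)
  simp only [coc]
  congr 1
  ext
  simp [h1, rep]

end cocycle

instance (n : ℕ) : MeasurableSpace (G3 (ZMod n)) := ⊤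

instance (n : ℕ) : MeasurableSingletonClass (G3 (ZMod n)) := ⟨fun _ => trivial⟩

instance (n : ℕ) [NeZero n] : Finite (G3 (ZMod n)) :=
  inferInstanceAs (Finite {A : Matrix (Fin 3) (Fin 3) (ZMod n) // A.det = 1})

variable {m : ℕ} {Λ : Subgroup Γ} (ψ : Λ →* FreeGroup (Fin m)) (u : Fin m → Ix)

/-- The homomorphism to `SL₃(ℤ/n)` sending free generators to elementary matrices. -/
noncomputable def red (n : ℕ) : Λ →* G3 (ZMod n) :=
  (FreeGroup.lift fun i => elem (u i) 1).comp ψ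

/-- The cocycle of the action `act`. -/
noncomputable def cocz {J : Type} (p : J → ℕ) (γ : Γ) (e : Pt Λ) : PG p :=
  fun j => coc (red ψ u (p j)) γ e

theorem cocz_mul {J : Type} (p : J → ℕ) (γ δ : Γ) (e : Pt Λ) :
    cocz ψ u p (γ * δ) e = cocz ψ u p γ (δ • e) * cocz ψ u p δ e :=
  funext fun _ => coc_mul _ _ _ _

/-- The action coinduced from the translation action of `Λ` on a product of groups `SL₃(ℤ/p)`,
times a Bernoulli shift. -/
noncomputable def act {J : Type} (p : J → ℕ) [∀ j, NeZero (p j)] : PMP Γ :=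
  Skew.pmp (K := fun j => G3 (ZMod (p j))) (cocz ψ u p) (cocz_mul ψ u p)

theorem exists_bit {n : ℕ} (hn : n.Prime) [NeZero n] : ∃ H : Set (G3 (ZMod n)),
    1 / 3 ≤ (unif (G3 (ZMod n))).real H ∧ (unif (G3 (ZMod n))).real H ≤ 1 / 2 := by
  have : Fact n.Prime := ⟨hn⟩
  set N := Nat.card (G3 (ZMod n)) with hN
  have hN2 : 2 ≤ N := by
    have : Nontrivial (G3 (ZMod n)) :=
      ⟨elem q01 1, 1, fun h => by
        have := congrArg (fun g : G3 (ZMod n) => g 0 1) h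
        simp [elem, q01, Matrix.SpecialLinearGroup.transvection_coe] at this⟩
    exact Finite.one_lt_card
  obtain ⟨H, -, hH⟩ := Set.exists_subset_card_eq (s := (Set.univ : Set (G3 (ZMod n)))) (n := N / 2)
    (by rw [Set.ncard_univ]; omega)
  have h1 : (N : ℝ) / 3 ≤ (N / 2 : ℕ) := by
    rw [div_le_iff₀ (by norm_num)]
    exact_mod_cast (by omega : N ≤ N / 2 * 3)
  have h2 : ((N / 2 : ℕ) : ℝ) ≤ N / 2 := Nat.cast_div_le
  have h0 : (0 : ℝ) < N := by exact_mod_cast (by omega : 0 < N)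
  refine ⟨H, ?_, ?_⟩
  · rw [unif_real, hH, ← hN, le_div_iff₀ h0]; linarith
  · rw [unif_real, hH, ← hN, div_le_iff₀ h0]; linarith

section finite

variable {J : Type} (p : J → ℕ) [∀ j, NeZero (p j)]

theorem act_standardBorel [Countable Γ] [Countable J] : StandardBorelSpace (act ψ u p).X :=
  have : Countable (Γ ⧸ Λ) := Quotient.countable
  Skew.standardBorelSpace _ (cocz_mul ψ u p)

theorem act_spread (j : J) (H : Set (G3 (ZMod (p j))))
    (h1 : 1 / 3 ≤ (unif (G3 (ZMod (p j)))).real H) (h2 : (unif (G3 (ZMod (p j)))).real H ≤ 1 / 2) :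
    (act ψ u p).Spread {ω : ∀ q : Pt Λ × J, G3 (ZMod (p q.2)) | ω (Sum.inr 1, j) ∈ H} :=
  Skew.spread _ (cocz_mul ψ u p) (Sum.inr 1)
    (fun γ δ h => by simpa using h) (fun γ δ => rfl) j H h1 h2

end finite

variable (p : ℕ → ℕ)

/-- The primes involved in finitely many coordinates of the product of two of our actions. -/
abbrev fp (i q : ℕ) : Option (Fin q) → ℕ := fun o => o.elim (p i) fun j => p j

variable (Λ) in
/-- Restriction to finitely many primes. -/
def pr (i q : ℕ) (x : (∀ _ : Pt Λ × Unit, G3 (ZMod (p i))) × (∀ y : Pt Λ × ℕ, G3 (ZMod (p y.2))))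
    (e : Pt Λ) : PG (fp p i q)
  | none => x.1 (e, ())
  | some j => x.2 (e, j)

theorem measurable_pr (i q : ℕ) : Measurable (pr Λ p i q) := by
  refine measurable_pi_lambda _ fun e => measurable_pi_lambda _ fun o => ?_
  rcases o with _ | j
  · exact (measurable_pi_apply (X := fun _ : Pt Λ × Unit => G3 (ZMod (p i)))
      (e, ())).comp measurable_fst
  · exact (measurable_pi_apply (X := fun y : Pt Λ × ℕ => G3 (ZMod (p y.2))) (e, (j : ℕ))).comp
      measurable_snd

theorem _root_.MeasureTheory.MeasurePreserving.map_of_semiconj {X Y : Type*} [MeasurableSpace X]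
    [MeasurableSpace Y] {μ : Measure X} {T : X → X} {T' : Y → Y} {π : X → Y} (hπ : Measurable π)
    (hT : MeasurePreserving T μ μ) (hT' : Measurable T') (h : ∀ x, π (T x) = T' (π x)) :
    MeasurePreserving T' (μ.map π) (μ.map π) := by
  refine ⟨hT', ?_⟩
  rw [Measure.map_map hT' hπ, show T' ∘ π = π ∘ T from funext fun x => (h x).symm,
    ← Measure.map_map hπ hT.measurable, hT.map_eq]

theorem injective_fp {p : ℕ → ℕ} (hinj : Function.Injective p) {i q : ℕ} (h : q ≤ i) :
    Function.Injective (fp p i q) := by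
  rintro (_ | j) (_ | j') hjj'
  · rfl
  · have := hinj (show p i = p j' from hjj'); omega
  · have := hinj (show p j = p i from hjj'); omega
  · exact congrArg some (Fin.ext (hinj (show p j = p j' from hjj')))

variable [∀ j, NeZero (p j)]

instance (i q : ℕ) (o : Option (Fin q)) : NeZero (fp p i q o) := by
  cases o <;> simp only [fp, Option.elim] <;> infer_instance

variable (Λ) in
/-- The product of the Haar measures of the two factors. -/
noncomputable def haar₂ (i : ℕ) :
    Measure ((∀ _ : Pt Λ × Unit, G3 (ZMod (p i))) × (∀ y : Pt Λ × ℕ, G3 (ZMod (p y.2)))) :=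
  (Skew.haar (Pt Λ) fun _ : Unit => G3 (ZMod (p i))).prod
    (Skew.haar (Pt Λ) fun j : ℕ => G3 (ZMod (p j)))

instance (i : ℕ) : IsProbabilityMeasure (haar₂ Λ p i) := by unfold haar₂; infer_instance

theorem measurePreserving_rmul_pr (i q : ℕ) (e : Pt Λ) (z : PG (fp p i q)) :
    MeasurePreserving (CoordGap.rmul e z) ((haar₂ Λ p i).map (pr Λ p i q))
      ((haar₂ Λ p i).map (pr Λ p i q)) := by
  classical
  cases nonempty_fintype (PG (fp p i q))
  have h := (Skew.measurePreserving_perm (K := fun _ : Unit => G3 (ZMod (p i))) (Equiv.refl (Pt Λ))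
      fun y => if y.1 = e then Equiv.mulRight (z none) else Equiv.refl _).prod
    (Skew.measurePreserving_perm (K := fun j : ℕ => G3 (ZMod (p j))) (Equiv.refl (Pt Λ))
      fun y => if h : y.1 = e ∧ y.2 < q then Equiv.mulRight (z (some ⟨y.2, h.2⟩)) else Equiv.refl _)
  refine h.map_of_semiconj (measurable_pr p i q) (CoordGap.measurable_rmul e z) fun x => ?_
  funext e' o
  by_cases he : e' = e
  · subst he
    rcases o with _ | j
    · simp [pr, CoordGap.rmul]
      rfl
    · simp [pr, CoordGap.rmul]
      rfl
  · rcases o with _ | j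
    · simp [pr, CoordGap.rmul, he]
      rfl
    · simp [pr, CoordGap.rmul, he]
      rfl

variable (θ : FreeGroup (Fin m) →* Γ)

/-- The product of two of our actions. -/
noncomputable def act₂ (i : ℕ) (γ : Γ)
    (x : (∀ _ : Pt Λ × Unit, G3 (ZMod (p i))) × (∀ y : Pt Λ × ℕ, G3 (ZMod (p y.2)))) :
    (∀ _ : Pt Λ × Unit, G3 (ZMod (p i))) × (∀ y : Pt Λ × ℕ, G3 (ZMod (p y.2))) :=
  ((act ψ u fun _ : Unit => p i).act γ x.1, (act ψ u p).act γ x.2)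

theorem measurePreserving_act₂ (i : ℕ) (γ : Γ) :
    MeasurePreserving (act₂ ψ u p i γ) (haar₂ Λ p i) (haar₂ Λ p i) :=
  ((act ψ u fun _ : Unit => p i).prod (act ψ u p)).preserves γ

open FreeGroup (mk hd) in
/-- Almost invariant finite-dimensional events of the product of two of our actions, where the
first one uses a prime not involved in the event for the second one, are almost trivial. -/
theorem real_sub_sq_le (hm : 2 ≤ m) (hu : Function.Surjective u) (hp : ∀ j, (p j).Prime)
    (hinj : Function.Injective p) (hθ : ∀ w, ∃ h : θ w ∈ Λ, ψ ⟨θ w, h⟩ = w)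
    (hfin : ∀ g ∉ Λ, ∃ a, {w | hd w = some a ∧ g⁻¹ * θ w * g ∈ Λ}.Finite) {i q : ℕ} (hqi : q ≤ i)
    {D : Set ((∀ _ : Pt Λ × Unit, G3 (ZMod (p i))) × (∀ y : Pt Λ × ℕ, G3 (ZMod (p y.2))))}
    {W : Finset (Pt Λ × Unit)} {W' : Finset (Pt Λ × ℕ)} (hW' : ∀ y ∈ W', y.2 < q)
    (hD : ∀ x x', (∀ y ∈ W, x.1 y = x'.1 y) → (∀ y ∈ W', x.2 y = x'.2 y) → x ∈ D → x' ∈ D)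
    {ε : ℝ} (hε : 0 ≤ ε) (hεm : ε * (2 * m + 5) ≤ 1 / 10 ^ 14)
    (hDε : ∀ a, (haar₂ Λ p i).real {x | ¬(x ∈ D ↔ act₂ ψ u p i (θ (mk [a])) x ∈ D)} ≤ ε ^ 2) :
    (haar₂ Λ p i).real D - (haar₂ Λ p i).real D ^ 2 ≤ 1 / 10 := by
  classical
  cases nonempty_fintype (PG (fp p i q))
  let inst : MulAction (FreeGroup (Fin m)) (Pt Λ) := MulAction.compHom _ θ
  have hsmul : ∀ (w : FreeGroup (Fin m)) (e : Pt Λ), w • e = θ w • e := fun _ _ => rfl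
  have hinjθ : ∀ w, θ w = 1 → w = 1 := by
    intro w h
    obtain ⟨h1, h2⟩ := hθ w
    rw [← h2, ← map_one ψ]
    exact congrArg ψ (Subtype.ext h)
  let s : (Pt Λ → PG (fp p i q)) →
      (∀ _ : Pt Λ × Unit, G3 (ZMod (p i))) × (∀ y : Pt Λ × ℕ, G3 (ZMod (p y.2))) := fun ω =>
    (fun y => ω y.1 none, fun y => if h : y.2 < q then ω y.1 (some ⟨y.2, h⟩) else 1)
  have hs : pr Λ p i q ⁻¹' (s ⁻¹' D) = D := by
    ext x
    have h1 : ∀ y ∈ W, (s (pr Λ p i q x)).1 y = x.1 y := fun y _ => rfl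
    have h2 : ∀ y ∈ W', (s (pr Λ p i q x)).2 y = x.2 y := fun y hy => by
      simp [s, hW' y hy, pr]
    exact ⟨hD _ _ h1 h2, hD _ _ (fun y hy => (h1 y hy).symm) fun y hy => (h2 y hy).symm⟩
  have hfd : FinDep (s ⁻¹' D) := by
    refine ⟨W.image Prod.fst ∪ W'.image Prod.fst,
      fun ω ω' h => hD _ _ (fun y hy => ?_) fun y hy => ?_⟩
    · have := h y.1 (Finset.mem_union_left _ (Finset.mem_image_of_mem _ hy))
      simp [s, this]
      rfl
    · have := h y.1 (Finset.mem_union_right _ (Finset.mem_image_of_mem _ hy))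
      simp [s, this]
  let c : FreeGroup (Fin m) → Pt Λ → PG (fp p i q) := fun w e => cocz ψ u (fp p i q) (θ w) e
  have hsemi : ∀ w x, pr Λ p i q (act₂ ψ u p i (θ w) x) =
      CoordGap.skew c w (pr Λ p i q x) := by
    intro w x
    funext e o
    have : w⁻¹ • e = (θ w)⁻¹ • e := by rw [hsmul, map_inv]
    simp only [CoordGap.skew, this]
    rcases o with _ | j <;> rfl
  have hskew : ∀ w, Measurable (CoordGap.skew c w) := fun w =>
    measurable_pi_lambda _ fun e => (measurable_of_countable (c w (w⁻¹ • e) * ·)).comp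
      (measurable_pi_apply (X := fun _ : Pt Λ => PG (fp p i q)) (w⁻¹ • e))
  have hmap : ∀ {B : Set (Pt Λ → PG (fp p i q))}, MeasurableSet B →
      ((haar₂ Λ p i).map (pr Λ p i q)).real B = (haar₂ Λ p i).real (pr Λ p i q ⁻¹' B) := fun hB =>
    map_measureReal_apply (measurable_pr p i q) hB
  have : IsProbabilityMeasure ((haar₂ Λ p i).map (pr Λ p i q)) :=
    Measure.isProbabilityMeasure_map (measurable_pr p i q).aemeasurable
  have key := CoordGap.measureReal_sub_sq_le (ι := Fin m) (p := fp p i q) (by simpa using hm)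
    (fun o => by cases o <;> exact hp _) (injective_fp hinj hqi) (base Λ)
    (fun w => smul_base ⟨θ w, (hθ w).1⟩) (fun e he => ?_) c u hu (fun k => ?_)
    ((haar₂ Λ p i).map (pr Λ p i q)) (measurePreserving_rmul_pr p i q)
    (fun w => (measurePreserving_act₂ ψ u p i (θ w)).map_of_semiconj (measurable_pr p i q)
      (hskew w) (hsemi w)) hfd hε (by simpa using hεm) (fun a => ?_)
  · rwa [hmap hfd.measurableSet, hs] at key
  · rcases e with e | δ
    · obtain ⟨g, rfl⟩ := QuotientGroup.mk_surjective e
      obtain ⟨a, ha⟩ := hfin g fun hg => he (by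
        simp only [base]
        congr 1
        exact (QuotientGroup.eq.2 (by simpa using hg)).symm)
      refine ⟨a, ha.subset fun w hw => ⟨hw.2, ?_⟩⟩
      have h1 : ((θ w * g : Γ) : Γ ⧸ Λ) = g := Sum.inl_injective hw.1
      have h2 := QuotientGroup.eq.1 h1.symm
      rwa [← mul_assoc] at h2
    · refine ⟨(⟨0, by omega⟩, true), Set.Finite.subset Set.finite_empty fun w hw => ?_⟩
      have h1 : θ w * δ = δ := Sum.inr_injective hw.1
      have h2 : w = 1 := hinjθ w (by simpa using h1)
      have h3 := hw.2
      rw [h2, FreeGroup.hd_one] at h3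
      cases h3
  · funext o
    obtain ⟨h1, h2⟩ := hθ (mk [(k, true)])
    have := coc_base (red ψ u (fp p i q o)) ⟨θ (mk [(k, true)]), h1⟩
    simp only [c, cocz]
    refine this.trans ?_
    simp only [red, MonoidHom.comp_apply, h2, pel, map_one]
    exact FreeGroup.lift_apply_of
  · have hm' : MeasurableSet {ω | ¬(ω ∈ s ⁻¹' D ↔ CoordGap.skew c (mk [a]) ω ∈ s ⁻¹' D)} :=
      (hfd.measurableSet.iff (hfd.measurableSet.preimage (hskew _))).compl
    rw [hmap hm']
    refine le_trans (le_of_eq ?_) (hDε a)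
    congr 1
    ext x
    have e1 : x ∈ D ↔ pr Λ p i q x ∈ s ⁻¹' D := by
      conv_lhs => rw [← hs]
      rfl
    have e2 : act₂ ψ u p i (θ (mk [a])) x ∈ D ↔
        CoordGap.skew c (mk [a]) (pr Λ p i q x) ∈ s ⁻¹' D := by
      conv_lhs => rw [← hs]
      rw [Set.mem_preimage, hsemi]
    simp only [Set.mem_preimage, Set.mem_ofPred_eq] at e1 e2 ⊢
    rw [e1, e2]

end CosetAction

namespace PMP

theorem near_invariant {a b : PMP Γ} {S : Finset Γ} {γ : Γ} (hγ : γ ∈ S) {f : a.X → Fin 2}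
    {f₀ : b.X → Fin 2} (hf₀ : ∀ x, f₀ (b.act γ x) = f₀ x) {δ : ℝ}
    (h : dist (a.M S 2 f) (b.M S 2 f₀) < δ) :
    a.μ.real {x | ¬(f x = 1 ↔ f (a.act γ x) = 1)} ≤ 2 * δ ∧
      |a.μ.real {x | f x = 1} - b.μ.real {x | f₀ x = 1}| ≤ 2 * δ := by
  have hd : ∀ i j : Fin 2, |a.μ.real {x | f x = i ∧ f (a.act γ x) = j} -
      b.μ.real {x | f₀ x = i ∧ f₀ (b.act γ x) = j}| ≤ δ := fun i j =>
    (dist_le_pi_dist (a.M S 2 f) (b.M S 2 f₀) (⟨γ, hγ⟩, i, j)).trans h.le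
  have h01 := hd 0 1
  have h10 := hd 1 0
  have h11 := hd 1 1
  have e01 : {x | f₀ x = 0 ∧ f₀ (b.act γ x) = 1} = ∅ := by
    ext x; simp only [hf₀, Set.mem_ofPred_eq, Set.mem_empty_iff_false, iff_false]; omega
  have e10 : {x | f₀ x = 1 ∧ f₀ (b.act γ x) = 0} = ∅ := by
    ext x; simp only [hf₀, Set.mem_ofPred_eq, Set.mem_empty_iff_false, iff_false]; omega
  have e11 : {x | f₀ x = 1 ∧ f₀ (b.act γ x) = 1} = {x | f₀ x = 1} := by
    ext x; simp only [hf₀, Set.mem_ofPred_eq, and_self]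
  rw [e01, measureReal_empty, sub_zero, abs_of_nonneg measureReal_nonneg] at h01
  rw [e10, measureReal_empty, sub_zero, abs_of_nonneg measureReal_nonneg] at h10
  rw [e11, abs_le] at h11
  have k1 : a.μ.real {x | ¬(f x = 1 ↔ f (a.act γ x) = 1)} ≤
      a.μ.real {x | f x = 0 ∧ f (a.act γ x) = 1} + a.μ.real {x | f x = 1 ∧ f (a.act γ x) = 0} := by
    refine (measureReal_mono fun x hx => ?_).trans (measureReal_union_le _ _)
    simp only [Set.mem_ofPred_eq, Set.mem_union] at hx ⊢
    omega
  have k2 : a.μ.real {x | f x = 1} ≤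
      a.μ.real {x | f x = 1 ∧ f (a.act γ x) = 1} + a.μ.real {x | f x = 1 ∧ f (a.act γ x) = 0} := by
    refine (measureReal_mono fun x hx => ?_).trans (measureReal_union_le _ _)
    simp only [Set.mem_ofPred_eq, Set.mem_union] at hx ⊢
    omega
  have k3 : a.μ.real {x | f x = 1 ∧ f (a.act γ x) = 1} ≤ a.μ.real {x | f x = 1} :=
    measureReal_mono fun x hx => hx.1
  refine ⟨by linarith, abs_le.2 ⟨by linarith, by linarith⟩⟩

end PMP

theorem exists_seq_of_tendsto_hyperfilter {J : Type*} [Countable J] (d : J → ℕ → ℝ)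
    (hd : ∀ j, Tendsto (d j) (hyperfilter ℕ) (𝓝 0)) :
    ∃ s : ℕ → ℕ, ∀ j, Tendsto (d j ∘ s) atTop (𝓝 0) := by
  obtain ⟨e, he⟩ := exists_injective_nat J
  have : ∀ n : ℕ, ∃ i, ∀ j ∈ {j | e j ≤ n}, |d j i| < 1 / ((n : ℝ) + 1) := by
    intro n
    have hfin : {j | e j ≤ n}.Finite := (Set.finite_Iic n).preimage he.injOn
    refine Eventually.exists (f := (hyperfilter ℕ : Filter ℕ)) (hfin.eventually_all.2 fun j _ => ?_)
    have := (hd j).abs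
    rw [abs_zero] at this
    exact this.eventually_lt_const (by positivity)
  choose s hs using this
  refine ⟨s, fun j => ?_⟩
  rw [tendsto_zero_iff_abs_tendsto_zero]
  refine squeeze_zero' (Eventually.of_forall fun n => abs_nonneg _)
    (eventually_atTop.2 ⟨e j, fun n hn => (hs n j hn).le⟩) tendsto_one_div_add_atTop_nhds_zero_nat

namespace CosetAction

open SLThree

variable {m : ℕ} {Λ : Subgroup Γ} (ψ : Λ →* FreeGroup (Fin m)) (u : Fin m → Ix) (p : ℕ → ℕ)
  [∀ j, NeZero (p j)]

variable (Λ) in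
/-- The event that the coordinates at the base point differ by an element of `H`. -/
def diffSet (i : ℕ) (H : Set (G3 (ZMod (p i)))) :
    Set ((∀ _ : Pt Λ × Unit, G3 (ZMod (p i))) × (∀ y : Pt Λ × ℕ, G3 (ZMod (p y.2)))) :=
  {x | (x.2 (base Λ, i))⁻¹ * x.1 (base Λ, ()) ∈ H}

theorem measurableSet_diffSet (i : ℕ) (H : Set (G3 (ZMod (p i)))) :
    MeasurableSet (diffSet Λ p i H) := by
  have h1 : Measurable fun x : (∀ _ : Pt Λ × Unit, G3 (ZMod (p i))) ×
      (∀ y : Pt Λ × ℕ, G3 (ZMod (p y.2))) => (x.2 (base Λ, i), x.1 (base Λ, ())) :=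
    ((measurable_pi_apply (X := fun y : Pt Λ × ℕ => G3 (ZMod (p y.2))) (base Λ, i)).comp
      measurable_snd).prodMk
    ((measurable_pi_apply (X := fun _ : Pt Λ × Unit => G3 (ZMod (p i))) (base Λ, ())).comp
      measurable_fst)
  exact h1 (t := {y | y.1⁻¹ * y.2 ∈ H}) (Set.toFinite _).measurableSet

theorem act₂_mem_diffSet (i : ℕ) (H : Set (G3 (ZMod (p i)))) (γ : Λ)
    (x : (∀ _ : Pt Λ × Unit, G3 (ZMod (p i))) × (∀ y : Pt Λ × ℕ, G3 (ZMod (p y.2)))) :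
    act₂ ψ u p i γ x ∈ diffSet Λ p i H ↔ x ∈ diffSet Λ p i H := by
  have h : ((γ : Γ)⁻¹) • base Λ = base Λ := smul_base γ⁻¹
  have h1 : (act₂ ψ u p i γ x).1 (base Λ, ()) = red ψ u (p i) γ * x.1 (base Λ, ()) := by
    show coc (red ψ u (p i)) (γ : Γ) ((γ : Γ)⁻¹ • base Λ) * x.1 ((γ : Γ)⁻¹ • base Λ, ()) = _
    rw [h, coc_base]
  have h2 : (act₂ ψ u p i γ x).2 (base Λ, i) = red ψ u (p i) γ * x.2 (base Λ, i) := by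
    show coc (red ψ u (p i)) (γ : Γ) ((γ : Γ)⁻¹ • base Λ) * x.2 ((γ : Γ)⁻¹ • base Λ, i) = _
    rw [Skew.apply_congr (K := fun j => G3 (ZMod (p j))) x.2 h i, h, coc_base]
  simp only [diffSet, Set.mem_ofPred_eq]
  rw [h1, h2, _root_.mul_inv_rev, mul_assoc, inv_mul_cancel_left]

theorem real_diffSet (i : ℕ) (H : Set (G3 (ZMod (p i)))) :
    (haar₂ Λ p i).real (diffSet Λ p i H) = (unif (G3 (ZMod (p i)))).real H := by
  have h1 : ∀ y : (∀ y : Pt Λ × ℕ, G3 (ZMod (p y.2))),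
      Skew.haar (Pt Λ) (fun _ : Unit => G3 (ZMod (p i))) ((fun x => (x, y)) ⁻¹' diffSet Λ p i H) =
        unif (G3 (ZMod (p i))) H := by
    intro y
    have e : (fun x => (x, y)) ⁻¹' diffSet Λ p i H =
        (fun x : (∀ _ : Pt Λ × Unit, G3 (ZMod (p i))) => x (base Λ, ())) ⁻¹'
          (Equiv.mulLeft (y (base Λ, i))⁻¹ ⁻¹' H) := rfl
    rw [e, ← Measure.map_apply
      (measurable_pi_apply (X := fun _ : Pt Λ × Unit => G3 (ZMod (p i))) _)
      (Set.toFinite _).measurableSet, Skew.haar]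
    refine Eq.trans (congrArg (fun ν : Measure (G3 (ZMod (p i))) => ν _)
      (Measure.infinitePi_map_eval (fun q : Pt Λ × Unit => unif (G3 (ZMod (p i)))) (base Λ, ()))) ?_
    exact unif_preimage _ H
  rw [Measure.real, haar₂, Measure.prod_apply_symm (measurableSet_diffSet p i H)]
  simp only [h1, lintegral_const, measure_univ, mul_one]
  rfl

open FreeGroup (mk hd) in
theorem le_hausdorffDist (hm : 2 ≤ m) (hu : Function.Surjective u) (hp : ∀ j, (p j).Prime)
    (hinj : Function.Injective p) (θ : FreeGroup (Fin m) →* Γ)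
    (hθ : ∀ w, ∃ h : θ w ∈ Λ, ψ ⟨θ w, h⟩ = w)
    (hfin : ∀ g ∉ Λ, ∃ a, {w | hd w = some a ∧ g⁻¹ * θ w * g ∈ Λ}.Finite)
    (l : PMP.Limit (fun i => act ψ u fun _ : Unit => p i)
      fun i => {C : Set (∀ _ : Pt Λ × Unit, G3 (ZMod (p i))) | FinDep C}) :
    ∃ S : Finset Γ, ∃ η : ℝ, 0 < η ∧ ∀ i, η ≤ Metric.hausdorffDist
      (((act ψ u fun _ : Unit => p i).prod (act ψ u p)).C S 2) ((l.α.prod (act ψ u p)).C S 2) := by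
  classical
  set ε : ℝ := 1 / 10 ^ 14 / (2 * m + 5) with hε
  have hε0 : 0 < ε := by positivity
  obtain ⟨S, hS⟩ : ∃ S : Finset Γ, ∀ a : Fin m × Bool, θ (mk [a]) ∈ S :=
    ⟨Finset.univ.image fun a => θ (mk [a]),
      fun a => Finset.mem_image_of_mem _ (Finset.mem_univ a)⟩
  refine ⟨S, min (ε ^ 2 / 4) (1 / 100), by positivity,
    fun i => ?_⟩
  by_contra! hlt
  obtain ⟨H, hH1, hH2⟩ := exists_bit (hp i)
  let f : (∀ _ : Pt Λ × Unit, G3 (ZMod (p i))) × (∀ y : Pt Λ × ℕ, G3 (ZMod (p y.2))) → Fin 2 :=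
    fun x => if x ∈ diffSet Λ p i H then 1 else 0
  have hf : Measurable f :=
    Measurable.ite (measurableSet_diffSet p i H) measurable_const measurable_const
  have hf1 : {x | f x = 1} = diffSet Λ p i H := by
    ext x; by_cases h : x ∈ diffSet Λ p i H <;> simp [f, h]
  obtain ⟨f', hf', hev⟩ := l.exists_coloring (act ψ u p)
    (ℬ := {C : Set (∀ y : Pt Λ × ℕ, G3 (ZMod (p y.2))) | FinDep C}) (isSetAlgebra_finDep _)
    (FinDep.generateFrom fun y : Pt Λ × ℕ => G3 (ZMod (p y.2)))
    (fun γ B hB => Skew.finDep_act _ (cocz_mul ψ u p) γ hB) (fun i D hD => FinDep.measurableSet hD)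
    _ 2 i (f := f) hf hlt
  obtain ⟨ι, hι, v, U, hv, hU, hvU⟩ := hf' {1}
  cases nonempty_fintype ι
  choose V hV using hv
  set q := (Finset.univ.biUnion V).sup Prod.snd + 1 with hq
  have hge : ∀ᶠ j in (hyperfilter ℕ : Filter ℕ), q ≤ j :=
    Nat.hyperfilter_le_atTop (eventually_ge_atTop q)
  obtain ⟨i', hi'q, hi'⟩ := (hge.and hev).exists
  have hUfd : ∀ t, FinDep (Z := fun _ : Pt Λ × Unit => G3 (ZMod (p i'))) (l.θ i' ⁻¹' U t) :=
    fun t => l.preimage_mem i' _ (hU t)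
  choose V' hV' using hUfd
  let F : (∀ _ : Pt Λ × Unit, G3 (ZMod (p i'))) × (∀ y : Pt Λ × ℕ, G3 (ZMod (p y.2))) → Fin 2 :=
    f' ∘ Prod.map (l.θ i') id
  have hFmem : ∀ x, F x = 1 ↔ l.θ i' x.1 ∈ U (v x.2) := fun x =>
    Iff.of_eq (congrArg (Prod.map (l.θ i') id x ∈ ·) hvU)
  have hnear : ∀ a, (haar₂ Λ p i').real
      {x | ¬(F x = 1 ↔ F (act₂ ψ u p i' (θ (mk [a])) x) = 1)} ≤ ε ^ 2 ∧
      |(haar₂ Λ p i').real {x | F x = 1} - (haar₂ Λ p i).real {x | f x = 1}| ≤ 1 / 25 := by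
    intro a
    have := PMP.near_invariant (a := (act ψ u fun _ : Unit => p i').prod (act ψ u p))
      (b := (act ψ u fun _ : Unit => p i).prod (act ψ u p)) (f := F) (f₀ := f)
      (γ := θ (mk [a])) (hS a) (fun x => by
        have := act₂_mem_diffSet ψ u p i H ⟨_, (hθ (mk [a])).1⟩ x
        exact if_congr this rfl rfl) hi'
    refine ⟨this.1.trans ?_, this.2.trans ?_⟩
    · linarith [min_le_left (ε ^ 2 / 4) (1 / 100 : ℝ)]
    · linarith [min_le_right (ε ^ 2 / 4) (1 / 100 : ℝ)]
  have key := real_sub_sq_le ψ u p θ hm hu hp hinj hθ hfin hi'q (D := {x | F x = 1})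
    (W := Finset.univ.biUnion V') (W' := Finset.univ.biUnion V)
    (fun y hy => Nat.lt_succ_of_le (Finset.le_sup (f := Prod.snd) hy)) (fun x x' h1 h2 hx => by
      rw [Set.mem_ofPred_eq, hFmem] at hx ⊢
      have e1 : v x'.2 = v x.2 :=
        hV (v x.2) x.2 x'.2 (fun y hy => h2 y (Finset.mem_biUnion.2 ⟨_, Finset.mem_univ _, hy⟩)) rfl
      rw [e1]
      exact hV' (v x.2) x.1 x'.1
        (fun y hy => h1 y (Finset.mem_biUnion.2 ⟨_, Finset.mem_univ _, hy⟩)) hx)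
    hε0.le (by rw [hε, div_mul_cancel₀ _ (by positivity)]) fun a => (hnear a).1
  have h2 := abs_le.1 (hnear (⟨0, by omega⟩, true)).2
  rw [hf1, real_diffSet] at h2
  nlinarith

end CosetAction

open FreeGroup (hd) in
/-- A group with a subgroup surjecting onto a free group, whose action on the cosets has suitably
small stabilizers, has an action multiplication by which is discontinuous. -/
theorem exists_discontinuous_of_free [Countable Γ] [Infinite Γ] {m : ℕ} (hm : 6 ≤ m)
    {Λ : Subgroup Γ} (ψ : Λ →* FreeGroup (Fin m)) (θ : FreeGroup (Fin m) →* Γ)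
    (hθ : ∀ w, ∃ h : θ w ∈ Λ, ψ ⟨θ w, h⟩ = w)
    (hfin : ∀ g ∉ Λ, ∃ a, {w | hd w = some a ∧ g⁻¹ * θ w * g ∈ Λ}.Finite) :
    ∃ β : PMP Γ,
      StandardBorelSpace β.X ∧ NoAtoms β.μ ∧ β.Free ∧
      ∃ (A : ℕ → PMP Γ) (α : PMP Γ),
        (∀ i, StandardBorelSpace (A i).X) ∧ StandardBorelSpace α.X ∧
        (∀ i, NoAtoms (A i).μ) ∧ NoAtoms α.μ ∧
        (∀ i, (A i).Free) ∧ α.Free ∧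
        (∀ (S : Finset Γ) (k : ℕ), 0 < k →
          Tendsto (fun i => Metric.hausdorffDist ((A i).C S k) (α.C S k)) atTop (𝓝 0)) ∧
        (∃ (S : Finset Γ) (k : ℕ), 0 < k ∧
          ¬ Tendsto (fun i =>
              Metric.hausdorffDist (((A i).prod β).C S k) ((α.prod β).C S k))
            atTop (𝓝 0)) := by
  classical
  have hcard : Fintype.card SLThree.Ix ≤ Fintype.card (Fin m) := by
    have : Fintype.card SLThree.Ix = 6 := by decide
    simpa [this] using hm
  have : Nonempty SLThree.Ix := ⟨SLThree.q01⟩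
  obtain ⟨emb⟩ := Function.Embedding.nonempty_of_card_le hcard
  set u : Fin m → SLThree.Ix := Function.invFun emb
  have hu : Function.Surjective u := Function.invFun_surjective emb.injective
  set p : ℕ → ℕ := Nat.nth Nat.Prime
  have hp : ∀ j, (p j).Prime := Nat.prime_nth_prime
  have hinj : Function.Injective p := Nat.nth_injective Nat.infinite_setOfPred_prime
  have inst : ∀ j, NeZero (p j) := fun j => ⟨(hp j).ne_zero⟩
  choose H hH1 hH2 using fun j => CosetAction.exists_bit (hp j)
  set A : ℕ → PMP Γ := fun i => CosetAction.act ψ u fun _ : Unit => p i with hA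
  set β : PMP Γ := CosetAction.act ψ u p with hβ
  have hAspread : ∀ i, (A i).Spread {ω : ∀ q : CosetAction.Pt Λ × Unit,
      SLThree.G3 (ZMod (p i)) | ω (Sum.inr 1, ()) ∈ H i} := fun i =>
    CosetAction.act_spread ψ u (fun _ : Unit => p i) () (H i) (hH1 i) (hH2 i)
  have hAstd : ∀ i, StandardBorelSpace (A i).X := fun i =>
    CosetAction.act_standardBorel ψ u fun _ : Unit => p i
  have hβstd : StandardBorelSpace β.X := CosetAction.act_standardBorel ψ u p
  have hβfree : β.Free := (CosetAction.act_spread ψ u p 0 (H 0) (hH1 0) (hH2 0)).free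
  obtain ⟨l, ⟨c, hc, hcb⟩, hl⟩ := PMP.exists_limit A
    (fun i => {C : Set (∀ _ : CosetAction.Pt Λ × Unit, SLThree.G3 (ZMod (p i))) | FinDep C})
    (fun i => isSetAlgebra_finDep _) (fun i => Skew.measureDense _ (CosetAction.cocz_mul ψ u _))
    (fun i γ D hD => Skew.finDep_act (CosetAction.cocz ψ u fun _ : Unit => p i)
      (CosetAction.cocz_mul ψ u _) γ (D := D) hD)
    (fun i => {ω : ∀ q : CosetAction.Pt Λ × Unit,
      SLThree.G3 (ZMod (p i)) | ω (Sum.inr 1, ()) ∈ H i}) (fun i => FinDep.eval _ _)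
  have hαfree : l.α.Free := (l.spread hc fun i => by rw [hcb i]; exact hAspread i).free
  have hαstd := l.std
  obtain ⟨S, η, hη, hle⟩ := CosetAction.le_hausdorffDist ψ u p (by omega) hu hp hinj θ hθ hfin l
  obtain ⟨s, hs⟩ := exists_seq_of_tendsto_hyperfilter
    (fun (j : Finset Γ × ℕ) i => Metric.hausdorffDist ((A i).C j.1 (j.2 + 1)) (l.α.C j.1 (j.2 + 1)))
    fun j => hl j.1 (j.2 + 1) j.2.succ_pos
  refine ⟨β, hβstd, hβfree.noAtoms, hβfree, fun n => A (s n), l.α, fun n => hAstd _, hαstd,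
    fun n => (hAspread _).free.noAtoms, hαfree.noAtoms, fun n => (hAspread _).free, hαfree,
    fun S k hk => ?_, S, 2, by norm_num, fun h => ?_⟩
  · obtain ⟨k, rfl⟩ := Nat.exists_eq_succ_of_ne_zero hk.ne'
    exact hs (S, k)
  · obtain ⟨n, hn⟩ := (h.eventually_lt_const hη).exists
    exact absurd (hle (s n)) (not_le.2 hn)

namespace LinDyn

variable {d : ℕ}

/-- A real function of a matrix which is a homogeneous polynomial in the entries. -/
structure IsForm (f : Matrix (Fin d) (Fin d) ℝ → ℝ) : Prop where
  poly : ∃ P : MvPolynomial (Fin d × Fin d) ℝ,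
    ∀ A, f A = MvPolynomial.eval (fun ij => A ij.1 ij.2) P
  homog : ∃ n : ℕ, ∀ (t : ℝ) A, f (t • A) = t ^ n * f A

theorem IsForm.prod {ι : Type*} (s : Finset ι) {f : ι → Matrix (Fin d) (Fin d) ℝ → ℝ}
    (hf : ∀ i, IsForm (f i)) : IsForm fun A => ∏ i ∈ s, f i A := by
  choose P hP using fun i => (hf i).poly
  choose n hn using fun i => (hf i).homog
  refine ⟨⟨∏ i ∈ s, P i, fun A => ?_⟩, ∑ i ∈ s, n i, fun t A => ?_⟩
  · simp [hP, map_prod]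
  · simp only [hn, Finset.prod_mul_distrib, Finset.prod_pow_eq_pow_sum]

theorem poly_sum {ι : Type*} (s : Finset ι) {f : ι → Matrix (Fin d) (Fin d) ℝ → ℝ}
    (hf : ∀ i, ∃ P : MvPolynomial (Fin d × Fin d) ℝ,
      ∀ A, f i A = MvPolynomial.eval (fun ij => A ij.1 ij.2) P) (c : ι → ℝ) :
    ∃ P : MvPolynomial (Fin d × Fin d) ℝ,
      ∀ A, ∑ i ∈ s, c i * f i A = MvPolynomial.eval (fun ij => A ij.1 ij.2) P := by
  choose P hP using hf
  exact ⟨∑ i ∈ s, MvPolynomial.C (c i) * P i, fun A => by simp [hP]⟩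

theorem isForm_bilin (w x : Fin d → ℝ) : IsForm fun A => w ⬝ᵥ A.mulVec x := by
  refine ⟨?_, 1, fun t A => by simp [Matrix.smul_mulVec, dotProduct_smul]⟩
  obtain ⟨P, hP⟩ := poly_sum (Finset.univ : Finset (Fin d × Fin d))
    (f := fun ij A => A ij.1 ij.2) (fun ij => ⟨MvPolynomial.X ij, by simp⟩)
    (fun ij => w ij.1 * x ij.2)
  refine ⟨P, fun A => ?_⟩
  rw [← hP, Fintype.sum_prod_type]
  simp only [dotProduct, Matrix.mulVec, Finset.mul_sum]
  exact Finset.sum_congr rfl fun i _ => Finset.sum_congr rfl fun j _ => by ring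

theorem isForm_adjugate (w x : Fin d → ℝ) : IsForm fun A => w ⬝ᵥ A.adjugate.mulVec x := by
  refine ⟨?_, d - 1, fun t A => by simp [Matrix.adjugate_smul, Matrix.smul_mulVec]⟩
  obtain ⟨P, hP⟩ := poly_sum (Finset.univ : Finset (Fin d × Fin d))
    (f := fun ij A => A.adjugate ij.1 ij.2)
    (fun ij => ⟨(Matrix.mvPolynomialX (Fin d) (Fin d) ℝ).adjugate ij.1 ij.2, fun A => by
      have := (MvPolynomial.eval fun ij : Fin d × Fin d => A ij.1 ij.2).map_adjugate
        (Matrix.mvPolynomialX (Fin d) (Fin d) ℝ)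
      rw [Matrix.mvPolynomialX_mapMatrix_eval] at this
      rw [← this]; rfl⟩)
    (fun ij => w ij.1 * x ij.2)
  refine ⟨P, fun A => ?_⟩
  rw [← hP, Fintype.sum_prod_type]
  simp only [dotProduct, Matrix.mulVec, Finset.mul_sum]
  exact Finset.sum_congr rfl fun i _ => Finset.sum_congr rfl fun j _ => by ring

/-- A representation of a group by real matrices of determinant one which has discrete image
and finite kernel, and whose image is Zariski dense in `SL_d(ℝ)`. -/
structure IsDenseRep {Γ : Type*} [Group Γ] (ρ : Γ →* Matrix (Fin d) (Fin d) ℝ) : Prop where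
  det_eq_one : ∀ γ, (ρ γ).det = 1
  finite : ∀ R : ℝ, {γ | ∀ i j, |ρ γ i j| ≤ R}.Finite
  dense : ∀ P : MvPolynomial (Fin d × Fin d) ℝ,
    (∀ γ, MvPolynomial.eval (fun ij => ρ γ ij.1 ij.2) P = 0) →
    ∀ A : Matrix (Fin d) (Fin d) ℝ, A.det = 1 → MvPolynomial.eval (fun ij => A ij.1 ij.2) P = 0

theorem IsForm.eq_zero_of_det {f : Matrix (Fin d) (Fin d) ℝ → ℝ} (hf : IsForm f)
    (h : ∀ A : Matrix (Fin d) (Fin d) ℝ, A.det = 1 → f A = 0) (A : Matrix (Fin d) (Fin d) ℝ) :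
    f A = 0 := by
  obtain ⟨P, hP⟩ := hf.poly
  obtain ⟨n, hn⟩ := hf.homog
  have hpos : ∀ B : Matrix (Fin d) (Fin d) ℝ, 0 < B.det → f B = 0 := by
    intro B hB
    rcases Nat.eq_zero_or_pos d with rfl | hd
    · exact h B (by simp)
    have h0 : 0 < B.det ^ (1 / d : ℝ) := Real.rpow_pos_of_pos hB _
    have h1 := h ((B.det ^ (1 / d : ℝ))⁻¹ • B) (by
      rw [Matrix.det_smul, Fintype.card_fin, inv_pow, ← Real.rpow_natCast, ← Real.rpow_mul hB.le,
        one_div, inv_mul_cancel₀ (by positivity), Real.rpow_one, inv_mul_cancel₀ hB.ne'])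
    rw [hn] at h1
    exact (mul_eq_zero.1 h1).resolve_left (by positivity)
  set Q : Polynomial ℝ := MvPolynomial.aeval
    (fun ij : Fin d × Fin d => Polynomial.C (A ij.1 ij.2) +
      Polynomial.C ((1 : Matrix (Fin d) (Fin d) ℝ) ij.1 ij.2) * Polynomial.X) P with hQ
  have hQe : ∀ s : ℝ, Q.eval s = f (A + s • (1 : Matrix (Fin d) (Fin d) ℝ)) := by
    intro s
    rw [hP, hQ, ← Polynomial.coe_evalRingHom, ← MvPolynomial.eval₂_id, MvPolynomial.aeval_def,
      MvPolynomial.hom_eval₂]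
    congr 1
    · ext x; simp
    · ext ij
      show Polynomial.eval s (Polynomial.C _ + Polynomial.C _ * Polynomial.X) = _
      rw [Polynomial.eval_add, Polynomial.eval_mul, Polynomial.eval_C, Polynomial.eval_C,
        Polynomial.eval_X, mul_comm]
      rfl
  set D : Polynomial ℝ := (-A).charpoly with hD
  have hDe : ∀ s : ℝ, D.eval s = (A + s • (1 : Matrix (Fin d) (Fin d) ℝ)).det := by
    intro s
    rw [hD, Matrix.eval_charpoly]
    congr 1
    rw [sub_neg_eq_add, add_comm, Matrix.smul_one_eq_diagonal]
    rfl
  have hQ0 : Q = 0 := by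
    rcases Nat.eq_zero_or_pos d with rfl | hd
    · refine Polynomial.funext fun s => ?_
      rw [hQe, hpos _ (by simp), Polynomial.eval_zero]
    · have ht : Tendsto (fun s => D.eval s) atTop atTop :=
        D.tendsto_atTop_of_leadingCoeff_nonneg
          (by
            rw [Polynomial.degree_eq_natDegree (Matrix.charpoly_monic _).ne_zero,
              Matrix.charpoly_natDegree_eq_dim, Fintype.card_fin]
            exact_mod_cast hd)
          (by rw [(Matrix.charpoly_monic _).leadingCoeff]; exact zero_le_one)
      obtain ⟨s₀, hs₀⟩ := eventually_atTop.1 (ht.eventually_gt_atTop 0)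
      refine Polynomial.eq_zero_of_infinite_isRoot _ ((Set.Ici_infinite s₀).mono fun s hs => ?_)
      show Q.eval s = 0
      rw [hQe]
      exact hpos _ (by rw [← hDe]; exact hs₀ s hs)
  have := hQe 0
  rwa [hQ0, Polynomial.eval_zero, zero_smul, add_zero, eq_comm] at this

variable {Γ : Type*} [Group Γ] {ρ : Γ →* Matrix (Fin d) (Fin d) ℝ}

theorem IsDenseRep.form_eq_zero (hρ : IsDenseRep ρ) {f : Matrix (Fin d) (Fin d) ℝ → ℝ}
    (hf : IsForm f) (h : ∀ γ, f (ρ γ) = 0) (A : Matrix (Fin d) (Fin d) ℝ) : f A = 0 := by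
  obtain ⟨P, hP⟩ := hf.poly
  refine hf.eq_zero_of_det (fun B hB => ?_) A
  rw [hP]
  exact hρ.dense P (fun γ => by rw [← hP, h]) B hB

/-- Finitely many nonzero forms have a common nonzero in a Zariski dense group. -/
theorem IsDenseRep.exists_ne_zero (hρ : IsDenseRep ρ) {ι : Type*} (s : Finset ι)
    {f : ι → Matrix (Fin d) (Fin d) ℝ → ℝ} (hf : ∀ i, IsForm (f i))
    (h : ∀ i ∈ s, ∃ A, f i A ≠ 0) : ∃ γ, ∀ i ∈ s, f i (ρ γ) ≠ 0 := by
  by_contra! hc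
  have h0 := hρ.form_eq_zero (IsForm.prod s hf) fun γ => by
    obtain ⟨i, hi, h⟩ := hc γ
    exact Finset.prod_eq_zero hi h
  choose P hP using fun i => (hf i).poly
  have h1 : ∏ i ∈ s, P i = 0 := by
    refine MvPolynomial.funext fun x => ?_
    have := h0 (Matrix.of fun i j => x (i, j))
    simp only [hP, Matrix.of_apply, Prod.mk.eta] at this
    rw [map_prod, map_zero]
    exact this
  obtain ⟨i, hi, h2⟩ := Finset.prod_eq_zero_iff.1 h1
  obtain ⟨A, hA⟩ := h i hi
  exact hA (by rw [hP, h2, map_zero])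

theorem IsDenseRep.inv_eq (hρ : IsDenseRep ρ) (γ : Γ) : ρ γ⁻¹ = (ρ γ).adjugate := by
  have h1 : ρ γ * ρ γ⁻¹ = 1 := by rw [← map_mul, mul_inv_cancel, map_one]
  calc ρ γ⁻¹ = ((ρ γ).adjugate * ρ γ) * ρ γ⁻¹ := by
        rw [Matrix.adjugate_mul, hρ.det_eq_one, one_smul, one_mul]
    _ = (ρ γ).adjugate := by rw [mul_assoc, h1, mul_one]

end LinDyn

section

open scoped Matrix.Norms.Elementwise

theorem Matrix.exists_rank_factorization {d : ℕ} (g : Matrix (Fin d) (Fin d) ℝ) :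
    ∃ (L : Matrix (Fin d) (Fin g.rank) ℝ) (R : Matrix (Fin g.rank) (Fin d) ℝ)
      (L' : Matrix (Fin g.rank) (Fin d) ℝ) (R' : Matrix (Fin d) (Fin g.rank) ℝ),
      g = L * R ∧ L' * L = 1 ∧ R * R' = 1 := by
  set f := Matrix.toLin' g with hf
  have hr : Module.finrank ℝ (LinearMap.range f) = Module.finrank ℝ (Fin g.rank → ℝ) := by
    rw [Module.finrank_fin_fun]; rfl
  let e : LinearMap.range f ≃ₗ[ℝ] (Fin g.rank → ℝ) := LinearEquiv.ofFinrankEq _ _ hr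
  let fL : (Fin g.rank → ℝ) →ₗ[ℝ] (Fin d → ℝ) := (LinearMap.range f).subtype ∘ₗ e.symm.toLinearMap
  let fR : (Fin d → ℝ) →ₗ[ℝ] (Fin g.rank → ℝ) := e.toLinearMap ∘ₗ f.rangeRestrict
  have hLR : fL ∘ₗ fR = f := by
    ext x; simp [fL, fR]
  have hL : LinearMap.ker fL = ⊥ := by
    rw [LinearMap.ker_eq_bot]
    exact (Submodule.injective_subtype _).comp e.symm.injective
  have hR : LinearMap.range fR = ⊤ := by
    rw [LinearMap.range_eq_top]
    exact e.surjective.comp f.surjective_rangeRestrict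
  obtain ⟨fL', hL'⟩ := fL.exists_leftInverse_of_injective hL
  obtain ⟨fR', hR'⟩ := fR.exists_rightInverse_of_surjective hR
  refine ⟨LinearMap.toMatrix' fL, LinearMap.toMatrix' fR, LinearMap.toMatrix' fL',
    LinearMap.toMatrix' fR', ?_, ?_, ?_⟩
  · rw [← LinearMap.toMatrix'_comp, hLR, hf, LinearMap.toMatrix'_toLin']
  · rw [← LinearMap.toMatrix'_comp, hL', LinearMap.toMatrix'_id]
  · rw [← LinearMap.toMatrix'_comp, hR', LinearMap.toMatrix'_id]

namespace LinDyn

variable {p : ℕ}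

theorem isCompact_abs_det_eq_one {T : Set (Matrix (Fin p) (Fin p) ℝ)} (hT : IsClosed T)
    (hsmul : ∀ t : ℝ, ∀ y ∈ T, t • y ∈ T) (hdet : ∀ y ∈ T, y ≠ 0 → y.det ≠ 0) :
    IsCompact {y | y ∈ T ∧ |y.det| = 1} := by
  have hcd : Continuous fun y : Matrix (Fin p) (Fin p) ℝ => |y.det| :=
    (continuous_id.matrix_det).abs
  have hclosed : IsClosed {y | y ∈ T ∧ |y.det| = 1} :=
    hT.inter (isClosed_singleton.preimage hcd)
  refine Metric.isCompact_of_isClosed_isBounded hclosed ?_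
  have hK : IsCompact (T ∩ Metric.sphere (0 : Matrix (Fin p) (Fin p) ℝ) 1) :=
    (isCompact_sphere _ _).inter_left hT
  rcases (T ∩ Metric.sphere (0 : Matrix (Fin p) (Fin p) ℝ) 1).eq_empty_or_nonempty with he | hne
  · refine (Metric.isBounded_closedBall (x := (0 : Matrix (Fin p) (Fin p) ℝ)) (r := 0)).subset ?_
    rintro y ⟨hy, -⟩
    by_contra hy0
    have hy0 : y ≠ 0 := by simpa using hy0
    have : ‖y‖⁻¹ • y ∈ T ∩ Metric.sphere (0 : Matrix (Fin p) (Fin p) ℝ) 1 :=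
      ⟨hsmul _ _ hy, by simp [norm_smul, norm_ne_zero_iff.2 hy0]⟩
    rw [he] at this
    exact this
  obtain ⟨z, hz, hmin⟩ := hK.exists_isMinOn hne hcd.continuousOn
  have hz0 : z ≠ 0 := by
    rintro rfl
    simpa using hz.2
  have hc : 0 < |z.det| := abs_pos.2 (hdet z hz.1 hz0)
  refine (Metric.isBounded_closedBall (x := (0 : Matrix (Fin p) (Fin p) ℝ))
    (r := max 1 |z.det|⁻¹)).subset ?_
  rintro y ⟨hy, hy1⟩
  rw [mem_closedBall_zero_iff]
  rcases le_or_gt ‖y‖ 1 with h | h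
  · exact h.trans (le_max_left _ _)
  have hy0 : y ≠ 0 := by rintro rfl; norm_num at h
  have h0 : 0 < ‖y‖ := norm_pos_iff.2 hy0
  have h1 : |z.det| ≤ |(‖y‖⁻¹ • y).det| := hmin ⟨hsmul _ _ hy, by simp [norm_smul, h0.ne']⟩
  rw [Matrix.det_smul, abs_mul, hy1, mul_one, Fintype.card_fin, abs_pow, abs_inv, abs_norm,
    inv_pow] at h1
  have hp : p ≠ 0 := by
    rintro rfl
    exact hz0 (Subsingleton.elim _ _)
  refine le_trans ?_ (le_max_right _ _)
  calc ‖y‖ ≤ ‖y‖ ^ p := le_self_pow₀ h.le hp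
    _ ≤ |z.det|⁻¹ := by
      rw [le_inv_comm₀ (by positivity) hc]; exact h1

open scoped Pointwise in
/-- A set of matrices preserving, up to scaling, a compact set of matrices of determinant `±1`
preserves a positive definite quadratic form up to scaling. -/
theorem exists_invariant_form {T X : Set (Matrix (Fin p) (Fin p) ℝ)} (hT : IsClosed T)
    (hsmul : ∀ t : ℝ, ∀ y ∈ T, t • y ∈ T) (hdet : ∀ y ∈ T, y ≠ 0 → y.det ≠ 0) (h1 : 1 ∈ T)
    (hX : ∀ x ∈ X, ∀ y ∈ T, x * y ∈ T) :
    ∃ Q : Matrix (Fin p) (Fin p) ℝ, (∀ i, 0 < Q i i) ∧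
      ∀ x ∈ X, ∃ c : ℝ, x * Q * x.transpose = c • Q := by
  set K := {y | y ∈ T ∧ |y.det| = 1} with hK
  have hKc : IsCompact K := isCompact_abs_det_eq_one hT hsmul hdet
  set B : Set (Fin p → ℝ) := (fun q : Matrix (Fin p) (Fin p) ℝ × (Fin p → ℝ) => q.1.mulVec q.2) ''
    (K ×ˢ Metric.closedBall 0 1) with hB
  have hBc : IsCompact B :=
    (hKc.prod (isCompact_closedBall _ _)).image (continuous_fst.matrix_mulVec continuous_snd)
  have hball : Metric.ball 0 1 ⊆ B := fun z hz =>
    ⟨(1, z), ⟨⟨h1, by simp⟩, Metric.ball_subset_closedBall hz⟩, by simp⟩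
  have hInt : ∀ f : (Fin p → ℝ) → ℝ, Continuous f → IntegrableOn f B := fun f hf =>
    hf.continuousOn.integrableOn_compact hBc
  refine ⟨Matrix.of fun i j => ∫ z in B, z i * z j, fun i => ?_, fun x hx => ?_⟩
  · rw [Matrix.of_apply, integral_pos_iff_support_of_nonneg (fun z => mul_self_nonneg (z i))
      (hInt _ ((continuous_apply i).mul (continuous_apply i))),
      Measure.restrict_apply' hBc.measurableSet]
    have ho : IsOpen ({z : Fin p → ℝ | z i ≠ 0} ∩ Metric.ball 0 1) :=
      (isOpen_ne.preimage (continuous_apply i)).inter Metric.isOpen_ball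
    refine (ho.measure_pos volume ⟨fun _ => 1 / 2, by simp, ?_⟩).trans_le
      (measure_mono (Set.inter_subset_inter (fun z hz => ?_) hball))
    · rw [mem_ball_zero_iff, pi_norm_lt_iff one_pos]
      intro; norm_num [Real.norm_eq_abs, abs_lt]
    · simpa [Function.mem_support] using hz
  by_cases hx0 : x = 0
  · exact ⟨0, by simp [hx0]⟩
  have hxT : x ∈ T := by simpa using hX x hx 1 h1
  have hdx := hdet x hxT hx0
  have hp : p ≠ 0 := by
    rintro rfl
    exact hx0 (Subsingleton.elim _ _)
  set s : ℝ := |x.det| ^ (1 / p : ℝ) with hs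
  have hs0 : 0 < s := Real.rpow_pos_of_pos (abs_pos.2 hdx) _
  set y := s⁻¹ • x with hy
  have hyd : |y.det| = 1 := by
    rw [hy, Matrix.det_smul, abs_mul, Fintype.card_fin, abs_of_nonneg (by positivity), inv_pow, hs,
      ← Real.rpow_natCast, ← Real.rpow_mul (abs_nonneg _), one_div,
      inv_mul_cancel₀ (by positivity), Real.rpow_one, inv_mul_cancel₀ (abs_pos.2 hdx).ne']
  have hyB : ∀ z ∈ B, y.mulVec z ∈ B := by
    rintro _ ⟨⟨k, z⟩, ⟨⟨hk, hk1⟩, hz⟩, rfl⟩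
    refine ⟨(y * k, z), ⟨⟨?_, ?_⟩, hz⟩, by simp⟩
    · rw [hy, Matrix.smul_mul]; exact hsmul _ _ (hX x hx k hk)
    · rw [Matrix.det_mul, abs_mul, hyd, hk1, one_mul]
  have hmp : MeasurePreserving (fun z => y.mulVec z) (volume : Measure (Fin p → ℝ)) volume := by
    refine ⟨(continuous_const.matrix_mulVec continuous_id).measurable, ?_⟩
    have := Real.map_matrix_volume_pi_eq_smul_volume_pi (M := y) (by
      rw [← abs_pos, hyd]; exact one_pos)
    rw [abs_inv, hyd, inv_one, ENNReal.ofReal_one, one_smul] at this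
    exact this
  have hBae : ((fun z => y.mulVec z) ⁻¹' B : Set (Fin p → ℝ)) =ᵐ[volume] B := by
    have hm := hmp.measure_preimage hBc.measurableSet.nullMeasurableSet
    exact (ae_eq_of_subset_of_measure_ge hyB hm.le hBc.measurableSet.nullMeasurableSet
      (hm.trans_lt hBc.measure_lt_top).ne).symm
  have hemb : MeasurableEmbedding fun z : Fin p → ℝ => y.mulVec z := by
    refine (continuous_const.matrix_mulVec continuous_id).measurableEmbedding ?_
    exact Matrix.mulVec_injective_of_isUnit ((Matrix.isUnit_iff_isUnit_det _).2
      (isUnit_iff_ne_zero.2 (by rw [← abs_pos, hyd]; exact one_pos)))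
  have key : y * (Matrix.of fun i j => ∫ z in B, z i * z j) * y.transpose =
      Matrix.of fun i j => ∫ z in B, z i * z j := by
    ext i j
    have e1 : ∫ z in B, z i * z j = ∫ z in B, (y.mulVec z) i * (y.mulVec z) j := by
      rw [← hmp.setIntegral_preimage_emb hemb (fun z => z i * z j), setIntegral_congr_set hBae]
    have e2 : ∀ z : Fin p → ℝ, (y.mulVec z) i * (y.mulVec z) j =
        ∑ q : Fin p × Fin p, y i q.2 * y j q.1 * (z q.2 * z q.1) := by
      intro z
      simp only [Matrix.mulVec, dotProduct, Finset.sum_mul_sum, Fintype.sum_prod_type]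
      rw [Finset.sum_comm]
      exact Finset.sum_congr rfl fun k _ => Finset.sum_congr rfl fun l _ => by ring
    rw [Matrix.of_apply, e1]
    simp_rw [e2]
    rw [integral_finsetSum _ fun q _ => (hInt (fun z => z q.2 * z q.1)
      ((continuous_apply q.2).mul (continuous_apply q.1))).const_mul _, Fintype.sum_prod_type]
    simp only [Matrix.mul_apply, Matrix.transpose_apply, Matrix.of_apply, integral_const_mul,
      Finset.sum_mul]
    exact Finset.sum_congr rfl fun k _ => Finset.sum_congr rfl fun l _ => by ring
  refine ⟨s ^ 2, ?_⟩
  have hxy : x = s • y := by rw [hy, smul_smul, mul_inv_cancel₀ hs0.ne', one_smul]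
  rw [hxy, Matrix.transpose_smul, Matrix.smul_mul, Matrix.smul_mul, Matrix.mul_smul, key,
    smul_smul, sq]

end LinDyn

end

namespace LinDyn

variable {d : ℕ} {Γ : Type*} [Group Γ] (ρ : Γ →* Matrix (Fin d) (Fin d) ℝ)

/-- The closed cone spanned by the image of a representation. -/
def cone : Set (Matrix (Fin d) (Fin d) ℝ) := closure {A | ∃ (t : ℝ) (γ : Γ), A = t • ρ γ}

theorem smul_mem_cone (t : ℝ) {A : Matrix (Fin d) (Fin d) ℝ} (hA : A ∈ cone ρ) :
    t • A ∈ cone ρ := by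
  refine map_mem_closure (continuous_const_smul t) hA ?_
  rintro _ ⟨s, γ, rfl⟩
  exact ⟨t * s, γ, smul_smul _ _ _⟩

theorem mul_mem_cone {A B : Matrix (Fin d) (Fin d) ℝ} (hA : A ∈ cone ρ) (hB : B ∈ cone ρ) :
    A * B ∈ cone ρ := by
  refine map_mem_closure₂ continuous_mul hA hB ?_
  rintro _ ⟨s, γ, rfl⟩ _ ⟨t, δ, rfl⟩
  exact ⟨s * t, γ * δ, by rw [map_mul, Matrix.smul_mul, Matrix.mul_smul, smul_smul]⟩

theorem apply_mem_cone (γ : Γ) : ρ γ ∈ cone ρ := subset_closure ⟨1, γ, (one_smul _ _).symm⟩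

variable {ρ}

/-- The quadratic form `A ↦ ((R A L) Q (R A L)ᵀ) i i` is polynomial. -/
theorem poly_congr_apply {p : ℕ} (L : Matrix (Fin d) (Fin p) ℝ) (R : Matrix (Fin p) (Fin d) ℝ)
    (Q : Matrix (Fin p) (Fin p) ℝ) (i : Fin p) :
    ∃ P : MvPolynomial (Fin d × Fin d) ℝ, ∀ A : Matrix (Fin d) (Fin d) ℝ,
      ((R * A * L) * Q * (R * A * L).transpose) i i =
        MvPolynomial.eval (fun ij => A ij.1 ij.2) P := by
  have h : ∀ s, ∃ P : MvPolynomial (Fin d × Fin d) ℝ, ∀ A : Matrix (Fin d) (Fin d) ℝ,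
      (R * A * L) i s = MvPolynomial.eval (fun ij => A ij.1 ij.2) P := by
    intro s
    obtain ⟨P, hP⟩ := (isForm_bilin (R i) fun k => L k s).poly
    refine ⟨P, fun A => ?_⟩
    rw [← hP, Matrix.mul_assoc]
    rfl
  choose P hP using h
  refine ⟨∑ t, (∑ s, P s * MvPolynomial.C (Q s t)) * P t, fun A => ?_⟩
  simp only [map_sum, map_mul, ← hP, MvPolynomial.eval_C]
  rw [Matrix.mul_apply]
  exact Finset.sum_congr rfl fun t _ => by rw [Matrix.mul_apply]; rfl

/-- The closed cone spanned by a Zariski dense group contains a matrix of rank one. -/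
theorem IsDenseRep.exists_rank_one (hρ : IsDenseRep ρ) (hd : 2 ≤ d) :
    ∃ v w : Fin d → ℝ, v ≠ 0 ∧ w ≠ 0 ∧ Matrix.vecMulVec v w ∈ cone ρ := by
  classical
  have : Nonempty (Fin d) := ⟨⟨0, by omega⟩⟩
  have hex : ∃ r, ∃ g ∈ cone ρ, g ≠ 0 ∧ g.rank = r :=
    ⟨_, 1, by simpa using apply_mem_cone ρ 1, one_ne_zero, rfl⟩
  obtain ⟨g, hg, hg0, hr⟩ := Nat.find_spec hex
  have hmin : ∀ g' ∈ cone ρ, g' ≠ 0 → g.rank ≤ g'.rank := fun g' h h0 => by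
    rw [hr]; exact Nat.find_min' hex ⟨g', h, h0, rfl⟩
  obtain ⟨L, R, L', R', hgLR, hL, hR⟩ := g.exists_rank_factorization
  generalize g.rank = p at *
  have hp0 : p ≠ 0 := by
    rintro rfl
    exact hg0 (by rw [hgLR]; ext i j; simp [Matrix.mul_apply])
  have hcancel : ∀ x : Matrix (Fin p) (Fin p) ℝ, L' * (L * x * R) * R' = x := fun x => by
    rw [Matrix.mul_assoc L, ← Matrix.mul_assoc L', hL, Matrix.one_mul, Matrix.mul_assoc, hR,
      Matrix.mul_one]
  by_cases hp1 : p = 1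
  · subst hp1
    have hg' : g = Matrix.vecMulVec (fun i => L i 0) (R 0) := by
      rw [hgLR]; ext i j; simp [Matrix.mul_apply, Matrix.vecMulVec_apply]
    refine ⟨fun i => L i 0, R 0, ?_, ?_, hg' ▸ hg⟩
    · intro h
      exact hg0 (by rw [hg', h, Matrix.zero_vecMulVec])
    · intro h
      exact hg0 (by rw [hg', h, Matrix.vecMulVec_zero])
  exfalso
  set T : Set (Matrix (Fin p) (Fin p) ℝ) := {x | L * x * R ∈ cone ρ} with hT
  set X : Set (Matrix (Fin p) (Fin p) ℝ) := {x | ∃ M ∈ cone ρ, x = R * M * L} with hX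
  obtain ⟨Q, hQ, hQX⟩ := exists_invariant_form (T := T) (X := X)
    (isClosed_closure.preimage (by fun_prop : Continuous fun x : Matrix (Fin p) (Fin p) ℝ =>
      L * x * R))
    (fun t y hy => by
      rw [hT, Set.mem_ofPred_eq, Matrix.mul_smul, Matrix.smul_mul]
      exact smul_mem_cone ρ t hy)
    (fun y hy hy0 => by
      have h1 : L * y * R ≠ 0 := fun h => hy0 (by
        rw [← hcancel y, h, Matrix.mul_zero, Matrix.zero_mul])
      have h2 : p ≤ y.rank := (hmin _ hy h1).trans
        ((Matrix.rank_mul_le_left _ _).trans (Matrix.rank_mul_le_right _ _))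
      have h3 : LinearMap.range y.mulVecLin = ⊤ := Submodule.eq_top_of_finrank_eq
        ((Module.finrank_fin_fun ℝ (n := p)).symm ▸
          le_antisymm ((Matrix.rank_le_card_height y).trans_eq (Fintype.card_fin p)) h2)
      have h4 : IsUnit y := Matrix.mulVec_surjective_iff_isUnit.1 (LinearMap.range_eq_top.1 h3)
      exact ((Matrix.isUnit_iff_isUnit_det _).1 h4).ne_zero)
    (by rw [hT, Set.mem_ofPred_eq, Matrix.mul_one, ← hgLR]; exact hg)
    (by
      rintro _ ⟨M, hM, rfl⟩ y hy
      have : L * (R * M * L * y) * R = g * M * (L * y * R) := by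
        rw [hgLR]; simp only [Matrix.mul_assoc]
      rw [hT, Set.mem_ofPred_eq, this]
      exact mul_mem_cone ρ (mul_mem_cone ρ hg hM) hy)
  set i0 : Fin p := ⟨0, by omega⟩
  set i1 : Fin p := ⟨1, by omega⟩
  have hi : i1 ≠ i0 := by simp [i0, i1]
  obtain ⟨P0, hP0⟩ := poly_congr_apply L R Q i0
  obtain ⟨P1, hP1⟩ := poly_congr_apply L R Q i1
  have hform : IsForm fun A : Matrix (Fin d) (Fin d) ℝ =>
      Q i1 i1 * ((R * A * L) * Q * (R * A * L).transpose) i0 i0 -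
        Q i0 i0 * ((R * A * L) * Q * (R * A * L).transpose) i1 i1 := by
    refine ⟨⟨MvPolynomial.C (Q i1 i1) * P0 - MvPolynomial.C (Q i0 i0) * P1, fun A => ?_⟩, 2,
      fun t A => ?_⟩
    · simp [← hP0, ← hP1]
    · simp only [Matrix.mul_smul, Matrix.smul_mul, Matrix.transpose_smul, Matrix.smul_apply,
        smul_eq_mul]
      ring
  have hz := hρ.form_eq_zero hform (fun γ => by
    obtain ⟨c, hc⟩ := hQX _ ⟨ρ γ, apply_mem_cone ρ γ, rfl⟩
    simp only [hc, Matrix.smul_apply, smul_eq_mul]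
    ring) (R' * Matrix.single i0 i0 (1 : ℝ) * L')
  have e : R * (R' * Matrix.single i0 i0 (1 : ℝ) * L') * L = Matrix.single i0 i0 (1 : ℝ) := by
    rw [← Matrix.mul_assoc R, ← Matrix.mul_assoc R, hR, Matrix.one_mul, Matrix.mul_assoc, hL,
      Matrix.mul_one]
  rw [e] at hz
  set E : Matrix (Fin p) (Fin p) ℝ := Matrix.single i0 i0 1 with hE
  have e0 : (E * Q * E.transpose) i0 i0 = Q i0 i0 := by simp [hE]
  have e1 : (E * Q * E.transpose) i1 i1 = 0 := by simp [hE, hi]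
  rw [e0, e1, mul_zero, sub_zero] at hz
  exact (mul_pos (hQ i1) (hQ i0)).ne' hz

end LinDyn

section

open scoped Matrix.Norms.Elementwise

theorem Ultrafilter.exists_tendsto_of_norm_le {ι E : Type*} [SeminormedAddCommGroup E]
    [ProperSpace E] (U : Ultrafilter ι) {f : ι → E} {R : ℝ} (h : ∀ i, ‖f i‖ ≤ R) :
    ∃ x, Tendsto f U (𝓝 x) := by
  obtain ⟨x, -, hx⟩ := (isCompact_closedBall (0 : E) R).ultrafilter_le_nhds (U.map f)
    (le_principal_iff.2 (show f ⁻¹' _ ∈ U from univ_mem' fun i => by simpa using h i))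
  exact ⟨x, hx⟩

theorem Ultrafilter.exists_tendsto_normalize {ι E : Type*} [NormedAddCommGroup E] [NormedSpace ℝ E]
    [ProperSpace E] (U : Ultrafilter ι) {f : ι → E} (h : ∀ i, f i ≠ 0) :
    ∃ x, x ≠ 0 ∧ Tendsto (fun i => ‖f i‖⁻¹ • f i) U (𝓝 x) := by
  have hn : ∀ i, ‖‖f i‖⁻¹ • f i‖ = 1 := fun i => by
    rw [norm_smul, norm_inv, norm_norm, inv_mul_cancel₀ (norm_ne_zero_iff.2 (h i))]
  obtain ⟨x, hx⟩ := U.exists_tendsto_of_norm_le fun i => (hn i).le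
  refine ⟨x, ?_, hx⟩
  rintro rfl
  have := hx.norm
  simp only [hn, norm_zero] at this
  exact one_ne_zero (tendsto_nhds_unique tendsto_const_nhds this)

namespace LinDyn

variable {d : ℕ} {Γ : Type*} [Group Γ] {ρ : Γ →* Matrix (Fin d) (Fin d) ℝ}

/-- A property of the elements of a group which holds outside of a proper hypersurface. -/
def Generic (ρ : Γ →* Matrix (Fin d) (Fin d) ℝ) (P : Γ → Prop) : Prop :=
  ∃ f : Matrix (Fin d) (Fin d) ℝ → ℝ, IsForm f ∧ (∃ A, f A ≠ 0) ∧ ∀ γ, f (ρ γ) ≠ 0 → P γ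

theorem IsDenseRep.exists_of_generic (hρ : IsDenseRep ρ) {P : Γ → Prop} (hP : Generic ρ P) :
    ∃ γ, P γ := by
  obtain ⟨f, hf, hA, h⟩ := hP
  obtain ⟨γ, hγ⟩ := hρ.exists_ne_zero (Finset.univ : Finset Unit) (f := fun _ => f) (fun _ => hf)
    fun _ _ => hA
  exact ⟨γ, h γ (hγ () (Finset.mem_univ _))⟩

theorem IsDenseRep.generic_forall (hρ : IsDenseRep ρ) {ι : Type*} [Finite ι] {P : ι → Γ → Prop}
    (hP : ∀ i, Generic ρ (P i)) : Generic ρ fun γ => ∀ i, P i γ := by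
  cases nonempty_fintype ι
  choose f hf hA h using hP
  refine ⟨fun A => ∏ i, f i A, IsForm.prod _ hf, ?_, fun γ hγ i =>
    h i γ (Finset.prod_ne_zero_iff.1 hγ i (Finset.mem_univ i))⟩
  obtain ⟨γ, hγ⟩ := hρ.exists_ne_zero Finset.univ hf fun i _ => hA i
  exact ⟨ρ γ, Finset.prod_ne_zero_iff.2 hγ⟩

theorem IsDenseRep.generic_and (hρ : IsDenseRep ρ) {P P' : Γ → Prop} (hP : Generic ρ P)
    (hP' : Generic ρ P') : Generic ρ fun γ => P γ ∧ P' γ := by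
  obtain ⟨f, hf, hA, h⟩ := hρ.generic_forall (ι := Bool) (P := fun b => bif b then P else P')
    (by rintro (_ | _) <;> assumption)
  exact ⟨f, hf, hA, fun γ hγ => ⟨h γ hγ true, h γ hγ false⟩⟩

theorem generic_true : Generic ρ fun _ => True :=
  ⟨fun _ => 1, ⟨⟨1, by simp⟩, 0, by simp⟩, ⟨0, one_ne_zero⟩, fun _ _ => trivial⟩

theorem generic_of_imp {q : Prop} {P : Γ → Prop}
    (hP : q → Generic ρ P) : Generic ρ fun γ => q → P γ := by
  by_cases hq : q
  · simpa only [hq, true_imp_iff] using hP hq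
  · simpa only [hq, false_imp_iff] using generic_true

theorem generic_bilin {w x : Fin d → ℝ} (hw : w ≠ 0) (hx : x ≠ 0) :
    Generic ρ fun γ => w ⬝ᵥ (ρ γ).mulVec x ≠ 0 := by
  obtain ⟨i, hi⟩ := Function.ne_iff.1 hw
  obtain ⟨j, hj⟩ := Function.ne_iff.1 hx
  refine ⟨_, isForm_bilin w x, ⟨Matrix.single i j 1, ?_⟩, fun γ h => h⟩
  have : (Matrix.single i j (1 : ℝ)).mulVec x = Pi.single i (x j) := by
    rw [Matrix.single_mulVec, one_mul]; rfl
  show w ⬝ᵥ (Matrix.single i j (1 : ℝ)).mulVec x ≠ 0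
  rw [this, dotProduct_single]
  exact mul_ne_zero hi hj

theorem IsDenseRep.generic_bilin_inv (hρ : IsDenseRep ρ) {w x : Fin d → ℝ} (hw : w ≠ 0)
    (hx : x ≠ 0) : Generic ρ fun γ => w ⬝ᵥ (ρ γ⁻¹).mulVec x ≠ 0 := by
  obtain ⟨γ, hγ⟩ := hρ.exists_of_generic (generic_bilin (ρ := ρ) hw hx)
  refine ⟨_, isForm_adjugate w x, ⟨ρ γ⁻¹, ?_⟩, fun γ h => ?_⟩
  swap
  · show w ⬝ᵥ (ρ γ⁻¹).mulVec x ≠ 0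
    rwa [hρ.inv_eq]
  rwa [← hρ.inv_eq, inv_inv]

theorem generic_notMem {v : Fin d → ℝ} (hv : v ≠ 0) {W : Submodule ℝ (Fin d → ℝ)} (hW : W ≠ ⊤) :
    Generic ρ fun γ => (ρ γ).mulVec v ∉ W := by
  obtain ⟨f, hf, hWf⟩ := W.exists_le_ker_of_lt_top hW.lt_top
  have hfw : ∀ x, f x = (fun i => f (Pi.single i 1)) ⬝ᵥ x := fun x => by
    conv_lhs => rw [LinearMap.pi_apply_eq_sum_univ f x]
    refine Finset.sum_congr rfl fun i _ => ?_
    rw [smul_eq_mul, mul_comm]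
    congr 2
    ext j
    simp [Pi.single_apply, eq_comm]
  have hw : (fun i => f (Pi.single i 1)) ≠ 0 := fun h => hf (by
    ext x; simpa using congrFun h x)
  obtain ⟨g, hg, hA, h⟩ := generic_bilin (ρ := ρ) hw hv
  refine ⟨g, hg, hA, fun γ hγ hmem => h γ hγ ?_⟩
  rw [← hfw]
  exact hWf hmem

/-- A Zariski dense group contains elements which, together with their inverses, are nearly
of rank one. -/
theorem IsDenseRep.exists_contracting (hρ : IsDenseRep ρ) (hd : 2 ≤ d) :
    ∃ (h : ℕ → Γ) (r : ℕ → ℝ) (v : Fin d → ℝ) (w : Bool → Fin d → ℝ), v ≠ 0 ∧ (∀ ε, w ε ≠ 0) ∧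
      Tendsto r (hyperfilter ℕ : Filter ℕ) (𝓝 0) ∧
      ∀ ε, Tendsto (fun n => r n • ρ (bif ε then h n else (h n)⁻¹)) (hyperfilter ℕ : Filter ℕ)
        (𝓝 (Matrix.vecMulVec v (w ε))) := by
  have : Nonempty (Fin d) := ⟨⟨0, by omega⟩⟩
  obtain ⟨v, w, hv, hw, hvw⟩ := hρ.exists_rank_one hd
  have : FrechetUrysohnSpace (Matrix (Fin d) (Fin d) ℝ) :=
    inferInstanceAs (FrechetUrysohnSpace (Fin d → Fin d → ℝ))
  obtain ⟨x, hx, hlim⟩ := mem_closure_iff_seq_limit.1 hvw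
  choose t γ hxt using hx
  have hne : ∀ n, ρ (γ n)⁻¹ ≠ 0 := fun n h => by
    have := hρ.det_eq_one (γ n)⁻¹
    rw [h, Matrix.det_zero] at this
    exact zero_ne_one this
  obtain ⟨B, hB0, hB⟩ := (hyperfilter ℕ).exists_tendsto_normalize hne
  obtain ⟨y, hy⟩ : ∃ y, B.mulVec y ≠ 0 := by
    by_contra! h
    exact hB0 (Matrix.ext_of_mulVec_single fun i => by rw [h, Matrix.zero_mulVec])
  obtain ⟨z, hz1, hz2⟩ := hρ.exists_of_generic
    (hρ.generic_and (generic_bilin hw hy) (hρ.generic_bilin_inv hw hy))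
  have hlim' : Tendsto x (hyperfilter ℕ : Filter ℕ) (𝓝 (Matrix.vecMulVec v w)) :=
    hlim.mono_left Nat.hyperfilter_le_atTop
  set r : ℕ → ℝ := fun n => t n * ‖ρ (γ n)⁻¹‖⁻¹ with hr
  have hmain : ∀ z : Γ, Tendsto (fun n => r n • ρ (γ n * z * (γ n)⁻¹)) (hyperfilter ℕ : Filter ℕ)
      (𝓝 (Matrix.vecMulVec v (Matrix.vecMul w (ρ z * B)))) := by
    intro z
    have h1 := (hlim'.mul (tendsto_const_nhds (x := ρ z))).mul hB
    rw [Matrix.mul_assoc, Matrix.vecMulVec_mul] at h1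
    refine h1.congr fun n => ?_
    rw [hxt, map_mul, map_mul, Matrix.smul_mul, Matrix.smul_mul, Matrix.mul_smul, smul_smul]
  have hnz : ∀ z : Γ, w ⬝ᵥ (ρ z).mulVec (B.mulVec y) ≠ 0 → Matrix.vecMul w (ρ z * B) ≠ 0 := by
    intro z hz h0
    rw [Matrix.mulVec_mulVec, Matrix.dotProduct_mulVec, h0, zero_dotProduct] at hz
    exact hz rfl
  refine ⟨fun n => γ n * z * (γ n)⁻¹, r, v,
    fun ε => Matrix.vecMul w (ρ (bif ε then z else z⁻¹) * B), hv, ?_, ?_, ?_⟩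
  · rintro (_ | _)
    · exact hnz _ hz2
    · exact hnz _ hz1
  · have h1 := ((continuous_id.matrix_det).tendsto _).comp (hmain z)
    have h2 : (Matrix.vecMulVec v (Matrix.vecMul w (ρ z * B))).det = 0 := by
      have : Nontrivial (Fin d) := Fin.nontrivial_iff_two_le.2 hd
      exact Matrix.det_vecMulVec _ _
    simp only [id, h2] at h1
    have h3 : Tendsto (fun n => r n ^ d) (hyperfilter ℕ : Filter ℕ) (𝓝 0) := by
      refine h1.congr fun n => ?_
      simp only [Function.comp, Matrix.det_smul, Fintype.card_fin, hρ.det_eq_one, mul_one]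
    have hd0 : d ≠ 0 := by omega
    have h4 := h3.abs.rpow_const (p := (1 / d : ℝ)) (Or.inr (by positivity))
    rw [abs_zero, Real.zero_rpow (by positivity)] at h4
    refine tendsto_zero_iff_abs_tendsto_zero _ |>.2 (h4.congr fun n => ?_)
    rw [abs_pow, ← Real.rpow_natCast, ← Real.rpow_mul (abs_nonneg _), mul_one_div_cancel
      (by exact_mod_cast hd0), Real.rpow_one]
    rfl
  · rintro (_ | _)
    · refine (hmain z⁻¹).congr fun n => ?_
      simp [_root_.mul_inv_rev, mul_assoc]
    · exact hmain z

end LinDyn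

end

/-- A sequence can be built by choosing every term depending on the previous ones. -/
theorem exists_seq_image_range {α : Type*} [DecidableEq α] {Q : Finset α → α → Prop}
    (h : ∀ s, ∃ y, Q s y) : ∃ u : ℕ → α, ∀ n, Q ((Finset.range n).image u) (u n) := by
  choose f hf using h
  let S : ℕ → Finset α := fun n => Nat.rec ∅ (fun _ s => insert (f s) s) n
  have hS : ∀ n, S (n + 1) = insert (f (S n)) (S n) := fun n => rfl
  have hS' : ∀ n, S n = (Finset.range n).image fun i => f (S i) := by
    intro n
    induction n with
    | zero => rfl
    | succ n ih => rw [hS, Finset.range_add_one, Finset.image_insert, ← ih]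
  exact ⟨fun n => f (S n), fun n => by rw [← hS']; exact hf _⟩

namespace LinDyn

section Rigidity

open Module Submodule

variable {K V : Type*} [Field K] [AddCommGroup V] [Module K V]

/-- Every point lies outside of the proper subspaces spanned by the previous points. -/
def IsIndep (p : ℕ → V) : Prop :=
  ∀ n, ∀ t ⊆ Finset.range n, span K (p '' t) ≠ ⊤ → p n ∉ span K (p '' t)

theorem finrank_span_singleton_le_one (x : V) : finrank K (span K {x}) ≤ 1 := by
  simpa using finrank_span_le_card (R := K) ({x} : Set V)

theorem exists_smul_of_mem_span {x y z : V} (hx : x ≠ 0) (hxz : x ∈ span K {z})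
    (hy : y ∈ span K {z}) : ∃ c : K, y = c • x := by
  obtain ⟨a, rfl⟩ := mem_span_singleton.1 hxz
  obtain ⟨b, rfl⟩ := mem_span_singleton.1 hy
  have ha : a ≠ 0 := fun h => hx (by rw [h, zero_smul])
  exact ⟨b * a⁻¹, by rw [smul_smul, inv_mul_cancel_right₀ ha]⟩

variable [FiniteDimensional K V] {p : ℕ → V}

theorem IsIndep.card_le (hp : IsIndep (K := K) p) {W : Submodule K V} (hW : W ≠ ⊤) {t : Finset ℕ}
    (ht : ∀ i ∈ t, p i ∈ W) : t.card ≤ finrank K W := by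
  have hle : span K (p '' t) ≤ W := span_le.2 (by rintro _ ⟨i, hi, rfl⟩; exact ht i hi)
  refine le_trans ?_ (finrank_mono hle)
  have hne : span K (p '' t) ≠ ⊤ := fun h => hW (top_unique (h ▸ hle))
  clear hle ht hW
  induction t using Finset.induction_on_max with
  | empty => simp
  | insert a t hlt ih =>
    have hsub : span K (p '' t) ≤ span K (p '' (insert a t : Finset ℕ)) :=
      span_mono (Set.image_mono (by simp))
    have hne' : span K (p '' t) ≠ ⊤ := fun h => hne (top_unique (h ▸ hsub))
    rw [Finset.card_insert_of_notMem fun ha => (hlt a ha).false]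
    refine Nat.succ_le_of_lt ((ih hne').trans_lt (finrank_lt_finrank_of_lt
      (lt_of_le_of_ne hsub fun h => hp a t (fun x hx => Finset.mem_range.2 (hlt x hx)) hne' ?_)))
    rw [h]
    exact subset_span ⟨a, by simp, rfl⟩

theorem IsIndep.ne_zero [Nontrivial V] (hp : IsIndep (K := K) p) (i : ℕ) : p i ≠ 0 := by
  intro h
  have := hp.card_le (W := ⊥) bot_ne_top (t := {i}) (by simpa using h)
  simp at this

theorem span_singleton_ne_top (hd : 2 ≤ finrank K V) (x : V) : span K {x} ≠ ⊤ := fun h => by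
  have := finrank_span_singleton_le_one (K := K) x
  rw [h, finrank_top] at this
  omega

theorem IsIndep.eq_of_mem (hp : IsIndep (K := K) p) (hd : 2 ≤ finrank K V) {x : V} {i j : ℕ}
    (hi : p i ∈ span K {x}) (hj : p j ∈ span K {x}) : i = j := by
  by_contra hij
  have := (hp.card_le (span_singleton_ne_top hd x) (t := {i, j}) (by simp [hi, hj])).trans
    (finrank_span_singleton_le_one x)
  rw [Finset.card_pair hij] at this
  omega

/-- An endomorphism with more eigenlines in general position than the dimension is scalar. -/
theorem IsIndep.eq_smul_one (hp : IsIndep (K := K) p) {k : V →ₗ[K] V} {t : Finset ℕ}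
    (ht : finrank K V < t.card) (hk : ∀ i ∈ t, ∃ c : K, k (p i) = c • p i) :
    ∃ c : K, k = c • 1 := by
  classical
  rcases subsingleton_or_nontrivial V with hV | hV
  · exact ⟨1, LinearMap.ext fun x => Subsingleton.elim _ _⟩
  obtain ⟨a, ha⟩ := Finset.card_pos.1 (by omega : 0 < t.card)
  choose! l hl using hk
  refine ⟨l a, by_contra fun hne => ?_⟩
  set D := k - l a • (1 : V →ₗ[K] V) with hD
  have hDp : ∀ i ∈ t, D (p i) = (l i - l a) • p i := fun i hi => by
    simp [hD, hl i hi, sub_smul]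
  have h1 : LinearMap.ker D ≠ ⊤ := fun h => hne (sub_eq_zero.1 (LinearMap.ker_eq_top.1 h))
  have h2 : LinearMap.range D ≠ ⊤ := fun h => by
    have h0 := LinearMap.ker_eq_bot_iff_range_eq_top.2 h
    refine hp.ne_zero (K := K) a (LinearMap.ker_eq_bot'.1 h0 _ ?_)
    rw [hDp a ha, sub_self, zero_smul]
  have c1 := hp.card_le h1 (t := t.filter fun i => l i = l a) (by
    intro i hi
    rw [Finset.mem_filter] at hi
    rw [LinearMap.mem_ker, hDp i hi.1, hi.2, sub_self, zero_smul])
  have c2 := hp.card_le h2 (t := t.filter fun i => ¬ l i = l a) (by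
    intro i hi
    rw [Finset.mem_filter] at hi
    refine ⟨(l i - l a)⁻¹ • p i, ?_⟩
    rw [map_smul, hDp i hi.1, smul_smul, inv_mul_cancel₀ (sub_ne_zero.2 hi.2), one_smul])
  have c3 := t.card_filter_add_card_filter_not (fun i => l i = l a)
  have c4 := LinearMap.finrank_range_add_finrank_ker D
  omega

variable {α : Type*} (K)

/-- The linear map `h` sends the lines through the first points of the pairs to the lines through
the second points. -/
def MapsLines (pt : α → V) (T : Finset (α × α)) (h : V →ₗ[K] V) : Prop :=
  Function.Injective h ∧ ∀ ab ∈ T, h (pt ab.1) ∈ span K {pt ab.2}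

open Classical in
/-- A linear map which realizes a prescribed map of lines, if there is one. -/
noncomputable def selLines (pt : α → V) (T : Finset (α × α)) : V →ₗ[K] V :=
  if h : ∃ h, MapsLines K pt T h then h.choose else 1

variable {K}

theorem MapsLines.selLines {pt : α → V} {T : Finset (α × α)} {h : V →ₗ[K] V}
    (hh : MapsLines K pt T h) : MapsLines K pt T (selLines K pt T) := by
  rw [LinDyn.selLines, dif_pos ⟨h, hh⟩]
  exact Exists.choose_spec (p := MapsLines K pt T) _

theorem selLines_injective (pt : α → V) (T : Finset (α × α)) :
    Function.Injective (selLines K pt T) := by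
  by_cases h : ∃ h, MapsLines K pt T h
  · exact h.choose_spec.selLines.1
  · rw [selLines, dif_neg h]
    exact Function.injective_id

variable (K) in
/-- The position of the line through `pt y` is generic with respect to the lines through the
points of `s`. -/
structure IsGenericPoint (pt : α → V) (s : Finset α) (y : α) : Prop where
  notMem_span : ∀ t ⊆ s, span K (pt '' t) ≠ ⊤ → pt y ∉ span K (pt '' t)
  eigen : ∀ T ⊆ s ×ˢ s, (¬ ∃ c : K, selLines K pt T = c • 1) →
    ∀ c : K, selLines K pt T (pt y) ≠ c • pt y
  map_notMem : ∀ T ⊆ s ×ˢ s, ∀ x ∈ s, selLines K pt T (pt y) ∉ span K {pt x}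

variable {pt : α → V} {u : ℕ → α} [DecidableEq α]

theorem isIndep_of_isGenericPoint
    (hu : ∀ n, IsGenericPoint K pt ((Finset.range n).image u) (u n)) :
    IsIndep (K := K) fun n => pt (u n) := by
  intro n t ht hne
  have := (hu n).notMem_span (t.image u) (Finset.image_subset_image ht)
  rw [Finset.coe_image, Set.image_image] at this
  exact this hne

/-- An injective linear map which permutes sufficiently many lines in general position is
scalar. -/
theorem eq_smul_one_of_permutes (hd : 2 ≤ finrank K V)
    (hu : ∀ n, IsGenericPoint K pt ((Finset.range n).image u) (u n)) {N : ℕ}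
    (hN : finrank K V + 3 ≤ N) {h : V →ₗ[K] V} (hinj : Function.Injective h)
    (hh : ∀ i < N, ∃ j < N, h (pt (u i)) ∈ span K {pt (u j)}) : ∃ c : K, h = c • 1 := by
  classical
  have hV : Nontrivial V := Module.nontrivial_of_finrank_pos (R := K) (by omega)
  have hp := isIndep_of_isGenericPoint hu
  choose! b hbN hb using hh
  have hne : ∀ {g : V →ₗ[K] V}, Function.Injective g → ∀ i, g (pt (u i)) ≠ 0 := fun hg i h0 =>
    hp.ne_zero (K := K) i (hg (by rw [h0, map_zero]))
  have hbinj : ∀ i < N, ∀ j < N, b i = b j → i = j := by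
    intro i hi j hj hij
    obtain ⟨c, hc⟩ := exists_smul_of_mem_span (hne hinj i) (hb i hi) (hij ▸ hb j hj)
    rw [← map_smul] at hc
    exact hp.eq_of_mem hd (mem_span_singleton_self (R := K) (pt (u i)))
      (mem_span_singleton.2 ⟨c, (hinj hc).symm⟩)
  obtain ⟨e, rfl⟩ : ∃ e, N = e + 1 := ⟨N - 1, by omega⟩
  set A := (Finset.range e).filter fun i => b i < e with hA
  have hAc : finrank K V < A.card := by
    have h1 := (Finset.range e).card_filter_add_card_filter_not (fun i => b i < e)
    have h2 : ((Finset.range e).filter fun i => ¬ b i < e).card ≤ 1 := by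
      refine Finset.card_le_one.2 fun i hi j hj => ?_
      rw [Finset.mem_filter, Finset.mem_range] at hi hj
      have := hbN i (by omega)
      have := hbN j (by omega)
      exact hbinj i (by omega) j (by omega) (by omega)
    rw [Finset.card_range] at h1
    change A.card + _ = _ at h1
    omega
  set T : Finset (α × α) := A.image fun i => (u i, u (b i)) with hT
  have hTs : T ⊆ (Finset.range e).image u ×ˢ (Finset.range e).image u := by
    intro x hx
    obtain ⟨i, hi, rfl⟩ := Finset.mem_image.1 hx
    rw [hA, Finset.mem_filter] at hi
    exact Finset.mem_product.2 ⟨Finset.mem_image_of_mem _ hi.1,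
      Finset.mem_image_of_mem _ (Finset.mem_range.2 hi.2)⟩
  have hml : MapsLines K pt T h := ⟨hinj, fun x hx => by
    obtain ⟨i, hi, rfl⟩ := Finset.mem_image.1 hx
    rw [hA, Finset.mem_filter, Finset.mem_range] at hi
    exact hb i (by omega)⟩
  have hsel := hml.selLines
  obtain ⟨g, hg⟩ : ∃ g : V →ₗ[K] V, ∀ x, g (h x) = x := by
    obtain ⟨g, hg⟩ := h.exists_leftInverse_of_injective (LinearMap.ker_eq_bot.2 hinj)
    exact ⟨g, fun x => by simpa using LinearMap.congr_fun hg x⟩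
  have hg' : ∀ x, h (g x) = x := fun x => by
    obtain ⟨y, rfl⟩ := (LinearMap.injective_iff_surjective.1 hinj) x
    rw [hg]
  obtain ⟨c, hc⟩ := hp.eq_smul_one (K := K) hAc (k := g.comp (selLines K pt T)) (by
    intro i hi
    have hi' := hi
    rw [hA, Finset.mem_filter, Finset.mem_range] at hi'
    obtain ⟨c, hc⟩ := exists_smul_of_mem_span (hne hinj i) (hb i (by omega))
      (hsel.2 (u i, u (b i)) (Finset.mem_image_of_mem (fun i => (u i, u (b i))) hi))
    refine ⟨c, ?_⟩
    dsimp only at hc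
    rw [LinearMap.comp_apply, hc, map_smul, hg])
  have hc' : ∀ x, selLines K pt T x = c • h x := fun x => by
    have := congrArg h (LinearMap.congr_fun hc x)
    rw [LinearMap.comp_apply, hg'] at this
    rw [this]
    simp
  have hc0 : c ≠ 0 := by
    rintro rfl
    exact hne hsel.1 e (by rw [hc', zero_smul])
  rcases Nat.lt_succ_iff_lt_or_eq.1 (hbN e (by omega)) with hlt | heq
  · refine absurd ?_ ((hu e).map_notMem T hTs (u (b e)) (Finset.mem_image_of_mem _
      (Finset.mem_range.2 hlt)))
    rw [hc']
    exact smul_mem _ _ (hb e (by omega))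
  · have := hb e (by omega)
    rw [heq] at this
    obtain ⟨a, ha⟩ := mem_span_singleton.1 this
    obtain ⟨c', hs⟩ : ∃ c' : K, selLines K pt T = c' • 1 := by
      by_contra hcon
      exact (hu e).eigen T hTs hcon (c * a) (by rw [hc', ← ha, smul_smul])
    refine ⟨c⁻¹ * c', LinearMap.ext fun x => ?_⟩
    have := hc' x
    rw [hs] at this
    rw [← inv_smul_smul₀ hc0 (h x), ← this]
    simp [smul_smul]

end Rigidity

end LinDyn

namespace LinDyn

variable {d : ℕ} {Γ : Type*} [Group Γ] {ρ : Γ →* Matrix (Fin d) (Fin d) ℝ}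

theorem Generic.mono {P P' : Γ → Prop} (hP : Generic ρ P) (h : ∀ γ, P γ → P' γ) : Generic ρ P' :=
  let ⟨f, hf, hA, hi⟩ := hP
  ⟨f, hf, hA, fun γ hγ => h γ (hi γ hγ)⟩

theorem IsDenseRep.generic_forall_mem (hρ : IsDenseRep ρ) {ι : Type*} {s : Set ι} (hs : s.Finite)
    {P : ι → Γ → Prop} (hP : ∀ i ∈ s, Generic ρ (P i)) : Generic ρ fun γ => ∀ i ∈ s, P i γ := by
  have := hs.to_subtype
  exact (hρ.generic_forall (ι := s) fun i => hP i i.2).mono fun γ h i hi => h ⟨i, hi⟩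

theorem inv_mulVec_mulVec (γ : Γ) (x : Fin d → ℝ) : (ρ γ⁻¹).mulVec ((ρ γ).mulVec x) = x := by
  rw [Matrix.mulVec_mulVec, ← map_mul, inv_mul_cancel, map_one, Matrix.one_mulVec]

theorem mulVec_ne_zero (γ : Γ) {x : Fin d → ℝ} (hx : x ≠ 0) : (ρ γ).mulVec x ≠ 0 := fun h =>
  hx (by rw [← inv_mulVec_mulVec (ρ := ρ) γ x, h, Matrix.mulVec_zero])

open Classical in
theorem IsDenseRep.exists_points (hρ : IsDenseRep ρ) (hd : 2 ≤ d) {v : Fin d → ℝ} (hv : v ≠ 0)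
    {w : Bool → Fin d → ℝ} (hw : ∀ ε, w ε ≠ 0) : ∃ u : ℕ → Γ,
      (∀ n, IsGenericPoint ℝ (fun γ => (ρ γ).mulVec v) ((Finset.range n).image u) (u n)) ∧
      ∀ i j, i ≠ j → ∀ ε, w ε ⬝ᵥ (ρ ((u i)⁻¹ * u j)).mulVec v ≠ 0 := by
  have hfr : Module.finrank ℝ (Fin d → ℝ) = d := Module.finrank_fin_fun ℝ
  obtain ⟨u, hu⟩ := exists_seq_image_range (α := Γ) (Q := fun s y =>
    IsGenericPoint ℝ (fun γ => (ρ γ).mulVec v) s y ∧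
      ∀ x ∈ s, ∀ ε, w ε ⬝ᵥ (ρ (x⁻¹ * y)).mulVec v ≠ 0 ∧ w ε ⬝ᵥ (ρ (y⁻¹ * x)).mulVec v ≠ 0) (by
    intro s
    have h1 : Generic ρ fun y => ∀ t ∈ (s.powerset : Set (Finset Γ)),
        Submodule.span ℝ ((fun γ => (ρ γ).mulVec v) '' t) ≠ ⊤ →
          (ρ y).mulVec v ∉ Submodule.span ℝ ((fun γ => (ρ γ).mulVec v) '' t) :=
      hρ.generic_forall_mem (Finset.finite_toSet _) fun t _ => generic_of_imp fun h =>
        generic_notMem hv h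
    have h2 : Generic ρ fun y => ∀ T ∈ ((s ×ˢ s).powerset : Set (Finset (Γ × Γ))),
        (¬ ∃ c : ℝ, selLines ℝ (fun γ => (ρ γ).mulVec v) T = c • 1) →
        ∀ c : ℝ, selLines ℝ (fun γ => (ρ γ).mulVec v) T ((ρ y).mulVec v) ≠ c • (ρ y).mulVec v := by
      refine hρ.generic_forall_mem (Finset.finite_toSet _) fun T _ => generic_of_imp fun h => ?_
      refine (hρ.generic_forall_mem (Module.End.finite_hasEigenvalue
        (selLines ℝ (fun γ => (ρ γ).mulVec v) T)) fun c _ => generic_notMem hv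
          (W := Module.End.eigenspace (selLines ℝ (fun γ => (ρ γ).mulVec v) T) c) ?_).mono ?_
      · intro htop
        refine h ⟨c, LinearMap.ext fun x => ?_⟩
        have : x ∈ Module.End.eigenspace (selLines ℝ (fun γ => (ρ γ).mulVec v) T) c :=
          htop ▸ Submodule.mem_top
        exact Module.End.mem_eigenspace_iff.1 this
      · intro γ hγ c hc
        have hmem := Module.End.mem_eigenspace_iff.2 hc
        exact hγ c (Module.End.hasEigenvalue_of_hasEigenvector ⟨hmem, mulVec_ne_zero γ hv⟩) hmem
    have h3 : Generic ρ fun y => ∀ T ∈ ((s ×ˢ s).powerset : Set (Finset (Γ × Γ))),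
        ∀ x ∈ (s : Set Γ), selLines ℝ (fun γ => (ρ γ).mulVec v) T ((ρ y).mulVec v) ∉
          Submodule.span ℝ {(ρ x).mulVec v} := by
      refine hρ.generic_forall_mem (Finset.finite_toSet _) fun T _ =>
        hρ.generic_forall_mem (Finset.finite_toSet _) fun x _ => ?_
      refine generic_notMem hv (W := (Submodule.span ℝ {(ρ x).mulVec v}).comap
        (selLines ℝ (fun γ => (ρ γ).mulVec v) T)) fun htop => ?_
      refine span_singleton_ne_top (K := ℝ) (by rw [hfr]; exact hd) ((ρ x).mulVec v)
        (top_unique fun y _ => ?_)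
      obtain ⟨z, rfl⟩ := LinearMap.injective_iff_surjective.1
        (selLines_injective (K := ℝ) (fun γ => (ρ γ).mulVec v) T) y
      have : z ∈ (Submodule.span ℝ {(ρ x).mulVec v}).comap
        (selLines ℝ (fun γ => (ρ γ).mulVec v) T) := htop ▸ Submodule.mem_top
      exact this
    have h4 : Generic ρ fun y => ∀ x ∈ (s : Set Γ), ∀ ε,
        w ε ⬝ᵥ (ρ (x⁻¹ * y)).mulVec v ≠ 0 ∧ w ε ⬝ᵥ (ρ (y⁻¹ * x)).mulVec v ≠ 0 := by
      refine hρ.generic_forall_mem (Finset.finite_toSet _) fun x _ =>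
        hρ.generic_forall fun ε => hρ.generic_and ?_ ?_
      · refine (generic_bilin (w := Matrix.vecMul (w ε) (ρ x⁻¹)) (fun h => hw ε ?_) hv).mono
          fun y hy => ?_
        · have := congrArg (fun z => Matrix.vecMul z (ρ x)) h
          simpa [Matrix.vecMul_vecMul, ← map_mul] using this
        · rwa [map_mul, ← Matrix.mulVec_mulVec, Matrix.dotProduct_mulVec]
      · refine (hρ.generic_bilin_inv (hw ε) (mulVec_ne_zero (ρ := ρ) x hv)).mono fun y hy => ?_
        rwa [map_mul, ← Matrix.mulVec_mulVec]
    obtain ⟨y, ⟨⟨hy1, hy2⟩, hy3⟩, hy4⟩ := hρ.exists_of_generic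
      (hρ.generic_and (hρ.generic_and (hρ.generic_and h1 h2) h3) h4)
    exact ⟨y, ⟨fun t ht => hy1 t (by simpa using ht),
      fun T hT => hy2 T (Finset.mem_coe.2 (Finset.mem_powerset.2 hT)),
      fun T hT x hx => hy3 T (Finset.mem_coe.2 (Finset.mem_powerset.2 hT)) x hx⟩,
      fun x hx => hy4 x hx⟩)
  refine ⟨u, fun n => (hu n).1, fun i j hij ε => ?_⟩
  rcases lt_or_gt_of_ne hij with h | h
  · exact ((hu j).2 (u i) (Finset.mem_image_of_mem _ (Finset.mem_range.2 h)) ε).1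
  · exact ((hu i).2 (u j) (Finset.mem_image_of_mem _ (Finset.mem_range.2 h)) ε).2

end LinDyn

namespace LinDyn

open scoped Matrix.Norms.Elementwise

variable {d : ℕ}

/-- The exterior product of two vectors, as an antisymmetric matrix. -/
def wedge (x y : Fin d → ℝ) : Matrix (Fin d) (Fin d) ℝ :=
  Matrix.vecMulVec x y - Matrix.vecMulVec y x

theorem wedge_apply (x y : Fin d → ℝ) (i j : Fin d) : wedge x y i j = x i * y j - y i * x j := rfl

theorem wedge_self (x : Fin d → ℝ) : wedge x x = 0 := sub_self _

theorem wedge_smul (t : ℝ) (x y : Fin d → ℝ) : wedge (t • x) y = t • wedge x y := by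
  ext i j
  simp only [wedge_apply, Pi.smul_apply, Matrix.smul_apply, smul_eq_mul]
  ring

theorem wedge_add (x x' y : Fin d → ℝ) : wedge (x + x') y = wedge x y + wedge x' y := by
  ext i j
  simp only [wedge_apply, Pi.add_apply, Matrix.add_apply]
  ring

theorem wedge_transpose (x y : Fin d → ℝ) : (wedge x y).transpose = -wedge x y := by
  ext i j
  simp only [wedge_apply, Matrix.transpose_apply, Matrix.neg_apply]
  ring

theorem wedge_mulVec (A : Matrix (Fin d) (Fin d) ℝ) (x y : Fin d → ℝ) :
    wedge (A.mulVec x) (A.mulVec y) = A * wedge x y * A.transpose := by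
  rw [wedge, wedge, Matrix.mul_sub, Matrix.sub_mul, Matrix.mul_vecMulVec, Matrix.mul_vecMulVec,
    Matrix.vecMulVec_mul, Matrix.vecMulVec_mul, Matrix.vecMul_transpose, Matrix.vecMul_transpose]

theorem continuous_wedge : Continuous fun z : (Fin d → ℝ) × (Fin d → ℝ) => wedge z.1 z.2 :=
  (continuous_fst.matrix_vecMulVec continuous_snd).sub
    (continuous_snd.matrix_vecMulVec continuous_fst)

theorem exists_smul_of_wedge_eq_zero {x p : Fin d → ℝ} (hp : p ≠ 0) (h : wedge x p = 0) :
    ∃ t : ℝ, x = t • p := by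
  obtain ⟨j, hj⟩ := Function.ne_iff.1 hp
  refine ⟨x j / p j, funext fun i => ?_⟩
  have := congrFun (congrFun h i) j
  rw [wedge_apply, Matrix.zero_apply] at this
  rw [Pi.smul_apply, smul_eq_mul, div_mul_eq_mul_div, eq_div_iff hj]
  linarith

theorem norm_mulVec_le (A : Matrix (Fin d) (Fin d) ℝ) (x : Fin d → ℝ) :
    ‖A.mulVec x‖ ≤ d * ‖A‖ * ‖x‖ := by
  refine (pi_norm_le_iff_of_nonneg (by positivity)).2 fun i => ?_
  calc ‖∑ j, A i j * x j‖ ≤ ∑ j, ‖A i j * x j‖ := norm_sum_le _ _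
    _ ≤ ∑ _j : Fin d, ‖A‖ * ‖x‖ := Finset.sum_le_sum fun j _ => by
        rw [norm_mul]
        exact mul_le_mul (A.norm_entry_le_entrywise_sup_norm) (norm_le_pi_norm x j)
          (norm_nonneg _) (norm_nonneg _)
    _ = d * ‖A‖ * ‖x‖ := by simp [mul_assoc]

theorem norm_wedge_le (x y : Fin d → ℝ) : ‖wedge x y‖ ≤ 2 * ‖x‖ * ‖y‖ := by
  refine (Matrix.norm_le_iff (by positivity)).2 fun i j => ?_
  have h1 := mul_le_mul (norm_le_pi_norm x i) (norm_le_pi_norm y j) (norm_nonneg _) (norm_nonneg _)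
  have h2 := mul_le_mul (norm_le_pi_norm y i) (norm_le_pi_norm x j) (norm_nonneg _) (norm_nonneg _)
  have h3 := norm_sub_le (x i * y j) (y i * x j)
  rw [norm_mul, norm_mul] at h3
  rw [wedge_apply]
  linarith

/-- The vectors which are nearly parallel to `p`. -/
def nearLine (δ : ℝ) (p : Fin d → ℝ) : Set (Fin d → ℝ) := {x | ‖wedge x p‖ ≤ δ * ‖x‖}

theorem smul_mem_nearLine {δ : ℝ} {p x : Fin d → ℝ} (hx : x ∈ nearLine δ p) (t : ℝ) :
    t • x ∈ nearLine δ p := by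
  rw [nearLine, Set.mem_ofPred_eq, wedge_smul, norm_smul, norm_smul, mul_left_comm]
  exact mul_le_mul_of_nonneg_left hx (norm_nonneg _)

theorem self_mem_nearLine {δ : ℝ} (hδ : 0 ≤ δ) (p : Fin d → ℝ) : p ∈ nearLine δ p := by
  rw [nearLine, Set.mem_ofPred_eq, wedge_self, norm_zero]
  positivity

theorem isClosed_nearLine (δ : ℝ) (p : Fin d → ℝ) : IsClosed (nearLine δ p) :=
  isClosed_le (continuous_wedge.comp (continuous_id.prodMk continuous_const)).norm
    (continuous_const.mul continuous_norm)

/-- Vectors which are nearly parallel to `p` are not nearly orthogonal to `w`. -/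
theorem exists_nearLine_lower {w p : Fin d → ℝ} (hwp : w ⬝ᵥ p ≠ 0) :
    ∃ κ > 0, ∀ x ∈ nearLine κ p, κ * ‖x‖ ≤ |w ⬝ᵥ x| := by
  have hp : p ≠ 0 := by rintro rfl; simp at hwp
  have hc : Continuous fun x : Fin d → ℝ => |w ⬝ᵥ x| + ‖wedge x p‖ :=
    (continuous_const.dotProduct continuous_id).abs.add
      (continuous_wedge.comp (continuous_id.prodMk continuous_const)).norm
  have hne : (Metric.sphere (0 : Fin d → ℝ) 1).Nonempty := ⟨‖p‖⁻¹ • p, by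
    rw [mem_sphere_zero_iff_norm, norm_smul, norm_inv, norm_norm,
      inv_mul_cancel₀ (norm_ne_zero_iff.2 hp)]⟩
  obtain ⟨x₀, hx₀, hmin⟩ := (isCompact_sphere (0 : Fin d → ℝ) 1).exists_isMinOn hne hc.continuousOn
  have hpos : 0 < |w ⬝ᵥ x₀| + ‖wedge x₀ p‖ := by
    by_contra! h
    have h1 : ‖wedge x₀ p‖ = 0 := by linarith [norm_nonneg (wedge x₀ p), abs_nonneg (w ⬝ᵥ x₀)]
    have h2 : |w ⬝ᵥ x₀| = 0 := by linarith [norm_nonneg (wedge x₀ p), abs_nonneg (w ⬝ᵥ x₀)]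
    obtain ⟨t, rfl⟩ := exists_smul_of_wedge_eq_zero hp (norm_eq_zero.1 h1)
    rw [dotProduct_smul, abs_eq_zero, smul_eq_mul, mul_eq_zero, or_iff_left hwp] at h2
    rw [h2, zero_smul] at hx₀
    simp at hx₀
  refine ⟨(|w ⬝ᵥ x₀| + ‖wedge x₀ p‖) / 2, by positivity, fun x hx => ?_⟩
  set κ := |w ⬝ᵥ x₀| + ‖wedge x₀ p‖
  rcases eq_or_ne x 0 with rfl | hx0
  · simp
  have h1 := hmin (show ‖x‖⁻¹ • x ∈ Metric.sphere (0 : Fin d → ℝ) 1 by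
    rw [mem_sphere_zero_iff_norm, norm_smul, norm_inv, norm_norm,
      inv_mul_cancel₀ (norm_ne_zero_iff.2 hx0)])
  simp only [Set.mem_ofPred_eq] at h1
  change κ ≤ _ at h1
  rw [dotProduct_smul, wedge_smul, norm_smul, smul_eq_mul, abs_mul, norm_inv, norm_norm, abs_inv,
    abs_norm, ← mul_add, inv_mul_eq_div, le_div_iff₀ (norm_pos_iff.2 hx0)] at h1
  have h2 : ‖wedge x p‖ ≤ κ / 2 * ‖x‖ := hx
  linarith

/-- The action of a matrix on antisymmetric matrices is controlled by the minors of size two. -/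
theorem norm_mul_mul_transpose_le (A W : Matrix (Fin d) (Fin d) ℝ) (hW : W.transpose = -W) :
    ‖A * W * A.transpose‖ ≤
      (∑ i, ∑ j, ∑ k, ∑ l, |A i k * A j l - A i l * A j k|) * ‖W‖ := by
  refine (Matrix.norm_le_iff (by positivity)).2 fun i j => ?_
  have h1 : (A * W * A.transpose) i j = ∑ k, ∑ l, A i k * A j l * W k l := by
    simp only [Matrix.mul_apply, Matrix.transpose_apply, Finset.sum_mul]
    rw [Finset.sum_comm]
    exact Finset.sum_congr rfl fun k _ => Finset.sum_congr rfl fun l _ => by ring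
  have h2 : (A * W * A.transpose) i j = -∑ k, ∑ l, A i l * A j k * W k l := by
    rw [h1, Finset.sum_comm, ← Finset.sum_neg_distrib]
    refine Finset.sum_congr rfl fun l _ => ?_
    rw [← Finset.sum_neg_distrib]
    refine Finset.sum_congr rfl fun k _ => ?_
    have := congrFun (congrFun hW l) k
    rw [Matrix.transpose_apply, Matrix.neg_apply] at this
    rw [this]; ring
  have h3 : 2 * (A * W * A.transpose) i j =
      ∑ k, ∑ l, (A i k * A j l - A i l * A j k) * W k l := by
    rw [two_mul]
    nth_rewrite 1 [h1]
    rw [h2, ← sub_eq_add_neg, ← Finset.sum_sub_distrib]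
    refine Finset.sum_congr rfl fun k _ => ?_
    rw [← Finset.sum_sub_distrib]
    exact Finset.sum_congr rfl fun l _ => by ring
  have h4 : ‖∑ k, ∑ l, (A i k * A j l - A i l * A j k) * W k l‖ ≤
      ∑ k, ∑ l, |A i k * A j l - A i l * A j k| * ‖W‖ := by
    refine (norm_sum_le _ _).trans (Finset.sum_le_sum fun k _ => (norm_sum_le _ _).trans
      (Finset.sum_le_sum fun l _ => ?_))
    rw [norm_mul, Real.norm_eq_abs]
    exact mul_le_mul_of_nonneg_left W.norm_entry_le_entrywise_sup_norm (abs_nonneg _)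
  rw [← h3, norm_mul, Real.norm_eq_abs, abs_two] at h4
  simp only [← Finset.sum_mul] at h4
  have h5 : (∑ k, ∑ l, |A i k * A j l - A i l * A j k|) ≤
      ∑ i, ∑ j, ∑ k, ∑ l, |A i k * A j l - A i l * A j k| :=
    (Finset.single_le_sum (f := fun j => ∑ k, ∑ l, |A i k * A j l - A i l * A j k|)
      (fun j _ => by positivity) (Finset.mem_univ j)).trans
    (Finset.single_le_sum (f := fun i => ∑ j, ∑ k, ∑ l, |A i k * A j l - A i l * A j k|)
      (fun j _ => by positivity) (Finset.mem_univ i))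
  have h6 := mul_le_mul_of_nonneg_right h5 (norm_nonneg W)
  linarith [norm_nonneg ((A * W * A.transpose) i j)]

theorem tendsto_minors {ι : Type*} {l : Filter ι} {A : ι → Matrix (Fin d) (Fin d) ℝ}
    {p w : Fin d → ℝ} (hA : Tendsto A l (𝓝 (Matrix.vecMulVec p w))) :
    Tendsto (fun n => ∑ i, ∑ j, ∑ k, ∑ l, |A n i k * A n j l - A n i l * A n j k|) l (𝓝 0) := by
  have he : ∀ i j, Tendsto (fun n => A n i j) l (𝓝 (p i * w j)) := fun i j =>
    ((continuous_id.matrix_elem i j).tendsto _).comp hA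
  have h : (0 : ℝ) = ∑ i : Fin d, ∑ j, ∑ k, ∑ l,
      |p i * w k * (p j * w l) - p i * w l * (p j * w k)| := by
    symm
    refine Finset.sum_eq_zero fun i _ => Finset.sum_eq_zero fun j _ => Finset.sum_eq_zero
      fun k _ => Finset.sum_eq_zero fun l _ => ?_
    rw [abs_eq_zero]; ring
  rw [h]
  exact tendsto_finsetSum _ fun i _ => tendsto_finsetSum _ fun j _ => tendsto_finsetSum _
    fun k _ => tendsto_finsetSum _ fun l _ =>
      (((he i k).mul (he j l)).sub ((he i l).mul (he j k))).abs

end LinDyn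

namespace LinDyn

open scoped Matrix.Norms.Elementwise
open FreeGroup (mk hd bar)

variable {d : ℕ} {Γ : Type*} [Group Γ] {ρ : Γ →* Matrix (Fin d) (Fin d) ℝ} {κ δ r : ℝ}

theorem nearLine_mono {δ' : ℝ} (h : δ ≤ δ') (p : Fin d → ℝ) : nearLine δ p ⊆ nearLine δ' p :=
  fun x (hx : _ ≤ _) => hx.trans (mul_le_mul_of_nonneg_right h (norm_nonneg x))

theorem eventually_maps_nearLine {ι : Type*} {l : Filter ι} {M : ι → Matrix (Fin d) (Fin d) ℝ}
    {p w q : Fin d → ℝ} (hM : Tendsto M l (𝓝 (Matrix.vecMulVec p w))) (hp : p ≠ 0) (hκ : 0 < κ)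
    (hδ : 0 < δ) (hw : ∀ x ∈ nearLine κ q, κ * ‖x‖ ≤ |w ⬝ᵥ x|) :
    ∀ᶠ n in l, ∀ x ∈ nearLine κ q, (M n).mulVec x ∈ nearLine δ p ∧
      κ * ‖p‖ / 2 * ‖x‖ ≤ ‖(M n).mulVec x‖ := by
  have hp0 := norm_pos_iff.2 hp
  have h0 : Tendsto (fun n => d * ‖M n - Matrix.vecMulVec p w‖) l (𝓝 0) := by
    have := (hM.sub_const (Matrix.vecMulVec p w)).norm.const_mul (d : ℝ)
    rwa [sub_self, norm_zero, mul_zero] at this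
  filter_upwards [h0.eventually_lt_const (show 0 < κ * ‖p‖ / 2 by positivity),
    h0.eventually_lt_const (show 0 < δ * κ / 4 by positivity)] with n h1 h2 x hx
  set D := M n - Matrix.vecMulVec p w with hD
  have hx1 : (M n).mulVec x = (w ⬝ᵥ x) • p + D.mulVec x := by
    rw [hD, Matrix.sub_mulVec, Matrix.vecMulVec_mulVec]
    simp
  have hx2 := norm_mulVec_le D x
  have hx3 := mul_le_mul_of_nonneg_right (hw x hx) hp0.le
  have hx4 : |w ⬝ᵥ x| * ‖p‖ ≤ ‖(M n).mulVec x‖ + ‖D.mulVec x‖ := by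
    rw [← Real.norm_eq_abs, ← norm_smul, eq_sub_of_add_eq hx1.symm]
    exact norm_sub_le _ _
  have hx5 : d * ‖D‖ * ‖x‖ ≤ κ * ‖p‖ / 2 * ‖x‖ := mul_le_mul_of_nonneg_right h1.le (norm_nonneg _)
  have hlow : κ * ‖p‖ / 2 * ‖x‖ ≤ ‖(M n).mulVec x‖ := by linarith
  refine ⟨?_, hlow⟩
  have hw1 : wedge ((M n).mulVec x) p = wedge (D.mulVec x) p := by
    rw [hx1, wedge_add, wedge_smul, wedge_self, smul_zero, zero_add]
  show ‖wedge _ _‖ ≤ _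
  rw [hw1]
  calc ‖wedge (D.mulVec x) p‖ ≤ 2 * ‖D.mulVec x‖ * ‖p‖ := norm_wedge_le _ _
    _ ≤ 2 * (δ * κ / 4 * ‖x‖) * ‖p‖ := by
        have := hx2.trans (mul_le_mul_of_nonneg_right h2.le (norm_nonneg x))
        gcongr
    _ = δ * (κ * ‖p‖ / 2 * ‖x‖) := by ring
    _ ≤ δ * ‖(M n).mulVec x‖ := by gcongr

/-- A system of matrices which plays ping-pong on the lines through the points `p a`. -/
structure IsPingPong {L : Type*} (ρ : Γ →* Matrix (Fin d) (Fin d) ℝ) (p : L × Bool → Fin d → ℝ)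
    (c : L × Bool → Γ) (r δ κ : ℝ) : Prop where
  κ_pos : 0 < κ
  δ_pos : 0 < δ
  bar : ∀ a, c (bar a) = (c a)⁻¹
  maps : ∀ a b, b ≠ FreeGroup.bar a → ∀ x ∈ nearLine δ (p b),
    (r • ρ (c a)).mulVec x ∈ nearLine δ (p a) ∧ κ * ‖x‖ ≤ ‖(r • ρ (c a)).mulVec x‖
  contr : ∀ a (W : Matrix (Fin d) (Fin d) ℝ), W.transpose = -W →
    ‖(r • ρ (c a)) * W * (r • ρ (c a)).transpose‖ ≤ κ ^ 2 / 2 * ‖W‖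
  notMem : ∀ a b, a ≠ b → p b ∉ nearLine δ (p a)
  ne_zero : ∀ a, p a ≠ 0
  eq_zero : ∀ e (M : Matrix (Fin d) (Fin d) ℝ), (∀ b ≠ e, M.mulVec (p b) = 0) → M = 0

theorem exists_pos_forall_le {ι : Type*} [Finite ι] {P : ι → ℝ → Prop}
    (h : ∀ i, ∃ x > 0, P i x) (hP : ∀ i x y, 0 < x → x ≤ y → P i y → P i x) :
    ∃ x > 0, ∀ i, P i x := by
  choose f hf hfP using h
  cases nonempty_fintype ι
  rcases isEmpty_or_nonempty ι with hι | hι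
  · exact ⟨1, one_pos, fun i => isEmptyElim i⟩
  · obtain ⟨i, hi⟩ := Finite.exists_min f
    exact ⟨f i, hf i, fun j => hP j _ _ (hf i) (hi j) (hfP j)⟩

theorem exists_eventually_isPingPong {L : Type*} [Finite L] {U : Filter ℕ} {c : ℕ → L × Bool → Γ}
    {r : ℕ → ℝ} {p w : L × Bool → Fin d → ℝ} (hp : ∀ a, p a ≠ 0)
    (hbar : ∀ n a, c n (bar a) = (c n a)⁻¹)
    (hlim : ∀ a, Tendsto (fun n => r n • ρ (c n a)) U (𝓝 (Matrix.vecMulVec (p a) (w a))))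
    (hwp : ∀ a b, b ≠ bar a → w a ⬝ᵥ p b ≠ 0) (hpp : ∀ a b, a ≠ b → wedge (p b) (p a) ≠ 0)
    (hM : ∀ e (M : Matrix (Fin d) (Fin d) ℝ), (∀ b ≠ e, M.mulVec (p b) = 0) → M = 0) :
    ∃ κ > 0, ∃ δ₀ > 0, ∀ δ > 0, δ ≤ δ₀ → ∀ᶠ n in U, IsPingPong ρ p (c n) (r n) δ κ := by
  obtain ⟨κ, hκ, hκw⟩ := exists_pos_forall_le (ι := (L × Bool) × (L × Bool))
    (P := fun ab κ => ab.2 ≠ bar ab.1 → ∀ x ∈ nearLine κ (p ab.2), κ * ‖x‖ ≤ |w ab.1 ⬝ᵥ x|)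
    (fun ab => by
      by_cases h : ab.2 ≠ bar ab.1
      · obtain ⟨κ, hκ, h'⟩ := exists_nearLine_lower (hwp _ _ h)
        exact ⟨κ, hκ, fun _ => h'⟩
      · exact ⟨1, one_pos, fun h' => absurd h' h⟩)
    (fun ab x y hx hxy h hab z hz => (mul_le_mul_of_nonneg_right hxy (norm_nonneg z)).trans
      (h hab z (nearLine_mono hxy _ hz)))
  obtain ⟨κ', hκ', hκp⟩ := exists_pos_forall_le (ι := L × Bool)
    (P := fun a κ' => κ' ≤ κ * ‖p a‖ / 2)
    (fun a => ⟨κ * ‖p a‖ / 2, by have := norm_pos_iff.2 (hp a); positivity, le_rfl⟩)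
    (fun a x y _ hxy h => hxy.trans h)
  obtain ⟨δ₀, hδ₀, hsep⟩ := exists_pos_forall_le (ι := (L × Bool) × (L × Bool))
    (P := fun ab δ => ab.1 ≠ ab.2 → p ab.2 ∉ nearLine δ (p ab.1))
    (fun ab => by
      by_cases h : ab.1 ≠ ab.2
      · have h1 := norm_pos_iff.2 (hpp _ _ h)
        have h2 := norm_pos_iff.2 (hp ab.2)
        refine ⟨‖wedge (p ab.2) (p ab.1)‖ / (2 * ‖p ab.2‖), by positivity, fun _ h3 => ?_⟩
        have h3 : ‖wedge (p ab.2) (p ab.1)‖ ≤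
          ‖wedge (p ab.2) (p ab.1)‖ / (2 * ‖p ab.2‖) * ‖p ab.2‖ := h3
        have h4 : ‖wedge (p ab.2) (p ab.1)‖ / (2 * ‖p ab.2‖) * ‖p ab.2‖ =
          ‖wedge (p ab.2) (p ab.1)‖ / 2 := by field_simp
        linarith
      · exact ⟨1, one_pos, fun h' => absurd h' h⟩)
    (fun ab x y _ hxy h hab hmem => h hab (nearLine_mono hxy _ hmem))
  refine ⟨κ', hκ', min κ δ₀, by positivity, fun δ hδ hle => ?_⟩
  have e1 : ∀ᶠ n in U, ∀ a b, b ≠ bar a → ∀ x ∈ nearLine κ (p b),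
      (r n • ρ (c n a)).mulVec x ∈ nearLine δ (p a) ∧
        κ * ‖p a‖ / 2 * ‖x‖ ≤ ‖(r n • ρ (c n a)).mulVec x‖ := by
    refine eventually_all.2 fun a => eventually_all.2 fun b => ?_
    by_cases h : b ≠ bar a
    · exact (eventually_maps_nearLine (hlim a) (hp a) hκ hδ (hκw (a, b) h)).mono fun n h _ => h
    · exact Eventually.of_forall fun n h' => absurd h' h
  have e2 : ∀ᶠ n in U, ∀ a, (∑ i, ∑ j, ∑ k, ∑ l,
      |(r n • ρ (c n a)) i k * (r n • ρ (c n a)) j l -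
        (r n • ρ (c n a)) i l * (r n • ρ (c n a)) j k|) < κ' ^ 2 / 2 :=
    eventually_all.2 fun a => (tendsto_minors (hlim a)).eventually_lt_const (by positivity)
  filter_upwards [e1, e2] with n h1 h2
  exact
    { κ_pos := hκ'
      δ_pos := hδ
      bar := hbar n
      maps := fun a b hab x hx => by
        obtain ⟨h3, h4⟩ := h1 a b hab x (nearLine_mono (hle.trans (min_le_left _ _)) _ hx)
        exact ⟨h3, (mul_le_mul_of_nonneg_right (hκp a) (norm_nonneg x)).trans h4⟩
      contr := fun a W hW => (norm_mul_mul_transpose_le _ W hW).trans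
        (mul_le_mul_of_nonneg_right (h2 a).le (norm_nonneg W))
      notMem := fun a b hab hmem => hsep (a, b) hab
        (nearLine_mono (hle.trans (min_le_right _ _)) _ hmem)
      ne_zero := hp
      eq_zero := hM }

end LinDyn

theorem Ultrafilter.exists_eventually_eq {ι α : Type*} [Finite α] (U : Ultrafilter ι) (f : ι → α) :
    ∃ a, ∀ᶠ i in U, f i = a := by
  obtain ⟨a, ha⟩ := (U.map f).eq_pure_of_finite
  refine ⟨a, ?_⟩
  have : ({a} : Set α) ∈ U.map f := by rw [ha]; exact Set.mem_singleton a
  exact this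

namespace LinDyn

open scoped Matrix.Norms.Elementwise
open FreeGroup (mk hd bar)

variable {d : ℕ} {Γ : Type*} [Group Γ] {ρ : Γ →* Matrix (Fin d) (Fin d) ℝ} {κ δ r : ℝ}
  {L : Type*} {p : L × Bool → Fin d → ℝ} {c : L × Bool → Γ}

/-- The homomorphism defined on the free group by a system of letters. -/
def wordHom (c : L × Bool → Γ) : FreeGroup L →* Γ := FreeGroup.lift fun i => c (i, true)

theorem wordHom_mk (hbar : ∀ a, c (bar a) = (c a)⁻¹) (a : L × Bool) :
    wordHom c (mk [a]) = c a := by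
  have h : ∀ i, wordHom c (mk [(i, true)]) = c (i, true) := fun i => FreeGroup.lift_apply_of
  rcases a with ⟨i, _ | _⟩
  · have h1 : ((i, false) : L × Bool) = bar (i, true) := rfl
    rw [h1, FreeGroup.mk_bar, map_inv, h, hbar]
  · exact h i

variable [DecidableEq L]

/-- The matrix of a word, rescaled according to the length of the word. -/
def wordMatrix (ρ : Γ →* Matrix (Fin d) (Fin d) ℝ) (c : L × Bool → Γ) (r : ℝ) (w : FreeGroup L) :
    Matrix (Fin d) (Fin d) ℝ := r ^ w.toWord.length • ρ (wordHom c w)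

theorem length_mk_mul {a : L × Bool} {v : FreeGroup L} (h : hd v ≠ some (bar a)) :
    (mk [a] * v).toWord.length = v.toWord.length + 1 := by
  rw [FreeGroup.toWord_mk_mul h, List.length_cons]

theorem IsPingPong.wordMatrix_mk_mul (h : IsPingPong ρ p c r δ κ) {a : L × Bool} {v : FreeGroup L}
    (hv : hd v ≠ some (FreeGroup.bar a)) :
    wordMatrix ρ c r (FreeGroup.mk [a] * v) = (r • ρ (c a)) * wordMatrix ρ c r v := by
  rw [wordMatrix, length_mk_mul hv, map_mul, wordHom_mk h.bar, map_mul, wordMatrix,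
    Matrix.smul_mul, Matrix.mul_smul, smul_smul, pow_succ']

theorem tendsto_wedge {ι : Type*} {l : Filter ι} {x y : ι → Fin d → ℝ} {a b : Fin d → ℝ}
    (hx : Tendsto x l (𝓝 a)) (hy : Tendsto y l (𝓝 b)) :
    Tendsto (fun n => wedge (x n) (y n)) l (𝓝 (wedge a b)) := by
  have h := hx.prodMk_nhds hy
  have h' := (continuous_wedge.tendsto (a, b)).comp h
  exact h'

theorem tendsto_mulVec_const {ι : Type*} {l : Filter ι} {A : ι → Matrix (Fin d) (Fin d) ℝ}
    {M : Matrix (Fin d) (Fin d) ℝ} (hA : Tendsto A l (𝓝 M)) (x : Fin d → ℝ) :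
    Tendsto (fun n => (A n).mulVec x) l (𝓝 (M.mulVec x)) := by
  have h : Continuous fun B : Matrix (Fin d) (Fin d) ℝ => B.mulVec x :=
    continuous_id.matrix_mulVec continuous_const
  have h' := (h.tendsto M).comp hA
  exact h'

theorem IsPingPong.exists_maps (h : IsPingPong ρ p c r δ κ) (w : FreeGroup L) :
    ∀ a, hd w = some a → ∃ e, ∀ b ≠ e,
    ∀ x ∈ nearLine δ (p b), (wordMatrix ρ c r w).mulVec x ∈ nearLine δ (p a) ∧
      κ ^ w.toWord.length * ‖x‖ ≤ ‖(wordMatrix ρ c r w).mulVec x‖ := by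
  induction hl : w.toWord.length generalizing w with
  | zero =>
    intro a ha
    rw [List.length_eq_zero_iff, FreeGroup.toWord_eq_nil_iff] at hl
    rw [hl, FreeGroup.hd_one] at ha
    cases ha
  | succ l ih =>
    intro a ha
    obtain ⟨v, rfl, hv⟩ := FreeGroup.exists_of_hd ha
    rw [length_mk_mul hv, Nat.add_right_cancel_iff] at hl
    rw [h.wordMatrix_mk_mul hv]
    rcases hv1 : hd v with _ | a'
    · rw [FreeGroup.hd_eq_none] at hv1
      subst hv1
      have hl0 : l = 0 := by rw [← hl]; simp
      subst hl0
      refine ⟨FreeGroup.bar a, fun b hb x hx => ?_⟩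
      have h1 : wordMatrix ρ c r (1 : FreeGroup L) = 1 := by simp [wordMatrix]
      rw [h1, mul_one, zero_add, pow_one]
      exact h.maps a b hb x hx
    · obtain ⟨e, he⟩ := ih v hl a' hv1
      refine ⟨e, fun b hb x hx => ?_⟩
      obtain ⟨h1, h2⟩ := he b hb x hx
      obtain ⟨h3, h4⟩ := h.maps a a' (fun h' => hv (by rw [hv1, h'])) _ h1
      rw [← Matrix.mulVec_mulVec]
      refine ⟨h3, le_trans ?_ h4⟩
      rw [pow_succ', mul_assoc]
      exact mul_le_mul_of_nonneg_left h2 h.κ_pos.le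

theorem IsPingPong.norm_mul_mul_transpose_le (h : IsPingPong ρ p c r δ κ) (w : FreeGroup L)
    (W : Matrix (Fin d) (Fin d) ℝ)
    (hW : W.transpose = -W) : ‖wordMatrix ρ c r w * W * (wordMatrix ρ c r w).transpose‖ ≤
      (κ ^ 2 / 2) ^ w.toWord.length * ‖W‖ := by
  induction hl : w.toWord.length generalizing w with
  | zero =>
    rw [List.length_eq_zero_iff, FreeGroup.toWord_eq_nil_iff] at hl
    simp [hl, wordMatrix]
  | succ l ih =>
    rcases ha : hd w with _ | a
    · rw [FreeGroup.hd_eq_none] at ha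
      simp [ha] at hl
    obtain ⟨v, rfl, hv⟩ := FreeGroup.exists_of_hd ha
    rw [length_mk_mul hv, Nat.add_right_cancel_iff] at hl
    rw [h.wordMatrix_mk_mul hv]
    set A := r • ρ (c a)
    set B := wordMatrix ρ c r v
    have h1 : A * B * W * (A * B).transpose = A * (B * W * B.transpose) * A.transpose := by
      simp only [Matrix.transpose_mul, Matrix.mul_assoc]
    rw [h1, pow_succ', mul_assoc (κ ^ 2 / 2)]
    have h2 := h.contr a (B * W * B.transpose) (by
      simp only [Matrix.transpose_mul, Matrix.transpose_transpose, hW, Matrix.mul_assoc,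
        Matrix.neg_mul, Matrix.mul_neg])
    exact h2.trans (mul_le_mul_of_nonneg_left (ih v hl) (by positivity))

theorem IsPingPong.eq_one_of_scalar (h : IsPingPong ρ p c r δ κ)
    (hL : ∀ a e : L × Bool, ∃ b, b ≠ a ∧ b ≠ e) {w : FreeGroup L} {s : ℝ}
    (hs : ρ (wordHom c w) = s • 1) : w = 1 := by
  by_contra hw
  obtain ⟨a, ha⟩ : ∃ a, hd w = some a := Option.ne_none_iff_exists'.1 (mt FreeGroup.hd_eq_none.1 hw)
  obtain ⟨e, he⟩ := h.exists_maps w a ha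
  obtain ⟨b, hba, hbe⟩ := hL a e
  obtain ⟨h1, h2⟩ := he b hbe (p b) (self_mem_nearLine h.δ_pos.le _)
  have h3 : (wordMatrix ρ c r w).mulVec (p b) = (r ^ w.toWord.length * s) • p b := by
    rw [wordMatrix, hs, smul_smul, Matrix.smul_mulVec, Matrix.one_mulVec]
  rw [h3] at h1 h2
  have h4 : r ^ w.toWord.length * s ≠ 0 := fun h0 => by
    rw [h0, zero_smul, norm_zero] at h2
    have := norm_pos_iff.2 (h.ne_zero b)
    have := pow_pos h.κ_pos w.toWord.length
    exact absurd h2 (not_le.2 (by positivity))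
  refine h.notMem a b hba.symm ?_
  have := smul_mem_nearLine h1 (r ^ w.toWord.length * s)⁻¹
  rwa [inv_smul_smul₀ h4] at this

theorem IsDenseRep.apply_ne_zero [Nonempty (Fin d)] (hρ : IsDenseRep ρ) (γ : Γ) : ρ γ ≠ 0 := by
  intro h
  have := hρ.det_eq_one γ
  rw [h, Matrix.det_zero] at this
  exact zero_ne_one this

theorem IsPingPong.r_ne_zero (h : IsPingPong ρ p c r δ κ) (a : L × Bool) : r ≠ 0 := by
  rintro rfl
  have h1 := (h.maps a a (FreeGroup.bar_ne a).symm (p a) (self_mem_nearLine h.δ_pos.le _)).2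
  rw [zero_smul, Matrix.zero_mulVec, norm_zero] at h1
  have := norm_pos_iff.2 (h.ne_zero a)
  have := h.κ_pos
  exact absurd h1 (not_le.2 (by positivity))

theorem IsPingPong.norm_wedge_le (h : IsPingPong ρ p c r δ κ) (w : FreeGroup L) {b : L × Bool}
    (h4 : κ ^ w.toWord.length * ‖p b‖ ≤ ‖(wordMatrix ρ c r w).mulVec (p b)‖) (y : Fin d → ℝ) :
    ‖wedge ((‖ρ (wordHom c w)‖⁻¹ • ρ (wordHom c w)).mulVec y)
      ((‖ρ (wordHom c w)‖⁻¹ • ρ (wordHom c w)).mulVec (p b))‖ ≤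
      d ^ 2 * (1 / 2 : ℝ) ^ w.toWord.length * ‖wedge y (p b)‖ := by
  set A := wordMatrix ρ c r w with hA
  set l := w.toWord.length
  have hpb := norm_pos_iff.2 (h.ne_zero b)
  have h5 : κ ^ l ≤ d * ‖A‖ := le_of_mul_le_mul_right (h4.trans (norm_mulVec_le A (p b))) hpb
  have hκ := pow_pos h.κ_pos l
  have hA0 : 0 < ‖A‖ := by
    by_contra! h0
    have : d * ‖A‖ ≤ 0 := mul_nonpos_of_nonneg_of_nonpos (Nat.cast_nonneg d) h0
    linarith
  have h6 : ‖A‖ = |r ^ l| * ‖ρ (wordHom c w)‖ := by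
    rw [hA, wordMatrix, norm_smul, Real.norm_eq_abs]
  set t := ‖ρ (wordHom c w)‖⁻¹ * (r ^ l)⁻¹ with ht
  have h7 : |t| = ‖A‖⁻¹ := by
    rw [ht, h6, abs_mul, abs_inv, abs_inv, abs_norm, mul_inv, mul_comm]
  have hN : ‖ρ (wordHom c w)‖⁻¹ • ρ (wordHom c w) = t • A := by
    rw [hA, wordMatrix, smul_smul, inv_mul_cancel_right₀ (pow_ne_zero _ (h.r_ne_zero b))]
  rw [hN, Matrix.smul_mulVec, Matrix.smul_mulVec]
  have h8 : wedge (t • A.mulVec y) (t • A.mulVec (p b)) =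
      (t ^ 2) • (A * wedge y (p b) * A.transpose) := by
    rw [← wedge_mulVec]
    ext i j
    simp only [wedge_apply, Pi.smul_apply, Matrix.smul_apply, smul_eq_mul]
    ring
  have h9 := h.norm_mul_mul_transpose_le w (wedge y (p b)) (wedge_transpose _ _)
  rw [h8, norm_smul, Real.norm_eq_abs, abs_pow, h7]
  calc ‖A‖⁻¹ ^ 2 * ‖A * wedge y (p b) * A.transpose‖
      ≤ ‖A‖⁻¹ ^ 2 * ((κ ^ 2 / 2) ^ l * ‖wedge y (p b)‖) := by gcongr
    _ = (κ ^ l * ‖A‖⁻¹) ^ 2 * (1 / 2 : ℝ) ^ l * ‖wedge y (p b)‖ := by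
        rw [div_eq_mul_one_div, mul_pow, mul_pow, ← pow_mul, ← pow_mul, mul_comm 2 l]
        ring
    _ ≤ (d : ℝ) ^ 2 * (1 / 2 : ℝ) ^ l * ‖wedge y (p b)‖ := by
        have : κ ^ l * ‖A‖⁻¹ ≤ d := by
          rwa [← div_eq_mul_inv, div_le_iff₀ hA0]
        gcongr

/-- The limits of the directions of the matrices of long words have rank one. -/
theorem IsPingPong.exists_limit (h : IsPingPong ρ p c r δ κ) [Finite L]
    {U : Ultrafilter ℕ} {w : ℕ → FreeGroup L} {a : L × Bool}
    (hρ : IsDenseRep ρ) (hlen : Tendsto (fun n => (w n).toWord.length) U atTop)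
    (hwa : ∀ᶠ n in U, hd (w n) = some a) :
    ∃ M x, Tendsto (fun n => ‖ρ (wordHom c (w n))‖⁻¹ • ρ (wordHom c (w n))) U (𝓝 M) ∧ M ≠ 0 ∧
      M.mulVec x ≠ 0 ∧ M.mulVec x ∈ nearLine δ (p a) ∧
      ∀ y, ∃ t : ℝ, M.mulVec y = t • M.mulVec x := by
  have hne0 : Nonempty (Fin d) := by
    obtain ⟨i, -⟩ := Function.ne_iff.1 (h.ne_zero a)
    exact ⟨i⟩
  have hρ0 : ∀ n, ρ (wordHom c (w n)) ≠ 0 := fun n => hρ.apply_ne_zero _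
  obtain ⟨M, hM0, hM⟩ := U.exists_tendsto_normalize hρ0
  have hex : ∀ n, ∃ e, hd (w n) = some a → ∀ b ≠ e, ∀ x ∈ nearLine δ (p b),
      (wordMatrix ρ c r (w n)).mulVec x ∈ nearLine δ (p a) ∧
        κ ^ (w n).toWord.length * ‖x‖ ≤ ‖(wordMatrix ρ c r (w n)).mulVec x‖ := by
    intro n
    by_cases hn : hd (w n) = some a
    · obtain ⟨e, he⟩ := h.exists_maps (w n) a hn
      exact ⟨e, fun _ => he⟩
    · exact ⟨a, fun h' => absurd h' hn⟩
  choose f hf using hex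
  obtain ⟨e, he⟩ := U.exists_eventually_eq f
  have hr := h.r_ne_zero a
  have hN : ∀ n, ‖ρ (wordHom c (w n))‖⁻¹ • ρ (wordHom c (w n)) =
      (‖ρ (wordHom c (w n))‖⁻¹ * (r ^ (w n).toWord.length)⁻¹) • wordMatrix ρ c r (w n) := by
    intro n
    rw [wordMatrix, smul_smul, inv_mul_cancel_right₀ (pow_ne_zero _ hr)]
  have hcont : ∀ x, Tendsto (fun n =>
      (‖ρ (wordHom c (w n))‖⁻¹ • ρ (wordHom c (w n))).mulVec x) U (𝓝 (M.mulVec x)) :=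
    fun x => tendsto_mulVec_const hM x
  have hnear : ∀ b ≠ e, M.mulVec (p b) ∈ nearLine δ (p a) := by
    intro b hb
    refine (isClosed_nearLine δ (p a)).mem_of_tendsto (hcont (p b)) ?_
    filter_upwards [he, hwa] with n h1 h2
    rw [hN, Matrix.smul_mulVec]
    exact smul_mem_nearLine (hf n h2 b (h1 ▸ hb) _ (self_mem_nearLine h.δ_pos.le _)).1 _
  obtain ⟨b, hb, hMb⟩ : ∃ b, b ≠ e ∧ M.mulVec (p b) ≠ 0 := by
    by_contra! hcon
    exact hM0 (h.eq_zero e M hcon)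
  refine ⟨M, p b, hM, hM0, hMb, hnear b hb, fun y => exists_smul_of_wedge_eq_zero hMb ?_⟩
  have h1 := tendsto_wedge (hcont y) (hcont (p b))
  have h2 : Tendsto (fun n => (d : ℝ) ^ 2 * (1 / 2 : ℝ) ^ (w n).toWord.length * ‖wedge y (p b)‖) U
      (𝓝 0) := by
    have := ((tendsto_pow_atTop_nhds_zero_of_lt_one (r := (1 / 2 : ℝ)) (by norm_num)
      (by norm_num)).comp hlen).const_mul ((d : ℝ) ^ 2)
    have := this.mul_const ‖wedge y (p b)‖
    rw [mul_zero, zero_mul] at this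
    exact this
  refine norm_le_zero_iff.1 (le_of_tendsto_of_tendsto h1.norm h2 ?_)
  filter_upwards [he, hwa] with n h3 h4
  exact h.norm_wedge_le _ (hf n h4 b (h3 ▸ hb) _ (self_mem_nearLine h.δ_pos.le _)).2 _

end LinDyn

namespace LinDyn

open scoped Matrix.Norms.Elementwise
open FreeGroup (mk hd bar)

theorem tendsto_length_of_injective {L : Type*} [Finite L] [DecidableEq L] {w : ℕ → FreeGroup L}
    (hw : Function.Injective w) :
    Tendsto (fun n => (w n).toWord.length) (hyperfilter ℕ : Filter ℕ) atTop := by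
  refine Tendsto.mono_left (tendsto_atTop.2 fun b => ?_) hyperfilter_le_cofinite
  have h : {x : FreeGroup L | x.toWord.length < b}.Finite :=
    (List.finite_length_lt (L × Bool) b).preimage FreeGroup.toWord_injective.injOn
  have h' := h.preimage (f := w) hw.injOn
  refine h'.subset fun n hn => ?_
  simpa using hn

variable {d : ℕ} {Γ : Type*} [Group Γ] {ρ : Γ →* Matrix (Fin d) (Fin d) ℝ} {κ δ r : ℝ}
  {L : Type*} {p : L × Bool → Fin d → ℝ} {c : L × Bool → Γ}

theorem exists_eq_smul_of_tendsto {ι : Type*} {l : Filter ι} [l.NeBot]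
    {A B : ι → Matrix (Fin d) (Fin d) ℝ} {A' B' : Matrix (Fin d) (Fin d) ℝ}
    (hA : Tendsto A l (𝓝 A')) (hB : Tendsto B l (𝓝 B')) (hB' : B' ≠ 0)
    (h : ∀ᶠ n in l, ∃ s : ℝ, A n = s • B n) : ∃ s : ℝ, A' = s • B' := by
  obtain ⟨i, j, hij⟩ : ∃ i j, B' i j ≠ 0 := by
    by_contra! hcon
    exact hB' (Matrix.ext hcon)
  refine ⟨A' i j / B' i j, Matrix.ext fun k m => ?_⟩
  have eA : ∀ k m, Tendsto (fun n => A n k m) l (𝓝 (A' k m)) := fun k m =>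
    tendsto_pi_nhds.1 (tendsto_pi_nhds.1 hA k) m
  have eB : ∀ k m, Tendsto (fun n => B n k m) l (𝓝 (B' k m)) := fun k m =>
    tendsto_pi_nhds.1 (tendsto_pi_nhds.1 hB k) m
  have h1 := (eA k m).mul (eB i j)
  have h2 := (eA i j).mul (eB k m)
  have h3 : A' k m * B' i j = A' i j * B' k m := by
    refine tendsto_nhds_unique h1 (h2.congr' ?_)
    filter_upwards [h] with n ⟨s, hs⟩
    simp only [hs, Matrix.smul_apply, smul_eq_mul]
    ring
  rw [Matrix.smul_apply, smul_eq_mul, div_mul_eq_mul_div, eq_div_iff hij, h3]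

theorem tendsto_mul_mul {ι : Type*} {l : Filter ι} {A : ι → Matrix (Fin d) (Fin d) ℝ}
    {M : Matrix (Fin d) (Fin d) ℝ} (hA : Tendsto A l (𝓝 M)) (P Q : Matrix (Fin d) (Fin d) ℝ) :
    Tendsto (fun n => P * A n * Q) l (𝓝 (P * M * Q)) := by
  have h : Continuous fun B : Matrix (Fin d) (Fin d) ℝ => P * B * Q :=
    (continuous_const.matrix_mul continuous_id).matrix_mul continuous_const
  have h' := (h.tendsto M).comp hA
  exact h'

variable [DecidableEq L]

theorem IsPingPong.wordHom_injective_of_smul (h : IsPingPong ρ p c r δ κ)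
    (hL : ∀ a e : L × Bool, ∃ b, b ≠ a ∧ b ≠ e) {w w' : FreeGroup L} {s : ℝ}
    (hs : ρ (wordHom c w) = s • ρ (wordHom c w')) : w = w' := by
  refine inv_mul_eq_one.1 (h.eq_one_of_scalar hL (s := s) ?_) |>.symm
  rw [map_mul, map_mul, hs, Matrix.mul_smul, ← map_mul, ← map_mul, inv_mul_cancel, map_one, map_one]

/-- If a conjugate of the free group meets it in infinitely many words which begin with `a`, then
the conjugating matrix sends the line of `a` close to the line of another letter. -/
theorem IsPingPong.exists_mem_nearLine (h : IsPingPong ρ p c r δ κ) [Finite L]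
    (hρ : IsDenseRep ρ) (hL : ∀ a e : L × Bool, ∃ b, b ≠ a ∧ b ≠ e) {g : Γ} {a : L × Bool}
    (hinf : {w | hd w = some a ∧
      ∃ w', ∃ s : ℝ, ρ (g⁻¹ * wordHom c w * g) = s • ρ (wordHom c w')}.Infinite) :
    ∃ b b', b' ≠ FreeGroup.bar b ∧ ∃ ξ, ξ ≠ 0 ∧ ξ ∈ nearLine δ (p a) ∧
      (ρ g⁻¹).mulVec ξ ∈ nearLine δ (p b) ∧
      (ρ ((c b)⁻¹ * g⁻¹)).mulVec ξ ∈ nearLine δ (p b') := by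
  set f := hinf.natEmbedding
  choose w' s hs using fun n => (f n).2.2
  set w : ℕ → FreeGroup L := fun n => f n
  have hwinj : Function.Injective w := Subtype.val_injective.comp f.injective
  have hs' : ∀ n, ρ (wordHom c (w n)) = s n • (ρ g * ρ (wordHom c (w' n)) * ρ g⁻¹) := by
    intro n
    rw [← Matrix.smul_mul, ← Matrix.mul_smul, ← hs n, ← map_mul, ← map_mul]
    congr 1
    group
    rfl
  have hne : Nonempty (Fin d) := by
    obtain ⟨i, -⟩ := Function.ne_iff.1 (h.ne_zero a)
    exact ⟨i⟩
  have hs0 : ∀ n, s n ≠ 0 := fun n h0 => hρ.apply_ne_zero (wordHom c (w n)) (by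
    rw [hs' n, h0, zero_smul])
  have hw'inj : Function.Injective w' := by
    intro n m hnm
    refine hwinj (h.wordHom_injective_of_smul hL (s := s n / s m) ?_)
    rw [hs' n, hs' m, hnm, smul_smul, div_mul_cancel₀ _ (hs0 m)]
  set U := hyperfilter ℕ
  have hlen' := tendsto_length_of_injective hw'inj
  obtain ⟨b, hb⟩ : ∃ b, ∀ᶠ n in (U : Filter ℕ), hd (w' n) = some b := by
    obtain ⟨o, ho⟩ := U.exists_eventually_eq fun n => hd (w' n)
    rcases o with _ | b
    · obtain ⟨n, h1, h2⟩ := (ho.and (hlen'.eventually_ge_atTop 1)).exists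
      rw [FreeGroup.hd_eq_none] at h1
      simp [h1] at h2
    · exact ⟨b, ho⟩
  have hex : ∀ n, ∃ v, hd (w' n) = some b →
      w' n = FreeGroup.mk [b] * v ∧ hd v ≠ some (FreeGroup.bar b) := by
    intro n
    by_cases hn : hd (w' n) = some b
    · obtain ⟨v, h1, h2⟩ := FreeGroup.exists_of_hd hn
      exact ⟨v, fun _ => ⟨h1, h2⟩⟩
    · exact ⟨1, fun h' => absurd h' hn⟩
  choose v hv using hex
  have hlenv : Tendsto (fun n => (v n).toWord.length) U atTop := by
    refine tendsto_atTop.2 fun N => ?_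
    filter_upwards [hb, hlen'.eventually_ge_atTop (N + 1)] with n h1 h2
    obtain ⟨h3, h4⟩ := hv n h1
    rw [h3, length_mk_mul h4] at h2
    omega
  obtain ⟨b', hb'⟩ : ∃ b', ∀ᶠ n in (U : Filter ℕ), hd (v n) = some b' := by
    obtain ⟨o, ho⟩ := U.exists_eventually_eq fun n => hd (v n)
    rcases o with _ | b
    · obtain ⟨n, h1, h2⟩ := (ho.and (hlenv.eventually_ge_atTop 1)).exists
      rw [FreeGroup.hd_eq_none] at h1
      simp [h1] at h2
    · exact ⟨b, ho⟩
  have hbb' : b' ≠ FreeGroup.bar b := by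
    obtain ⟨n, h1, h2⟩ := (hb.and hb').exists
    rintro rfl
    exact (hv n h1).2 h2
  obtain ⟨M, x, hM, -, hx0, hxa, -⟩ := h.exists_limit hρ (tendsto_length_of_injective hwinj)
    (Eventually.of_forall fun n => (f n).2.1)
  obtain ⟨M', x', hM', hM'0, -, hx'b, hx'⟩ := h.exists_limit hρ hlenv hb'
  obtain ⟨τ, hτ⟩ := exists_eq_smul_of_tendsto (tendsto_mul_mul hM
    (ρ ((c b)⁻¹ * g⁻¹)) (ρ g)) hM' hM'0
    (by
      filter_upwards [hb] with n hn
      refine ⟨‖ρ (wordHom c (w n))‖⁻¹ * (s n * ‖ρ (wordHom c (v n))‖), ?_⟩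
      have h1 : ρ ((c b)⁻¹ * g⁻¹) * ρ (wordHom c (w n)) * ρ g = s n • ρ (wordHom c (v n)) := by
        have h2 : ρ ((c b)⁻¹ * g⁻¹) * ρ (wordHom c (w n)) * ρ g =
            ρ (c b)⁻¹ * ρ (g⁻¹ * wordHom c (w n) * g) := by
          simp only [map_mul, Matrix.mul_assoc]
        rw [h2]
        refine (congrArg (ρ (c b)⁻¹ * ·) (hs n)).trans ?_
        rw [Matrix.mul_smul, (hv n hn).1, map_mul, wordHom_mk h.bar, ← map_mul,
          inv_mul_cancel_left]
      have h3 : ‖ρ (wordHom c (v n))‖ ≠ 0 := norm_ne_zero_iff.2 (hρ.apply_ne_zero _)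
      rw [Matrix.mul_smul, Matrix.smul_mul, h1, smul_smul, smul_smul]
      congr 1
      field_simp)
  set ξ := M.mulVec x
  have hζ : (ρ ((c b)⁻¹ * g⁻¹)).mulVec ξ = τ • M'.mulVec ((ρ g⁻¹).mulVec x) := by
    rw [← Matrix.smul_mulVec, ← hτ, Matrix.mulVec_mulVec, Matrix.mulVec_mulVec, Matrix.mul_assoc,
      ← map_mul ρ g, mul_inv_cancel, map_one, Matrix.mul_one]
  have hζb : (ρ ((c b)⁻¹ * g⁻¹)).mulVec ξ ∈ nearLine δ (p b') := by
    obtain ⟨t, ht⟩ := hx' ((ρ g⁻¹).mulVec x)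
    rw [hζ, ht]
    exact smul_mem_nearLine (smul_mem_nearLine hx'b _) _
  refine ⟨b, b', hbb', ξ, hx0, hxa, ?_, hζb⟩
  have h4 := smul_mem_nearLine (h.maps b b' hbb' _ hζb).1 r⁻¹
  rwa [Matrix.smul_mulVec, inv_smul_smul₀ (h.r_ne_zero b), Matrix.mulVec_mulVec, ← map_mul,
    mul_inv_cancel_left] at h4

end LinDyn

namespace LinDyn

open scoped Matrix.Norms.Elementwise
open FreeGroup (mk hd bar)

variable {d : ℕ} {Γ : Type*} [Group Γ] {ρ : Γ →* Matrix (Fin d) (Fin d) ℝ} {κ δ r : ℝ}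
  {L : Type*} {p : L × Bool → Fin d → ℝ} {c : L × Bool → Γ}

/-- The elements which act on the projective space as elements of the free group. -/
def projSubgroup (ρ : Γ →* Matrix (Fin d) (Fin d) ℝ) (c : L × Bool → Γ) : Subgroup Γ where
  carrier := {γ | ∃ w, ∃ s : ℝ, ρ γ = s • ρ (wordHom c w)}
  one_mem' := ⟨1, 1, by simp⟩
  mul_mem' := by
    rintro γ γ' ⟨w, s, h⟩ ⟨w', s', h'⟩
    refine ⟨w * w', s * s', ?_⟩
    rw [map_mul, h, h', map_mul, map_mul, Matrix.smul_mul, Matrix.mul_smul, smul_smul]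
  inv_mem' := by
    rintro γ ⟨w, s, h⟩
    refine ⟨w⁻¹, s⁻¹, ?_⟩
    have h1 : ρ (wordHom c w⁻¹) = s • ρ γ⁻¹ := by
      rw [map_inv]
      have h2 : ρ (wordHom c w)⁻¹ * (s • ρ (wordHom c w)) * ρ γ⁻¹ = ρ (wordHom c w)⁻¹ := by
        rw [← h, mul_assoc, ← map_mul ρ γ, mul_inv_cancel, map_one, mul_one]
      rw [← h2, Matrix.mul_smul, Matrix.smul_mul, ← map_mul, inv_mul_cancel, map_one,
        one_mul]
    rcases eq_or_ne s 0 with rfl | hs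
    · have h3 : (1 : Matrix (Fin d) (Fin d) ℝ) = 0 := by
        rw [← map_one ρ, ← mul_inv_cancel γ, map_mul, h, zero_smul, zero_mul]
      rw [← one_mul (ρ γ⁻¹), h3, zero_mul, inv_zero, zero_smul]
    · rw [h1, inv_smul_smul₀ hs]

variable [DecidableEq L]

theorem IsPingPong.exists_retraction (h : IsPingPong ρ p c r δ κ) (hρ : IsDenseRep ρ)
    (hL : ∀ a e : L × Bool, ∃ b, b ≠ a ∧ b ≠ e) (a : L × Bool) :
    ∃ ψ : projSubgroup ρ c →* FreeGroup L,
      ∀ w, ∃ h : wordHom c w ∈ projSubgroup ρ c, ψ ⟨wordHom c w, h⟩ = w := by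
  have hne : Nonempty (Fin d) := by
    obtain ⟨i, -⟩ := Function.ne_iff.1 (h.ne_zero a)
    exact ⟨i⟩
  choose f s hf using fun γ : projSubgroup ρ c => γ.2
  have huniq : ∀ (γ : projSubgroup ρ c) w, ∀ t : ℝ, ρ (γ : Γ) = t • ρ (wordHom c w) → f γ = w := by
    intro γ w t ht
    have hs0 : s γ ≠ 0 := fun h0 => hρ.apply_ne_zero γ.1 (by rw [hf γ, h0, zero_smul])
    refine h.wordHom_injective_of_smul hL (s := (s γ)⁻¹ * t) ?_
    rw [mul_smul, ← ht, hf γ, inv_smul_smul₀ hs0]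
  refine ⟨MonoidHom.mk' f fun γ γ' => huniq _ _ (s γ * s γ') ?_, fun w => ?_⟩
  · rw [Subgroup.coe_mul, map_mul, hf γ, hf γ', map_mul, map_mul, Matrix.smul_mul, Matrix.mul_smul,
      smul_smul]
  · have hw : wordHom c w ∈ projSubgroup ρ c := ⟨w, 1, (one_smul _ _).symm⟩
    exact ⟨hw, huniq ⟨_, hw⟩ w 1 (one_smul _ _).symm⟩

theorem IsDenseRep.exists_min_norm (hρ : IsDenseRep ρ) {T : Set Γ} (hT : T.Nonempty) :
    ∃ y ∈ T, ∀ z ∈ T, ‖ρ y‖ ≤ ‖ρ z‖ := by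
  obtain ⟨y₀, hy₀⟩ := hT
  have hfin : {y ∈ T | ‖ρ y‖ ≤ ‖ρ y₀‖}.Finite := (hρ.finite ‖ρ y₀‖).subset fun y hy i j =>
    (Matrix.norm_entry_le_entrywise_sup_norm (ρ y)).trans hy.2
  obtain ⟨y, hy, hmin⟩ := Set.exists_min_image _ (fun y => ‖ρ y‖) hfin ⟨y₀, hy₀, le_rfl⟩
  refine ⟨y, hy.1, fun z hz => ?_⟩
  rcases le_total ‖ρ z‖ ‖ρ y₀‖ with h | h
  · exact hmin z ⟨hz, h⟩
  · exact hy.2.trans h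

/-- If the free group is not malnormal in the required sense, then there is a nontrivial projective
transformation which maps the lines of the letters close to lines of letters. -/
theorem IsPingPong.exists_permuting (h : IsPingPong ρ p c r δ κ) [Finite L] (hρ : IsDenseRep ρ)
    (hL : ∀ a e : L × Bool, ∃ b, b ≠ a ∧ b ≠ e) {g : Γ} (hg : g ∉ projSubgroup ρ c)
    (hinf : ∀ a, {w | hd w = some a ∧ g⁻¹ * wordHom c w * g ∈ projSubgroup ρ c}.Infinite) :
    ∃ y : Γ, (∀ s : ℝ, ρ y ≠ s • 1) ∧ (∀ q, ‖ρ y‖ ≤ ‖ρ ((c q)⁻¹ * y)‖) ∧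
      ∀ a, ∃ b b', b' ≠ FreeGroup.bar b ∧ ∃ ξ, ξ ≠ 0 ∧ ξ ∈ nearLine δ (p a) ∧
        (ρ y).mulVec ξ ∈ nearLine δ (p b) ∧ (ρ ((c b)⁻¹ * y)).mulVec ξ ∈ nearLine δ (p b') := by
  obtain ⟨y, ⟨l, hl, rfl⟩, hmin⟩ := hρ.exists_min_norm
    (T := {y | ∃ l ∈ projSubgroup ρ c, y = l * g⁻¹}) ⟨g⁻¹, 1, one_mem _, (one_mul _).symm⟩
  refine ⟨l * g⁻¹, fun s hs => hg ?_, fun q => hmin _ ⟨(c q)⁻¹ * l, mul_mem (inv_mem ?_) hl,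
    (_root_.mul_assoc _ _ _).symm⟩, fun a => ?_⟩
  · have h1 : l * g⁻¹ ∈ projSubgroup ρ c := ⟨1, s, by rw [hs, map_one, map_one]⟩
    have h2 := mul_mem (inv_mem h1) hl
    rwa [_root_.mul_inv_rev, inv_inv, inv_mul_cancel_right] at h2
  · exact ⟨FreeGroup.mk [q], 1, by rw [wordHom_mk h.bar, one_smul]⟩
  · have h1 : {w | hd w = some a ∧ ∃ w', ∃ s : ℝ,
        ρ ((g * l⁻¹)⁻¹ * wordHom c w * (g * l⁻¹)) = s • ρ (wordHom c w')}.Infinite := by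
      refine (hinf a).mono fun w hw => ⟨hw.1, ?_⟩
      have h2 := mul_mem (mul_mem hl hw.2) (inv_mem hl)
      have h3 : l * (g⁻¹ * wordHom c w * g) * l⁻¹ = (g * l⁻¹)⁻¹ * wordHom c w * (g * l⁻¹) := by
        group
      rwa [h3] at h2
    have h4 := h.exists_mem_nearLine hρ hL h1
    rwa [_root_.mul_inv_rev, inv_inv] at h4

end LinDyn

theorem Ultrafilter.exists_eventually_eq_of_mem {ι α : Type*} (U : Ultrafilter ι) {f : ι → α}
    {s : Set α} (hs : s.Finite) (h : ∀ᶠ i in U, f i ∈ s) : ∃ a, ∀ᶠ i in U, f i = a := by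
  obtain ⟨a, -, ha⟩ := (Ultrafilter.finite_biUnion_mem_iff (f := U.map f) hs
    (s := fun a => ({a} : Set α))).1 (by rw [Set.biUnion_of_singleton]; exact h)
  exact ⟨a, ha⟩

namespace LinDyn

open scoped Matrix.Norms.Elementwise
open FreeGroup (mk hd bar)

variable {d : ℕ} {Γ : Type*} [Group Γ] {ρ : Γ →* Matrix (Fin d) (Fin d) ℝ}

/-- Points and linear forms, indexed by the letters of a free group, in general position. -/
structure IsConfiguration {L : Type*} (p w : L × Bool → Fin d → ℝ) : Prop where
  ne_zero : ∀ a, p a ≠ 0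
  dot_ne_zero : ∀ a b, b ≠ bar a → w a ⬝ᵥ p b ≠ 0
  wedge_ne_zero : ∀ a b, a ≠ b → wedge (p b) (p a) ≠ 0
  card_le : ∀ W : Submodule ℝ (Fin d → ℝ), W ≠ ⊤ → ∀ t : Finset (L × Bool), (∀ a ∈ t, p a ∈ W) →
    t.card ≤ d - 1
  rigid : ∀ A : Matrix (Fin d) (Fin d) ℝ, A.det ≠ 0 →
    (∀ a, ∃ b, ∃ t : ℝ, A.mulVec (p a) = t • p b) → ∃ s : ℝ, A = s • 1

theorem exists_smul_of_tendsto_nearLine {ι : Type*} {U : Ultrafilter ι}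
    {A : ι → Matrix (Fin d) (Fin d) ℝ} {A' : Matrix (Fin d) (Fin d) ℝ} (hA : Tendsto A U (𝓝 A'))
    {ξ : ι → Fin d → ℝ} (hξ0 : ∀ n, ξ n ≠ 0) {δ : ι → ℝ} (hδ : Tendsto δ U (𝓝 0))
    {p q : Fin d → ℝ} (hp : p ≠ 0) (hq : q ≠ 0) (hξ : ∀ᶠ n in U, ξ n ∈ nearLine (δ n) p)
    (hAξ : ∀ᶠ n in U, (A n).mulVec (ξ n) ∈ nearLine (δ n) q) : ∃ t : ℝ, A'.mulVec p = t • q := by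
  obtain ⟨x, hx0, hx⟩ := U.exists_tendsto_normalize hξ0
  have h1 : wedge x p = 0 := by
    have e1 := (tendsto_wedge hx (tendsto_const_nhds (x := p))).norm
    refine norm_le_zero_iff.1 (le_of_tendsto_of_tendsto e1 hδ ?_)
    filter_upwards [hξ] with n hn
    refine (smul_mem_nearLine hn ‖ξ n‖⁻¹ : _ ≤ _).trans_eq ?_
    rw [norm_smul, norm_inv, norm_norm, inv_mul_cancel₀ (norm_ne_zero_iff.2 (hξ0 n)), mul_one]
  obtain ⟨t, rfl⟩ := exists_smul_of_wedge_eq_zero hp h1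
  have hAx : Tendsto (fun n => (A n).mulVec (‖ξ n‖⁻¹ • ξ n)) U (𝓝 (A'.mulVec (t • p))) := by
    have hc : Continuous fun z : Matrix (Fin d) (Fin d) ℝ × (Fin d → ℝ) => z.1.mulVec z.2 :=
      continuous_fst.matrix_mulVec continuous_snd
    have e1 := hA.prodMk_nhds hx
    have e2 := (hc.tendsto (A', t • p)).comp e1
    exact e2
  have h2 : wedge (A'.mulVec (t • p)) q = 0 := by
    have e1 := (tendsto_wedge hAx (tendsto_const_nhds (x := q))).norm
    have e2 := hδ.mul hAx.norm
    rw [zero_mul] at e2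
    refine norm_le_zero_iff.1 (le_of_tendsto_of_tendsto e1 e2 ?_)
    filter_upwards [hAξ] with n hn
    rw [Matrix.mulVec_smul]
    exact smul_mem_nearLine hn _
  obtain ⟨t', ht'⟩ := exists_smul_of_wedge_eq_zero hq h2
  have ht : t ≠ 0 := fun h => hx0 (by rw [h, zero_smul])
  refine ⟨t⁻¹ * t', ?_⟩
  rw [mul_smul, ← ht', Matrix.mulVec_smul, inv_smul_smul₀ ht]

/-- A linear map whose kernel and image are proper cannot map the lines of a large configuration to
lines of the configuration with small fibres. -/
theorem IsConfiguration.det_ne_zero {L : Type*} [Fintype L] [DecidableEq L]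
    {p w : L × Bool → Fin d → ℝ}
    (hpw : IsConfiguration p w) (hcard : (d - 1) + (d - 1) ^ 2 < Fintype.card (L × Bool))
    {A : Matrix (Fin d) (Fin d) ℝ} (hA : A ≠ 0) {β : L × Bool → L × Bool}
    (hβ : ∀ a, ∃ t : ℝ, A.mulVec (p a) = t • p (β a))
    {A' : L × Bool → Matrix (Fin d) (Fin d) ℝ} (hA' : ∀ q, A' q ≠ 0)
    (hfib : ∀ a, (A' (β a)).mulVec (p a) = 0) : A.det ≠ 0 := by
  classical
  intro hdet
  have hker : ∀ B : Matrix (Fin d) (Fin d) ℝ, B ≠ 0 → LinearMap.ker B.mulVecLin ≠ ⊤ := by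
    intro B hB h
    refine hB (Matrix.toLin'.injective ?_)
    rw [map_zero]
    exact LinearMap.ker_eq_top.1 h
  have hrange : LinearMap.range A.mulVecLin ≠ ⊤ := by
    intro h
    have h1 : LinearMap.ker A.mulVecLin = ⊥ :=
      LinearMap.ker_eq_bot_iff_range_eq_top.2 h
    rw [Matrix.ker_mulVecLin_eq_bot_iff] at h1
    obtain ⟨v, hv, hv'⟩ := Matrix.exists_mulVec_eq_zero_iff.2 hdet
    exact hv (h1 v hv')
  set K := Finset.univ.filter fun a => A.mulVec (p a) = 0
  set T := Finset.univ.filter fun b => p b ∈ LinearMap.range A.mulVecLin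
  have hK : K.card ≤ d - 1 := hpw.card_le _ (hker A hA) K fun a ha => (Finset.mem_filter.1 ha).2
  have hT : T.card ≤ d - 1 := hpw.card_le _ hrange T fun a ha => (Finset.mem_filter.1 ha).2
  have hF : ∀ q, (Finset.univ.filter fun a => β a = q).card ≤ d - 1 := fun q =>
    hpw.card_le _ (hker (A' q) (hA' q)) _ fun a ha => by
      have := hfib a
      rw [(Finset.mem_filter.1 ha).2] at this
      exact this
  have hcov : (Finset.univ : Finset (L × Bool)) ⊆
      K ∪ T.biUnion fun q => Finset.univ.filter fun a => β a = q := by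
    intro a _
    by_cases ha : A.mulVec (p a) = 0
    · exact Finset.mem_union_left _ (Finset.mem_filter.2 ⟨Finset.mem_univ _, ha⟩)
    · refine Finset.mem_union_right _ (Finset.mem_biUnion.2 ⟨β a, Finset.mem_filter.2
        ⟨Finset.mem_univ _, ?_⟩, Finset.mem_filter.2 ⟨Finset.mem_univ _, rfl⟩⟩)
      obtain ⟨t, ht⟩ := hβ a
      have ht0 : t ≠ 0 := fun h => ha (by rw [ht, h, zero_smul])
      refine ⟨t⁻¹ • p a, ?_⟩
      rw [Matrix.mulVecLin_apply, Matrix.mulVec_smul, ht, inv_smul_smul₀ ht0]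
  have h1 := (Finset.card_le_card hcov).trans (Finset.card_union_le _ _)
  have h2 := Finset.card_biUnion_le_card_mul T (fun q => Finset.univ.filter fun a => β a = q)
    (d - 1) fun q _ => hF q
  rw [Finset.card_univ] at h1
  have h3 : T.card * (d - 1) ≤ (d - 1) ^ 2 := by
    rw [pow_two]
    exact Nat.mul_le_mul_right _ hT
  omega

end LinDyn

namespace LinDyn

open scoped Matrix.Norms.Elementwise
open FreeGroup (mk hd bar)

variable {d : ℕ} {Γ : Type*} [Group Γ] {ρ : Γ →* Matrix (Fin d) (Fin d) ℝ}

/-- If the normalized limit of group elements is invertible, then these elements are eventually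
constant. -/
theorem IsDenseRep.eventually_eq_of_det_ne_zero [Nonempty (Fin d)] (hρ : IsDenseRep ρ)
    {U : Ultrafilter ℕ} {y : ℕ → Γ} {A : Matrix (Fin d) (Fin d) ℝ}
    (hA : Tendsto (fun n => ‖ρ (y n)‖⁻¹ • ρ (y n)) U (𝓝 A)) (hdet : A.det ≠ 0) :
    ∃ g, ∀ᶠ n in U, y n = g := by
  have h1 : Tendsto (fun n => (‖ρ (y n)‖⁻¹) ^ d) U (𝓝 A.det) := by
    have hc : Continuous fun B : Matrix (Fin d) (Fin d) ℝ => B.det := continuous_id.matrix_det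
    have e := (hc.tendsto A).comp hA
    refine e.congr fun n => ?_
    simp [hρ.det_eq_one]
  have hd0 : d ≠ 0 := by
    rintro rfl
    exact isEmptyElim (Classical.arbitrary (Fin 0))
  have hpos : ∀ n, 0 < ‖ρ (y n)‖ := fun n => norm_pos_iff.2 (hρ.apply_ne_zero _)
  have hD : 0 < A.det := lt_of_le_of_ne
    (ge_of_tendsto' h1 fun n => by have := hpos n; positivity) hdet.symm
  refine U.exists_eventually_eq_of_mem (hρ.finite (max 1 (2 / A.det))) ?_
  filter_upwards [h1.eventually_const_lt (half_lt_self hD)] with n hn i j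
  refine (Matrix.norm_entry_le_entrywise_sup_norm (ρ (y n))).trans ?_
  rcases le_total ‖ρ (y n)‖ 1 with h2 | h2
  · exact h2.trans (le_max_left _ _)
  · refine le_trans ?_ (le_max_right _ _)
    have h3 : A.det / 2 < ‖ρ (y n)‖⁻¹ := hn.trans_le (pow_le_of_le_one (by positivity)
      (inv_le_one_of_one_le₀ h2) hd0)
    rw [← inv_div]
    exact (le_inv_comm₀ (by positivity) (hpos n)).1 h3.le

theorem IsConfiguration.false_of_permuting {L : Type*} [Fintype L] [DecidableEq L]
    {p w : L × Bool → Fin d → ℝ} (hpw : IsConfiguration p w) (hρ : IsDenseRep ρ)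
    (hcard : (d - 1) + (d - 1) ^ 2 < Fintype.card (L × Bool))
    {U : Ultrafilter ℕ} {c : ℕ → L × Bool → Γ} {r δ : ℕ → ℝ} (hr : Tendsto r U (𝓝 0))
    (hδ : Tendsto δ U (𝓝 0))
    (hlim : ∀ a, Tendsto (fun n => r n • ρ (c n a)) U (𝓝 (Matrix.vecMulVec (p a) (w a))))
    {y : ℕ → Γ} (hy : ∀ n, ∀ s : ℝ, ρ (y n) ≠ s • 1)
    (hmin : ∀ n q, ‖ρ (y n)‖ ≤ ‖ρ ((c n q)⁻¹ * y n)‖)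
    (hperm : ∀ n a, ∃ b b', b' ≠ bar b ∧ ∃ ξ, ξ ≠ 0 ∧ ξ ∈ nearLine (δ n) (p a) ∧
      (ρ (y n)).mulVec ξ ∈ nearLine (δ n) (p b) ∧
      (ρ ((c n b)⁻¹ * y n)).mulVec ξ ∈ nearLine (δ n) (p b')) : False := by
  obtain ⟨a₀⟩ : Nonempty (L × Bool) := Fintype.card_pos_iff.1 (by omega)
  have hne : Nonempty (Fin d) := by
    obtain ⟨i, -⟩ := Function.ne_iff.1 (hpw.ne_zero a₀)
    exact ⟨i⟩
  choose b b' hbb' ξ hξ0 hξ hξb hξb' using hperm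
  choose β hβ using fun a => U.exists_eventually_eq fun n => b n a
  choose β' hβ' using fun a => U.exists_eventually_eq fun n => b' n a
  have hββ' : ∀ a, β' a ≠ bar (β a) := fun a => by
    obtain ⟨n, h1, h2⟩ := ((hβ a).and (hβ' a)).exists
    rw [← h1, ← h2]
    exact hbb' n a
  obtain ⟨A, hA0, hA⟩ := U.exists_tendsto_normalize fun n => hρ.apply_ne_zero (y n)
  choose A' hA'0 hA' using fun q =>
    U.exists_tendsto_normalize fun n => hρ.apply_ne_zero ((c n q)⁻¹ * y n)
  have hAp : ∀ a, ∃ t : ℝ, A.mulVec (p a) = t • p (β a) := fun a => by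
    refine exists_smul_of_tendsto_nearLine hA (fun n => hξ0 n a) hδ (hpw.ne_zero a)
      (hpw.ne_zero (β a)) (Eventually.of_forall fun n => hξ n a) ?_
    filter_upwards [hβ a] with n hn
    rw [Matrix.smul_mulVec, ← hn]
    exact smul_mem_nearLine (hξb n a) _
  have hA'p : ∀ a, ∃ t : ℝ, (A' (β a)).mulVec (p a) = t • p (β' a) := fun a => by
    refine exists_smul_of_tendsto_nearLine (hA' (β a)) (fun n => hξ0 n a) hδ (hpw.ne_zero a)
      (hpw.ne_zero (β' a)) (Eventually.of_forall fun n => hξ n a) ?_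
    filter_upwards [hβ a, hβ' a] with n hn hn'
    rw [Matrix.smul_mulVec, ← hn, ← hn']
    exact smul_mem_nearLine (hξb' n a) _
  have hZ : ∀ q, Matrix.vecMulVec (p q) (w q) * A' q = 0 := by
    intro q
    have hc : Continuous fun z : Matrix (Fin d) (Fin d) ℝ × Matrix (Fin d) (Fin d) ℝ =>
        z.1 * z.2 := continuous_fst.matrix_mul continuous_snd
    have e1 := (hlim q).prodMk_nhds (hA' q)
    have e2 := (hc.tendsto (Matrix.vecMulVec (p q) (w q), A' q)).comp e1
    have e3 := e2.norm
    refine norm_le_zero_iff.1 (le_of_tendsto_of_tendsto' e3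
      (tendsto_zero_iff_abs_tendsto_zero r |>.1 hr) fun n => ?_)
    have e4 : (r n • ρ (c n q)) * (‖ρ ((c n q)⁻¹ * y n)‖⁻¹ • ρ ((c n q)⁻¹ * y n)) =
        (r n * ‖ρ ((c n q)⁻¹ * y n)‖⁻¹) • ρ (y n) := by
      rw [Matrix.smul_mul, Matrix.mul_smul, smul_smul, ← map_mul, mul_inv_cancel_left]
    refine (congrArg norm e4).trans_le ?_
    rw [norm_smul, norm_mul, norm_inv, norm_norm, Real.norm_eq_abs, mul_assoc, Function.comp]
    refine mul_le_of_le_one_right (abs_nonneg _) ?_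
    rw [inv_mul_le_iff₀ (norm_pos_iff.2 (hρ.apply_ne_zero _)), mul_one]
    exact hmin n q
  have hfib : ∀ a, (A' (β a)).mulVec (p a) = 0 := by
    intro a
    obtain ⟨t, ht⟩ := hA'p a
    have h1 := congrArg (fun B => B.mulVec (p a)) (hZ (β a))
    simp only [← Matrix.mulVec_mulVec, ht, Matrix.vecMulVec_mulVec, Matrix.zero_mulVec,
      dotProduct_smul, smul_eq_mul] at h1
    have h2 : t * (w (β a) ⬝ᵥ p (β' a)) = 0 := by
      by_contra h0
      have h3 : (t * (w (β a) ⬝ᵥ p (β' a))) • p (β a) = 0 := by simpa [or_comm] using h1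
      exact smul_ne_zero h0 (hpw.ne_zero _) h3
    rw [ht, (mul_eq_zero.1 h2).resolve_right (hpw.dot_ne_zero _ _ (hββ' a)), zero_smul]
  have hdet := hpw.det_ne_zero hcard hA0 hAp hA'0 hfib
  obtain ⟨g, hg⟩ := hρ.eventually_eq_of_det_ne_zero hA hdet
  have hAg : A = ‖ρ g‖⁻¹ • ρ g := by
    refine tendsto_nhds_unique hA (tendsto_const_nhds.congr' ?_)
    filter_upwards [hg] with n hn
    rw [hn]
  obtain ⟨s, hs⟩ := hpw.rigid A hdet fun a => ⟨β a, hAp a⟩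
  obtain ⟨n, hn⟩ := hg.exists
  refine hy n (‖ρ g‖ * s) ?_
  rw [hn, mul_smul, ← hs, hAg, smul_inv_smul₀ (norm_ne_zero_iff.2 (hρ.apply_ne_zero g))]

theorem IsConfiguration.eq_zero {L : Type*} [Fintype L] [DecidableEq L]
    {p w : L × Bool → Fin d → ℝ} (hpw : IsConfiguration p w)
    (hcard : d < Fintype.card (L × Bool)) (hd0 : d ≠ 0)
    (e : L × Bool) {M : Matrix (Fin d) (Fin d) ℝ} (h : ∀ b ≠ e, M.mulVec (p b) = 0) : M = 0 := by
  by_contra hM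
  have h1 := hpw.card_le (LinearMap.ker M.mulVecLin) (fun h => hM (by
    refine Matrix.toLin'.injective ?_
    rw [map_zero]
    exact LinearMap.ker_eq_top.1 h)) (Finset.univ.erase e)
      fun a ha => h a (Finset.ne_of_mem_erase ha)
  rw [Finset.card_erase_of_mem (Finset.mem_univ e), Finset.card_univ] at h1
  omega

/-- Sufficiently deep members of a sequence of ping-pong systems generate a free group whose
projective image is malnormal in a weak sense. -/
theorem IsConfiguration.exists_isPingPong {L : Type*} [Fintype L] [DecidableEq L]
    {p w : L × Bool → Fin d → ℝ} (hpw : IsConfiguration p w) (hρ : IsDenseRep ρ) (hd2 : 2 ≤ d)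
    (hcard : (d - 1) + (d - 1) ^ 2 < Fintype.card (L × Bool)) (hcard' : d < Fintype.card (L × Bool))
    (hL : ∀ a e : L × Bool, ∃ b, b ≠ a ∧ b ≠ e)
    {c : ℕ → L × Bool → Γ} {r : ℕ → ℝ} (hr : Tendsto r (hyperfilter ℕ : Filter ℕ) (𝓝 0))
    (hbar : ∀ n a, c n (bar a) = (c n a)⁻¹)
    (hlim : ∀ a, Tendsto (fun n => r n • ρ (c n a)) (hyperfilter ℕ : Filter ℕ)
      (𝓝 (Matrix.vecMulVec (p a) (w a)))) :
    ∃ n δ κ, IsPingPong ρ p (c n) (r n) δ κ ∧ ∀ g ∉ projSubgroup ρ (c n), ∃ a,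
      {v | hd v = some a ∧ g⁻¹ * wordHom (c n) v * g ∈ projSubgroup ρ (c n)}.Finite := by
  by_contra! hcon
  obtain ⟨κ, -, δ₀, hδ₀, hpp⟩ := exists_eventually_isPingPong hpw.ne_zero hbar hlim
    hpw.dot_ne_zero hpw.wedge_ne_zero fun e M => hpw.eq_zero hcard' (by omega) e
  have hk : ∀ k : ℕ, ∃ n, IsPingPong ρ p (c n) (r n) (min δ₀ (1 / ((k : ℝ) + 1))) κ ∧
      |r n| < 1 / ((k : ℝ) + 1) ∧
      ∀ a, dist (r n • ρ (c n a)) (Matrix.vecMulVec (p a) (w a)) < 1 / ((k : ℝ) + 1) := by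
    intro k
    have hk0 : (0 : ℝ) < 1 / ((k : ℝ) + 1) := by positivity
    have e1 := hpp _ (lt_min hδ₀ hk0) (min_le_left _ _)
    have e2 := (tendsto_zero_iff_abs_tendsto_zero r |>.1 hr).eventually_lt_const hk0
    have e3 := eventually_all.2 fun a => Metric.tendsto_nhds.1 (hlim a) _ hk0
    exact (e1.and (e2.and e3)).exists
  choose n hn hrn hcn using hk
  have h0 := tendsto_one_div_add_atTop_nhds_zero_nat (𝕜 := ℝ)
  choose g hg hinf using fun k => hcon (n k) _ _ (hn k)
  choose y hy1 hy2 hy3 using fun k => (hn k).exists_permuting hρ hL (hg k) (hinf k)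
  refine hpw.false_of_permuting hρ hcard (U := hyperfilter ℕ) (c := fun k => c (n k))
    (r := fun k => r (n k)) (δ := fun k : ℕ => min δ₀ (1 / ((k : ℝ) + 1))) ?_ ?_ (fun a => ?_)
    hy1 hy2 hy3
  · refine Tendsto.mono_left ?_ Nat.hyperfilter_le_atTop
    exact squeeze_zero_norm (fun k => (hrn k).le) h0
  · refine Tendsto.mono_left ?_ Nat.hyperfilter_le_atTop
    have := (tendsto_const_nhds (x := δ₀)).min h0
    rwa [min_eq_right hδ₀.le] at this
  · refine Tendsto.mono_left ?_ Nat.hyperfilter_le_atTop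
    refine tendsto_iff_dist_tendsto_zero.2 ?_
    exact squeeze_zero (fun k => dist_nonneg) (fun k => (hcn k a).le) h0

end LinDyn

namespace LinDyn

open scoped Matrix.Norms.Elementwise
open FreeGroup (mk hd bar)

variable {d : ℕ} {Γ : Type*} [Group Γ] {ρ : Γ →* Matrix (Fin d) (Fin d) ℝ}

open Classical in
theorem isConfiguration_of_isGenericPoint (hd2 : 2 ≤ d) {v : Fin d → ℝ}
    (hv : v ≠ 0) {w : Bool → Fin d → ℝ} {u : ℕ → Γ}
    (hu : ∀ n, IsGenericPoint ℝ (fun γ => (ρ γ).mulVec v) ((Finset.range n).image u) (u n))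
    (huw : ∀ i j, i ≠ j → ∀ ε, w ε ⬝ᵥ (ρ ((u i)⁻¹ * u j)).mulVec v ≠ 0)
    {L : Type*} {N : ℕ} (hN : d + 3 ≤ N) (e : L × Bool ≃ Fin N) :
    IsConfiguration (fun a => (ρ (u (e a))).mulVec v)
      (fun a => Matrix.vecMul (w a.2) (ρ (u (e (bar a)))⁻¹)) := by
  have hfr : Module.finrank ℝ (Fin d → ℝ) = d := Module.finrank_fin_fun ℝ
  have hp := isIndep_of_isGenericPoint hu
  have hinj : Function.Injective fun a => (e a : ℕ) := Fin.val_injective.comp e.injective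
  have h0 : ∀ a, (ρ (u (e a))).mulVec v ≠ 0 := fun a => mulVec_ne_zero _ hv
  refine ⟨h0, fun a b hab => ?_, fun a b hab h => ?_, fun W hW t ht => ?_, fun A hA hperm => ?_⟩
  · have h1 := huw (e (bar a)) (e b) (fun h => hab (hinj h).symm) a.2
    rwa [map_mul, ← Matrix.mulVec_mulVec, Matrix.dotProduct_mulVec] at h1
  · obtain ⟨t, ht⟩ := exists_smul_of_wedge_eq_zero (h0 a) h
    refine hab (hinj (hp.eq_of_mem (by rw [hfr]; exact hd2) (x := (ρ (u (e a))).mulVec v)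
      (Submodule.mem_span_singleton_self _) ?_))
    exact Submodule.mem_span_singleton.2 ⟨t, ht.symm⟩
  · have h1 := hp.card_le hW (t := t.image fun a => (e a : ℕ)) fun i hi => by
      obtain ⟨a, ha, rfl⟩ := Finset.mem_image.1 hi
      exact ht a ha
    rw [Finset.card_image_of_injective _ hinj] at h1
    have h2 := Submodule.finrank_lt hW
    rw [hfr] at h2
    omega
  · obtain ⟨s, hs⟩ := eq_smul_one_of_permutes (by rw [hfr]; exact hd2) hu (N := N)
      (by rw [hfr]; exact hN) (h := A.mulVecLin)
        (Matrix.mulVec_injective_of_isUnit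
          ((Matrix.isUnit_iff_isUnit_det A).2 hA.isUnit)) fun i hi => by
        obtain ⟨b, t, hb⟩ := hperm (e.symm ⟨i, hi⟩)
        rw [Equiv.apply_symm_apply] at hb
        exact ⟨e b, (e b).2, Submodule.mem_span_singleton.2 ⟨t, hb.symm⟩⟩
    refine ⟨s, Matrix.toLin'.injective ?_⟩
    rw [map_smul, Matrix.toLin'_one]
    exact hs

/-- A Zariski dense discrete group contains a nonabelian free group with a retraction from an
overgroup which is malnormal in a weak sense. -/
theorem IsDenseRep.exists_free (hρ : IsDenseRep ρ) (hd2 : 2 ≤ d) :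
    ∃ m ≥ 6, ∃ (Λ : Subgroup Γ) (ψ : Λ →* FreeGroup (Fin m)) (θ : FreeGroup (Fin m) →* Γ),
      (∀ w, ∃ h : θ w ∈ Λ, ψ ⟨θ w, h⟩ = w) ∧
      ∀ g ∉ Λ, ∃ a, {w | hd w = some a ∧ g⁻¹ * θ w * g ∈ Λ}.Finite := by
  classical
  obtain ⟨h, r, v, w, hv, hw, hr, hlim⟩ := hρ.exists_contracting hd2
  obtain ⟨u, hu, huw⟩ := hρ.exists_points hd2 hv hw
  set m := d ^ 2 + 6
  have hcard : Fintype.card (Fin m × Bool) = 2 * m := by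
    simp [mul_comm]
  have e : Fin m × Bool ≃ Fin (2 * m) := Fintype.equivFinOfCardEq hcard
  have hdd : d ≤ d ^ 2 := Nat.le_self_pow two_ne_zero d
  have hpw := isConfiguration_of_isGenericPoint (ρ := ρ) hd2 hv hu huw (N := 2 * m) (by omega) e
  set c : ℕ → Fin m × Bool → Γ := fun n a =>
    u (e a) * (bif a.2 then h n else (h n)⁻¹) * (u (e (bar a)))⁻¹
  have hbar : ∀ n a, c n (bar a) = (c n a)⁻¹ := by
    rintro n ⟨i, _ | _⟩ <;>
    simp only [c, bar, Bool.not_true, Bool.not_false, cond_true, cond_false, _root_.mul_inv_rev,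
      inv_inv, mul_assoc]
  have hclim : ∀ a, Tendsto (fun n => r n • ρ (c n a)) (hyperfilter ℕ : Filter ℕ)
      (𝓝 (Matrix.vecMulVec ((ρ (u (e a))).mulVec v)
        (Matrix.vecMul (w a.2) (ρ (u (e (bar a)))⁻¹)))) := by
    intro a
    have h1 := tendsto_mul_mul (hlim a.2) (ρ (u (e a))) (ρ (u (e (bar a)))⁻¹)
    rw [Matrix.mul_vecMulVec, Matrix.vecMulVec_mul] at h1
    refine h1.congr fun n => ?_
    rw [Matrix.mul_smul, Matrix.smul_mul, ← map_mul, ← map_mul]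
  have hle : (d - 1) + (d - 1) ^ 2 < Fintype.card (Fin m × Bool) := by
    have h1 : (d - 1) ^ 2 ≤ d ^ 2 := Nat.pow_le_pow_left (Nat.sub_le d 1) 2
    omega
  have hL : ∀ a e : Fin m × Bool, ∃ b, b ≠ a ∧ b ≠ e := by
    intro a e
    obtain ⟨b, hb⟩ := Finset.exists_mem_notMem_of_card_lt_card (s := {a, e})
      (t := (Finset.univ : Finset (Fin m × Bool))) (by
        have := Finset.card_le_two (a := a) (b := e)
        rw [Finset.card_univ]
        omega)
    simp only [Finset.mem_insert, Finset.mem_singleton, not_or] at hb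
    exact ⟨b, hb.2⟩
  obtain ⟨n, δ, κ, hpp, hfin⟩ := hpw.exists_isPingPong hρ hd2 hle (by omega) hL hr hbar hclim
  have hm : 0 < m := by omega
  obtain ⟨ψ, hψ⟩ := hpp.exists_retraction hρ hL (⟨0, hm⟩, true)
  exact ⟨m, by omega, projSubgroup ρ (c n), ψ, wordHom (c n), hψ, hfin⟩

end LinDyn

namespace LinDyn

/-- The real matrices of the elements of a subgroup of `SL_d(ℤ)`. -/
def intRep {d : ℕ} (Γ : Subgroup (Matrix.SpecialLinearGroup (Fin d) ℤ)) :
    Γ →* Matrix (Fin d) (Fin d) ℝ where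
  toFun γ := (γ : Matrix (Fin d) (Fin d) ℤ).map (Int.castRingHom ℝ)
  map_one' := by simp
  map_mul' γ γ' := by
    rw [Subgroup.coe_mul, Matrix.SpecialLinearGroup.coe_mul, Matrix.map_mul]

theorem isDenseRep_intRep {d : ℕ} {Γ : Subgroup (Matrix.SpecialLinearGroup (Fin d) ℤ)}
    (hΓ : ZariskiDense d Γ) : IsDenseRep (intRep Γ) where
  det_eq_one γ := by
    have h := (Int.castRingHom ℝ).map_det (γ : Matrix (Fin d) (Fin d) ℤ)
    rw [Matrix.SpecialLinearGroup.det_coe, map_one] at h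
    exact h.symm
  finite R := by
    have hinj : Function.Injective fun γ : Γ => (γ : Matrix (Fin d) (Fin d) ℤ) :=
      Subtype.val_injective.comp Subtype.val_injective
    have hfin : {B : Matrix (Fin d) (Fin d) ℤ | ∀ i j, |(B i j : ℝ)| ≤ R}.Finite := by
      have h : (Set.univ.pi fun _ : Fin d => Set.univ.pi fun _ : Fin d =>
        Set.Icc (-⌊R⌋) ⌊R⌋).Finite :=
        Set.Finite.pi fun _ => Set.Finite.pi fun _ => Set.finite_Icc _ _
      refine h.subset fun B hB => ?_
      refine Set.mem_univ_pi.2 fun i => Set.mem_univ_pi.2 fun j => Set.mem_Icc.2 (abs_le.1 ?_)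
      rw [Int.le_floor, Int.cast_abs]
      exact hB i j
    exact (hfin.preimage (f := fun γ : Γ => (γ : Matrix (Fin d) (Fin d) ℤ)) hinj.injOn).subset
      fun γ hγ => hγ
  dense P hP A hA := hΓ P (fun γ hγ => hP ⟨γ, hγ⟩) ⟨A, hA⟩

end LinDyn

/-- Theorem (main, part (2)): for a countably infinite Zariski dense subgroup
`Γ ≤ SL_d(ℤ)` (`d ≥ 2`), there is a free p.m.p. action `β` of `Γ` on an atomless standard
probability space such that multiplication by (the weak equivalence class of) `β` is
discontinuous: there are free p.m.p. actions `α_i`, `α` of `Γ` on atomless standard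
probability spaces with `C(α_i,S,k) → C(α,S,k)` in the Hausdorff metric for all finite
`S ⊆ Γ` and all `k ∈ ℕ⁺`, while for some `S`, `k` the distances
`dist_H(C(α_i×β,S,k), C(α×β,S,k))` do not tend to `0`. -/
theorem multiplication_by_fixed_class_discontinuous
    (d : ℕ) (hd : 2 ≤ d)
    (Γ : Subgroup (Matrix.SpecialLinearGroup (Fin d) ℤ))
    (hinf : Infinite ↥Γ) (hZD : ZariskiDense d Γ) :
    ∃ β : PMP ↥Γ,
      StandardBorelSpace β.X ∧ NoAtoms β.μ ∧ β.Free ∧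
      ∃ (A : ℕ → PMP ↥Γ) (α : PMP ↥Γ),
        (∀ i, StandardBorelSpace (A i).X) ∧ StandardBorelSpace α.X ∧
        (∀ i, NoAtoms (A i).μ) ∧ NoAtoms α.μ ∧
        (∀ i, (A i).Free) ∧ α.Free ∧
        (∀ (S : Finset ↥Γ) (k : ℕ), 0 < k →
          Tendsto (fun i => Metric.hausdorffDist ((A i).C S k) (α.C S k)) atTop (𝓝 0)) ∧
        (∃ (S : Finset ↥Γ) (k : ℕ), 0 < k ∧
          ¬ Tendsto (fun i =>
              Metric.hausdorffDist (((A i).prod β).C S k) ((α.prod β).C S k))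
            atTop (𝓝 0)) := by
  obtain ⟨m, hm, Λ, ψ, θ, hθ, hfin⟩ := (LinDyn.isDenseRep_intRep hZD).exists_free hd
  have : Countable (Matrix.SpecialLinearGroup (Fin d) ℤ) :=
    Function.Injective.countable (β := Fin d → Fin d → ℤ) (f := fun A => A.1)
      Subtype.val_injective
  exact exists_discontinuous_of_free hm ψ θ hθ hfin
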